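/- Let Γ be a non-elementary hyperbolic group and μ a finitely supported symmetric probability measure on Γ whose support generates Γ. Then the associated Green metric d_G is a left-invariant hyperbolic metric on Γ quasi-isometric to Γ (i.e. to a word metric), and for every sufficiently small ε>0 the harmonic measure is Ahlfors regular of dimension 1/ε when ∂Γ is endowed with a visual metric d_ε^G of parameter ε induced by d_G. -/

import Mathlib

open Filter MeasureTheory Topology Metric Set
open scoped ENNReal

noncomputable section

namespace GHM

/-! ### Coarse geometry of distance functions -/

/-- The Gromov product `(x|y)_w` of `x` and `y` seen from `w`, for a distance function `d`. -/
def gromov {X : Type*} (d : X → X → ℝ) (w x y : X) : ℝ :=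
  (d x w + d y w - d x y) / 2

/-- `d` is `δ`-hyperbolic (four point condition on Gromov products). -/
def IsHyperbolicWith {X : Type*} (d : X → X → ℝ) (δ : ℝ) : Prop :=
  ∀ w x y z : X, min (gromov d w x y) (gromov d w x z) - δ ≤ gromov d w y z

/-- `d` is Gromov hyperbolic. -/
def IsHyperbolic {X : Type*} (d : X → X → ℝ) : Prop :=
  ∃ δ : ℝ, 0 ≤ δ ∧ IsHyperbolicWith d δ

/-- `d` is a genuine metric. -/
structure IsMetricFun {X : Type*} (d : X → X → ℝ) : Prop where
  refl : ∀ x, d x x = 0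
  pos : ∀ x y, x ≠ y → 0 < d x y
  symm : ∀ x y, d x y = d y x
  triangle : ∀ x y z, d x z ≤ d x y + d y z

/-- `f` is a `(Λ,c)`-quasi-isometric embedding from `(X,dX)` to `(Y,dY)`. -/
def QIEmbed {X Y : Type*} (dX : X → X → ℝ) (dY : Y → Y → ℝ)
    (f : X → Y) (Λ c : ℝ) : Prop :=
  ∀ x x' : X, dX x x' / Λ - c ≤ dY (f x) (f x') ∧ dY (f x) (f x') ≤ Λ * dX x x' + c

/-- `(X,dX)` and `(Y,dY)` are quasi-isometric. -/
def QuasiIsometric {X Y : Type*} (dX : X → X → ℝ) (dY : Y → Y → ℝ) : Prop :=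
  ∃ (f : X → Y) (Λ c C : ℝ), 1 ≤ Λ ∧ 0 ≤ c ∧ 0 ≤ C ∧
    QIEmbed dX dY f Λ c ∧ ∀ y : Y, ∃ x : X, dY (f x) y ≤ C

variable {G : Type*} [Group G]

/-- Word length of `g` with respect to the (symmetrized) finite set `S`. -/
def wordLength (S : Finset G) (g : G) : ℕ :=
  sInf {n : ℕ | ∃ l : List G, l.length = n ∧ (∀ a ∈ l, a ∈ S ∨ a⁻¹ ∈ S) ∧ l.prod = g}

/-- The word metric associated with a finite generating set `S`. -/
def wordDist (S : Finset G) (x y : G) : ℝ := wordLength S (x⁻¹ * y)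

/-- `S` generates the group. -/
def Generates (S : Finset G) : Prop := Subgroup.closure (S : Set G) = ⊤

/-- The standard metric on `ℤ`. -/
def intDist (m n : ℤ) : ℝ := |(m : ℝ) - (n : ℝ)|

/-- `G` is a non-elementary hyperbolic group: finitely generated, its word metrics are
Gromov hyperbolic, it is infinite, and it is not quasi-isometric to `ℤ`. -/
def NonElemHyperbolic (G : Type*) [Group G] : Prop :=
  Infinite G ∧ (∃ S : Finset G, Generates S) ∧
    ∀ S : Finset G, Generates S →
      IsHyperbolic (wordDist S) ∧ ¬ QuasiIsometric (wordDist S) intDist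

/-- `d` is invariant under left translations. -/
def LeftInvariant (d : G → G → ℝ) : Prop := ∀ g x y : G, d (g * x) (g * y) = d x y

/-- `d` belongs to the class `𝒟(Γ)`: it is a left-invariant Gromov hyperbolic metric on the
group, quasi-isometric to a word metric of a finite generating set. -/
def MemD (d : G → G → ℝ) : Prop :=
  IsMetricFun d ∧ LeftInvariant d ∧ IsHyperbolic d ∧
    ∃ S : Finset G, Generates S ∧ QuasiIsometric d (wordDist S)

/-! ### Random walks -/

/-- `μ` is (the density of) a probability measure on the (countable) group. -/
def IsProbDensity (μ : G → ℝ) : Prop := (∀ g, 0 ≤ μ g) ∧ HasSum μ 1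

/-- `μ` is symmetric. -/
def IsSymmetric (μ : G → ℝ) : Prop := ∀ g : G, μ g⁻¹ = μ g

/-- The support of `μ` generates `G`. -/
def GeneratesSupp (μ : G → ℝ) : Prop := Subgroup.closure {g : G | μ g ≠ 0} = ⊤

open scoped Classical in
/-- Convolution powers `μ^n` of `μ`. -/
def convPow (μ : G → ℝ) : ℕ → G → ℝ
  | 0 => fun g => if g = 1 then 1 else 0
  | n + 1 => fun g => ∑' y : G, convPow μ n y * μ (y⁻¹ * g)

/-- The Green function `G(x,y) = ∑_n μ^n(x⁻¹y)`. -/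
def greenFn (μ : G → ℝ) (x y : G) : ℝ := ∑' n : ℕ, convPow μ n (x⁻¹ * y)

/-- The random walk is transient, i.e. `G(e,e) = ∑_n μ^n(e) < ∞`. -/
def Transient (μ : G → ℝ) : Prop := Summable fun n : ℕ => convPow μ n (1 : G)

/-- Successive positions of a walk started at `x` with increments `l`. -/
def walkPositions (x : G) (l : List G) : List G := l.scanl (fun p a => p * a) x

/-- The increments `l` describe a trajectory from `x` which hits `y` for the first time at
its final position. -/
def IsFirstHitPath (x y : G) (l : List G) : Prop :=
  (walkPositions x l).getLast? = some y ∧ y ∉ (walkPositions x l).dropLast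

/-- `F(x,y)`: the probability that the `μ`-random walk started at `x` ever hits `y`. -/
def hitProb (μ : G → ℝ) (x y : G) : ℝ :=
  ∑' l : {l : List G // IsFirstHitPath x y l}, ((l : List G).map μ).prod

/-- The Green metric `d_G(x,y) = - log F(x,y)`. -/
def greenDist (μ : G → ℝ) (x y : G) : ℝ := - Real.log (hitProb μ x y)

/-- `μ` has a finite first moment with respect to `d`. -/
def FiniteFirstMoment (d : G → G → ℝ) (μ : G → ℝ) : Prop :=
  Summable fun g : G => d 1 g * μ g

/-- `μ` has an exponential moment with respect to `d`. -/
def HasExpMoment (d : G → G → ℝ) (μ : G → ℝ) : Prop :=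
  ∃ lam : ℝ, 0 < lam ∧ Summable fun g : G => Real.exp (lam * d 1 g) * μ g

/-- The entropy `H(μ^n) = -∑_γ μ^n(γ) log μ^n(γ)` of the `n`-th convolution power. -/
def entropyAt (μ : G → ℝ) (n : ℕ) : ℝ :=
  - ∑' g : G, convPow μ n g * Real.log (convPow μ n g)

/-- `h` is the asymptotic entropy of the walk. -/
def HasEntropy (μ : G → ℝ) (h : ℝ) : Prop :=
  Tendsto (fun n : ℕ => entropyAt μ n / n) atTop (𝓝 h)

/-- `v` is the logarithmic volume growth of `(G,d)` (seen from the identity). -/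
def HasGrowth (d : G → G → ℝ) (v : ℝ) : Prop :=
  Filter.limsup (fun R : ℝ => Real.log (Nat.card {g : G // d 1 g ≤ R}) / R) atTop = v

/-- The position `Z_n = ω_0 ω_1 ⋯ ω_{n-1}` of the random walk at time `n`, given the
sequence of increments `ω`. -/
def walkPos (n : ℕ) (ω : ℕ → G) : G := ((List.range n).map ω).prod

/-- `P` is the law on the space of increment sequences of an i.i.d. sequence of law `μ`:
cylinders have product measure.  (This characterizes the path measure of the random walk.) -/
def IsWalkMeasure [MeasurableSpace G] (μ : G → ℝ) (P : Measure (ℕ → G)) : Prop :=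
  IsProbabilityMeasure P ∧
    ∀ (n : ℕ) (g : Fin n → G),
      P {ω : ℕ → G | ∀ i : Fin n, ω (i : ℕ) = g i} = ∏ i : Fin n, ENNReal.ofReal (μ (g i))

/-! ### The Gromov boundary, visual metrics, harmonic and quasiconformal measures -/

/-- A sequence tends to infinity if Gromov products (at the base point `1`) go to `∞`. -/
def TendstoInfinity (d : G → G → ℝ) (u : ℕ → G) : Prop :=
  Tendsto (fun p : ℕ × ℕ => gromov d 1 (u p.1) (u p.2)) atTop atTop

/-- A realization of the Gromov boundary of `(G,d)` as an abstract type `B`: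
`conv u b` means that the sequence `u` converges at infinity to the boundary point `b`.
The group acts on its boundary by `smul`. -/
structure BoundaryData (G : Type*) [Group G] (d : G → G → ℝ) (B : Type*) where
  conv : (ℕ → G) → B → Prop
  smul : G → B → B
  conv_unique : ∀ u b b', conv u b → conv u b' → b = b'
  exists_conv : ∀ u, TendstoInfinity d u → ∃ b, conv u b
  conv_tendstoInfinity : ∀ u b, conv u b → TendstoInfinity d u
  conv_iff : ∀ u v b, conv u b →
    (conv v b ↔ Tendsto (fun n => gromov d 1 (u n) (v n)) atTop atTop)
  conv_surj : ∀ b, ∃ u, conv u b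
  smul_conv : ∀ (γ : G) (u) (b), conv u b → conv (fun n => γ * u n) (smul γ b)

/-- Asymptotic Gromov product of two sequences. -/
def seqGromov (d : G → G → ℝ) (u v : ℕ → G) : ℝ :=
  Filter.liminf (fun n => gromov d 1 (u n) (v n)) atTop

/-- The metric of `B` is a visual metric of parameter `ε` (with comparison constant `C`)
for the hyperbolic distance `d` on the group:  `dist(a,b) ≍ exp(-ε (a|b))`. -/
def IsVisualMetric {B : Type*} [MetricSpace B] (d : G → G → ℝ)
    (bd : BoundaryData G d B) (ε C : ℝ) : Prop :=
  0 < ε ∧ 0 < C ∧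
    ∀ u v b b', bd.conv u b → bd.conv v b' → b ≠ b' →
      dist b b' ≤ C * Real.exp (-ε * seqGromov d u v) ∧
      Real.exp (-ε * seqGromov d u v) ≤ C * dist b b'

/-- `ν` is the harmonic measure of the random walk of law `μ` on the boundary `B`:
it is the law of the almost sure limit `Z_∞` of the walk on the boundary. -/
def IsHarmonicMeasure {B : Type*} [MeasurableSpace G] [MeasurableSpace B]
    (d : G → G → ℝ) (bd : BoundaryData G d B) (μ : G → ℝ)
    (P : Measure (ℕ → G)) (ν : Measure B) : Prop :=
  IsWalkMeasure μ P ∧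
    ∃ Zinf : (ℕ → G) → B, Measurable Zinf ∧
      (∀ᵐ ω ∂P, bd.conv (fun n => walkPos n ω) (Zinf ω)) ∧ ν = P.map Zinf

/-- Busemann function `β_b(x,y)` of the boundary point `b`. -/
def busemann {B : Type*} (d : G → G → ℝ) (bd : BoundaryData G d B)
    (x y : G) (b : B) : ℝ :=
  sSup {t : ℝ | ∃ u, bd.conv u b ∧
    t = Filter.limsup (fun n => d x (u n) - d y (u n)) atTop}

/-- The image measure `γ^*ρ`, `γ^*ρ(A) = ρ(γA)`. -/
def actPush {B : Type*} [MeasurableSpace B] {d : G → G → ℝ}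
    (bd : BoundaryData G d B) (γ : G) (ρ : Measure B) : Measure B :=
  ρ.map (bd.smul γ⁻¹)

/-- `ρ` is a quasiconformal measure on the boundary for `(G,d)` of logarithmic growth
parameter `v`: `γ^*ρ` and `ρ` are mutually absolutely continuous, with density
`dγ^*ρ/dρ ≍ exp (v β_b(1,γ⁻¹))` (uniformly in `γ`). -/
def IsQuasiconformalMeasure {B : Type*} [MeasurableSpace B] {d : G → G → ℝ}
    (bd : BoundaryData G d B) (ρ : Measure B) (v : ℝ) : Prop :=
  ∃ C : ℝ, 0 < C ∧ ∀ γ : G,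
    actPush bd γ ρ ≪ ρ ∧ ρ ≪ actPush bd γ ρ ∧
      ∀ᵐ b ∂ρ,
        (actPush bd γ ρ).rnDeriv ρ b
            ≤ ENNReal.ofReal (C * Real.exp (v * busemann d bd 1 γ⁻¹ b)) ∧
        ENNReal.ofReal (C⁻¹ * Real.exp (v * busemann d bd 1 γ⁻¹ b))
            ≤ (actPush bd γ ρ).rnDeriv ρ b

/-- `ν` is Ahlfors regular of dimension `α`: `ν(B(b,r)) ≍ r^α`. -/
def AhlforsRegularOfDim {B : Type*} [MetricSpace B] [MeasurableSpace B]
    (ν : Measure B) (α : ℝ) : Prop :=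
  ∃ C : ℝ, 0 < C ∧ ∀ (b : B) (r : ℝ), 0 < r → r ≤ Metric.diam (Set.univ : Set B) →
    ENNReal.ofReal (C⁻¹ * r ^ α) ≤ ν (Metric.ball b r) ∧
      ν (Metric.ball b r) ≤ ENNReal.ofReal (C * r ^ α)

/-- The Hausdorff dimension of a measure: the infimum of the Hausdorff dimensions of sets of
full measure. -/
def measureDim {B : Type*} [EMetricSpace B] [MeasurableSpace B] (ν : Measure B) : ℝ≥0∞ :=
  ⨅ (A : Set B) (_ : ν Aᶜ = 0), dimH A

/-! ### Word geodesics -/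

/-- `p 0, …, p n` is a geodesic segment for the word metric of `S`. -/
def IsWordGeodesic (S : Finset G) (n : ℕ) (p : ℕ → G) : Prop :=
  ∀ i j : ℕ, i ≤ n → j ≤ n → wordDist S (p i) (p j) = |(i : ℝ) - (j : ℝ)|

/-- `v` lies within distance `r` of some word geodesic segment from `x` to `y`. -/
def NearWordGeodesic (S : Finset G) (x y v : G) (r : ℝ) : Prop :=
  ∃ (n : ℕ) (p : ℕ → G), IsWordGeodesic S n p ∧ p 0 = x ∧ p n = y ∧
    ∃ i ≤ n, wordDist S v (p i) ≤ r

/-! ### Martin boundary -/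

/-- The Martin kernel `K(x,y) = G(x,y)/G(e,y)`. -/
def martinKernel (μ : G → ℝ) (x y : G) : ℝ := greenFn μ x y / greenFn μ 1 y

/-- The embedding `y ↦ K(·,y)` of the group in `C(G)` (pointwise topology). -/
def martinMap (μ : G → ℝ) (y : G) : G → ℝ := fun x => martinKernel μ x y

/-- The Martin boundary: the boundary of the image of the group under the Martin embedding
in the space of functions with the topology of pointwise convergence. -/
def martinBoundary (μ : G → ℝ) : Set (G → ℝ) :=
  closure (Set.range (martinMap μ)) \ Set.range (martinMap μ)

/-- `h` is a `μ`-harmonic function. -/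
def IsHarmonicFn (μ : G → ℝ) (h : G → ℝ) : Prop :=
  ∀ x : G, h x = ∑' y : G, h y * μ (x⁻¹ * y)

/-- `h` is a minimal positive harmonic function. -/
def IsMinimalHarmonic (μ : G → ℝ) (h : G → ℝ) : Prop :=
  IsHarmonicFn μ h ∧ (∀ x, 0 < h x) ∧
    ∀ u : G → ℝ, IsHarmonicFn μ u → (∀ x, 0 ≤ u x) → (∀ x, u x ≤ h x) →
      ∃ c : ℝ, u = fun x => c * h x

/-! ### Metric space versions (geodesic and quasiruled spaces) -/

/-- A geodesic metric space. -/
def IsGeodesicSpace (X : Type*) [MetricSpace X] : Prop :=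
  ∀ x y : X, ∃ f : ℝ → X, f 0 = x ∧ f (dist x y) = y ∧
    ∀ s ∈ Set.Icc (0:ℝ) (dist x y), ∀ t ∈ Set.Icc (0:ℝ) (dist x y),
      dist (f s) (f t) = |s - t|

/-- `f : [a,b] → Y` is a `(Λ,c)`-quasigeodesic segment. -/
def IsQuasigeodesicOn {Y : Type*} [MetricSpace Y] (f : ℝ → Y) (a b Λ c : ℝ) : Prop :=
  ∀ s ∈ Set.Icc a b, ∀ t ∈ Set.Icc a b,
    |s - t| / Λ - c ≤ dist (f s) (f t) ∧ dist (f s) (f t) ≤ Λ * |s - t| + c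

/-- `f : [a,b] → Y` is a `τ`-quasiruler: Gromov products of triples along it are `≤ τ`. -/
def IsQuasirulerOn {Y : Type*} [MetricSpace Y] (f : ℝ → Y) (a b τ : ℝ) : Prop :=
  ∀ s t u : ℝ, s ∈ Set.Icc a b → t ∈ Set.Icc a b → u ∈ Set.Icc a b → s ≤ t → t ≤ u →
    dist (f s) (f t) + dist (f t) (f u) ≤ dist (f s) (f u) + 2 * τ

/-- A quasiruled metric space: for some constants `(Λ,c,τ)` every pair of points is joined
by a `(Λ,c)`-quasigeodesic, and every `(Λ,c)`-quasigeodesic is a `τ`-quasiruler. -/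
def Quasiruled (Y : Type*) [MetricSpace Y] : Prop :=
  ∃ Λ c τ : ℝ, 1 ≤ Λ ∧ 0 ≤ c ∧ 0 ≤ τ ∧
    (∀ x y : Y, ∃ (a b : ℝ) (f : ℝ → Y), a ≤ b ∧ f a = x ∧ f b = y ∧
      IsQuasigeodesicOn f a b Λ c) ∧
    ∀ (f : ℝ → Y) (a b : ℝ), IsQuasigeodesicOn f a b Λ c → IsQuasirulerOn f a b τ

/-- A metric space is hyperbolic. -/
def HypSpace (Y : Type*) [MetricSpace Y] : Prop :=
  IsHyperbolic (fun x y : Y => dist x y)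

/-- `f` is a quasi-isometry between metric spaces. -/
def MetricQI {X Y : Type*} [MetricSpace X] [MetricSpace Y] (f : X → Y) : Prop :=
  ∃ Λ c C : ℝ, 1 ≤ Λ ∧ 0 ≤ c ∧ 0 ≤ C ∧
    QIEmbed (fun a b : X => dist a b) (fun a b : Y => dist a b) f Λ c ∧
    ∀ y : Y, ∃ x : X, dist (f x) y ≤ C




/-! ### Part A : word metric basics -/

theorem wl_le (S : Finset G) (l : List G) (hl : ∀ a ∈ l, a ∈ S ∨ a⁻¹ ∈ S) :
    wordLength S l.prod ≤ l.length :=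
  Nat.sInf_le ⟨l, rfl, hl, rfl⟩

theorem wl_exists {S : Finset G} (hS : Generates S) (g : G) :
    ∃ l : List G, l.length = wordLength S g ∧ (∀ a ∈ l, a ∈ S ∨ a⁻¹ ∈ S) ∧ l.prod = g := by
  have hne : {n : ℕ | ∃ l : List G, l.length = n ∧ (∀ a ∈ l, a ∈ S ∨ a⁻¹ ∈ S) ∧
      l.prod = g}.Nonempty := by
    have hg : g ∈ Subgroup.closure (S : Set G) := by
      unfold Generates at hS; rw [hS]; trivial
    rw [← Subgroup.mem_toSubmonoid, Subgroup.closure_toSubmonoid] at hg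
    obtain ⟨l, hl, hp⟩ := Submonoid.exists_list_of_mem_closure hg
    exact ⟨l.length, l, rfl, fun a ha => by simpa using hl a ha, hp⟩
  exact Nat.sInf_mem hne

theorem wl_one (S : Finset G) : wordLength S (1 : G) = 0 := by
  have := wl_le S ([] : List G) (by simp)
  simpa using this

theorem wl_mul {S : Finset G} (hS : Generates S) (g h : G) :
    wordLength S (g * h) ≤ wordLength S g + wordLength S h := by
  obtain ⟨l, h1, h2, h3⟩ := wl_exists hS g
  obtain ⟨l', h1', h2', h3'⟩ := wl_exists hS h
  have := wl_le S (l ++ l') (by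
    intro a ha
    rcases List.mem_append.1 ha with h | h
    · exact h2 a h
    · exact h2' a h)
  rw [List.prod_append, h3, h3', List.length_append, h1, h1'] at this
  exact this

theorem wl_inv_le {S : Finset G} (hS : Generates S) (g : G) :
    wordLength S g⁻¹ ≤ wordLength S g := by
  obtain ⟨l, h1, h2, h3⟩ := wl_exists hS g
  have := wl_le S ((l.map fun x => x⁻¹).reverse) (by
    intro a ha
    simp only [List.mem_reverse, List.mem_map] at ha
    obtain ⟨b, hb, rfl⟩ := ha
    rcases h2 b hb with h | h
    · right; simpa using h
    · left; exact h)
  rw [← List.prod_inv_reverse, h3] at this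
  simpa [h1] using this

theorem wl_inv {S : Finset G} (hS : Generates S) (g : G) :
    wordLength S g⁻¹ = wordLength S g :=
  le_antisymm (wl_inv_le hS g) (by simpa using wl_inv_le hS g⁻¹)

theorem wl_mem_le {S : Finset G} {s : G} (hs : s ∈ S) : wordLength S s ≤ 1 := by
  have := wl_le S [s] (by simp [hs])
  simpa using this

/-- geodesic path from `1` to `g`. -/
theorem wl_geodesic {S : Finset G} (hS : Generates S) (g : G) :
    ∃ p : ℕ → G, p 0 = 1 ∧ p (wordLength S g) = g ∧
      ∀ i j, i ≤ j → j ≤ wordLength S g → wordLength S ((p i)⁻¹ * p j) = j - i := by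
  obtain ⟨l, h1, h2, h3⟩ := wl_exists hS g
  have key : ∀ i j, i ≤ j → wordLength S (((l.take i).prod)⁻¹ * (l.take j).prod) ≤ j - i := by
    intro i j hij
    have e : ((l.take i).prod)⁻¹ * (l.take j).prod = ((l.drop i).take (j - i)).prod := by
      have : l.take j = l.take i ++ (l.drop i).take (j - i) := by
        rw [← List.take_add]; congr 1; omega
      rw [this, List.prod_append]; group
    rw [e]
    refine (wl_le S _ ?_).trans ?_
    · intro a ha
      exact h2 a (List.mem_of_mem_drop (List.mem_of_mem_take ha))
    · simp only [List.length_take]; exact min_le_left _ _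
  refine ⟨fun i => (l.take i).prod, by simp, ?_, ?_⟩
  · simp only []
    rw [← h1, List.take_length, h3]
  · intro i j hij hj
    refine le_antisymm (key i j hij) ?_
    have hA := key 0 i (Nat.zero_le _)
    have hB := key j (wordLength S g) hj
    rw [← h1, List.take_length, h3, h1] at hB
    simp only [List.take_zero, List.prod_nil, inv_one, one_mul] at hA
    have e : g = (l.take i).prod * ((((l.take i).prod)⁻¹ * (l.take j).prod) *
        (((l.take j).prod)⁻¹ * g)) := by group
    have h4 := wl_mul hS (l.take i).prod ((((l.take i).prod)⁻¹ * (l.take j).prod) *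
        (((l.take j).prod)⁻¹ * g))
    have h5 := wl_mul hS (((l.take i).prod)⁻¹ * (l.take j).prod) (((l.take j).prod)⁻¹ * g)
    rw [← e] at h4
    simp only []
    omega

theorem wl_prefix {S : Finset G} (hS : Generates S) (g : G) (k : ℕ) (hk : k ≤ wordLength S g) :
    ∃ h, wordLength S h = k ∧ wordLength S (h⁻¹ * g) = wordLength S g - k := by
  obtain ⟨p, h0, hn, hp⟩ := wl_geodesic hS g
  refine ⟨p k, ?_, ?_⟩
  · have := hp 0 k (Nat.zero_le _) hk
    simpa [h0] using this
  · have := hp k _ hk le_rfl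
    rwa [hn] at this

theorem wl_eq_zero {S : Finset G} (hS : Generates S) {g : G} (h : wordLength S g = 0) : g = 1 := by
  obtain ⟨l, h1, h2, h3⟩ := wl_exists hS g
  rw [h, List.length_eq_zero_iff] at h1
  rw [← h3, h1]; simp

theorem ball_finite {S : Finset G} (hS : Generates S) (n : ℕ) :
    {g : G | wordLength S g ≤ n}.Finite := by
  induction n with
  | zero =>
    refine (Set.finite_singleton (1 : G)).subset ?_
    intro g hg
    exact wl_eq_zero hS (Nat.le_zero.1 hg)
  | succ n ih =>
    have hT : ({g : G | wordLength S g ≤ 1} : Set G).Finite := by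
      have : ((S : Set G) ∪ (fun x => x⁻¹) '' (S : Set G) ∪ {1}).Finite :=
        ((S.finite_toSet.union (S.finite_toSet.image _)).union (Set.finite_singleton _))
      refine this.subset ?_
      intro g hg
      obtain ⟨l, h1, h2, h3⟩ := wl_exists hS g
      have hg : wordLength S g ≤ 1 := hg
      rcases Nat.le_one_iff_eq_zero_or_eq_one.1 hg with h | h
      · right; exact wl_eq_zero hS h
      · rw [h, List.length_eq_one_iff] at h1
        obtain ⟨a, rfl⟩ := h1
        left
        simp only [List.prod_singleton] at h3
        subst h3
        rcases h2 a (by simp) with h | h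
        · left; exact h
        · right; exact ⟨a⁻¹, h, by simp⟩
    refine (ih.union (Set.Finite.image2 (fun a b => a * b) ih hT)).subset ?_
    intro g hg
    have hg : wordLength S g ≤ n + 1 := hg
    by_cases h : wordLength S g ≤ n
    · left; exact h
    · right
      obtain ⟨k, hk1, hk2⟩ := wl_prefix hS g n (by omega)
      exact ⟨k, by simp [hk1], k⁻¹ * g, by simp only [mem_ofPred_eq]; omega, by simp⟩

theorem wd_self (S : Finset G) (x : G) : wordDist S x x = 0 := by
  simp [wordDist, wl_one]

theorem wd_nonneg (S : Finset G) (x y : G) : 0 ≤ wordDist S x y := by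
  simp [wordDist]

theorem wd_symm {S : Finset G} (hS : Generates S) (x y : G) :
    wordDist S x y = wordDist S y x := by
  unfold wordDist
  rw [← wl_inv hS]; simp

theorem wd_tri {S : Finset G} (hS : Generates S) (x y z : G) :
    wordDist S x z ≤ wordDist S x y + wordDist S y z := by
  unfold wordDist
  have := wl_mul hS (x⁻¹ * y) (y⁻¹ * z)
  rw [show x⁻¹ * y * (y⁻¹ * z) = x⁻¹ * z by group] at this
  exact_mod_cast this

theorem wd_left (S : Finset G) (g x y : G) : wordDist S (g * x) (g * y) = wordDist S x y := by
  unfold wordDist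
  congr 2; group

theorem wd_one (S : Finset G) (x : G) : wordDist S 1 x = wordLength S x := by
  simp [wordDist]

theorem wd_one' {S : Finset G} (hS : Generates S) (x : G) : wordDist S x 1 = wordLength S x := by
  rw [wd_symm hS, wd_one]

/-- geodesic path from `x` to `y`. -/
theorem wd_geodesic {S : Finset G} (hS : Generates S) (x y : G) :
    ∃ (n : ℕ) (p : ℕ → G), (n : ℝ) = wordDist S x y ∧ p 0 = x ∧ p n = y ∧
      ∀ i j, i ≤ j → j ≤ n → wordDist S (p i) (p j) = (j : ℝ) - i := by
  obtain ⟨p, h0, hn, hp⟩ := wl_geodesic hS (x⁻¹ * y)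
  refine ⟨wordLength S (x⁻¹ * y), fun i => x * p i, rfl, by simp [h0], by simp [hn], ?_⟩
  intro i j hij hj
  rw [wd_left, wordDist, hp i j hij hj, Nat.cast_sub hij]

/-- four point condition in the symmetric form. -/
def Four {X : Type*} (d : X → X → ℝ) (δ : ℝ) : Prop :=
  ∀ x y z w : X, d x y + d z w ≤ max (d x z + d y w) (d x w + d y z) + 2 * δ

theorem four_of_hyp {X : Type*} {d : X → X → ℝ} {δ : ℝ} (hs : ∀ x y, d x y = d y x)
    (h : IsHyperbolicWith d δ) : Four d δ := by
  intro x y z w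
  have := h w z x y
  unfold gromov at this
  rw [hs z x, hs z y] at this
  rcases min_cases ((d z w + d x w - d x z) / 2) ((d z w + d y w - d y z) / 2) with ⟨h1, _⟩ | ⟨h1, _⟩
  · rw [h1] at this
    have := le_max_left (d x z + d y w) (d x w + d y z)
    linarith
  · rw [h1] at this
    have := le_max_right (d x z + d y w) (d x w + d y z)
    linarith

theorem hyp_of_four {X : Type*} {d : X → X → ℝ} {δ : ℝ} (hs : ∀ x y, d x y = d y x)
    (h : Four d δ) : IsHyperbolicWith d δ := by
  intro w x y z
  have := h y z x w
  unfold gromov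
  rw [hs y x, hs z x] at this
  rcases max_cases (d x y + d z w) (d y w + d x z) with ⟨h1, _⟩ | ⟨h1, _⟩
  · rw [h1] at this
    have := min_le_left ((d x w + d y w - d x y) / 2) ((d x w + d z w - d x z) / 2)
    linarith
  · rw [h1] at this
    have := min_le_right ((d x w + d y w - d x y) / 2) ((d x w + d z w - d x z) / 2)
    linarith

/-- From a bound on `(y|z)_w`: one of the two products is small. -/
theorem hyp_or {X : Type*} {d : X → X → ℝ} {δ : ℝ} (h : IsHyperbolicWith d δ) (w x y z : X) :
    gromov d w x y ≤ gromov d w y z + δ ∨ gromov d w x z ≤ gromov d w y z + δ := by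
  have := h w x y z
  rcases min_le_iff.1 (le_of_eq rfl : min (gromov d w x y) (gromov d w x z) ≤ _) with h1 | h1
  · left; linarith
  · right; linarith

theorem gromov_comm {X : Type*} {d : X → X → ℝ} (hs : ∀ x y, d x y = d y x) (w x y : X) :
    gromov d w x y = gromov d w y x := by
  unfold gromov; rw [hs x y]; ring

theorem gromov_left {d : G → G → ℝ} (hd : LeftInvariant d) (g w x y : G) :
    gromov d (g * w) (g * x) (g * y) = gromov d w x y := by
  unfold gromov; rw [hd, hd, hd]



/-! ### Part B : tripods, growth, drift -/

theorem exists_wl_eq [Infinite G] {S : Finset G} (hS : Generates S) (n : ℕ) :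
    ∃ g : G, wordLength S g = n := by
  obtain ⟨g, hg⟩ := (ball_finite hS n).exists_notMem
  have hg : ¬ wordLength S g ≤ n := hg
  obtain ⟨h, h1, -⟩ := wl_prefix hS g n (by omega)
  exact ⟨h, h1⟩

theorem exists_segment [Infinite G] {S : Finset G} (hS : Generates S) (n : ℕ) :
    ∃ p : ℤ → G, p 0 = 1 ∧ ∀ i j : ℤ, |i| ≤ n → |j| ≤ n →
      wordDist S (p i) (p j) = |(i : ℝ) - j| := by
  obtain ⟨g, hg⟩ := exists_wl_eq hS (2 * n)
  obtain ⟨m, q, hm, h0, -, hq⟩ := wd_geodesic hS 1 g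
  rw [wd_one, hg] at hm
  have hm : m = 2 * n := by exact_mod_cast hm
  refine ⟨fun i => (q n)⁻¹ * q (n + i).toNat, by simp, ?_⟩
  intro i j hi hj
  rw [abs_le] at hi hj
  simp only [wd_left]
  have key : ∀ i j : ℤ, -n ≤ i → i ≤ j → j ≤ n →
      wordDist S (q (n + i).toNat) (q (n + j).toNat) = (j : ℝ) - i := by
    intro i j h1 h2 h3
    rw [hq _ _ (by omega) (by omega)]
    have e1 : ((n + i).toNat : ℤ) = n + i := by omega
    have e2 : ((n + j).toNat : ℤ) = n + j := by omega
    have e1' : ((n + i).toNat : ℝ) = n + i := by exact_mod_cast e1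
    have e2' : ((n + j).toNat : ℝ) = n + j := by exact_mod_cast e2
    rw [e1', e2']; ring
  rcases le_total i j with h | h
  · rw [key i j hi.1 h hj.2, abs_sub_comm, abs_of_nonneg]
    have : (i : ℝ) ≤ j := by exact_mod_cast h
    linarith
  · rw [wd_symm hS, key j i hj.1 h hi.2, abs_of_nonneg]
    have : (j : ℝ) ≤ i := by exact_mod_cast h
    linarith

theorem exists_line [Infinite G] {S : Finset G} (hS : Generates S) :
    ∃ p : ℤ → G, ∀ i j : ℤ, wordDist S (p i) (p j) = |(i : ℝ) - j| := by
  choose q h0 hq using exists_segment (G := G) hS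
  have hev : ∀ i : ℤ, ∀ᶠ n : ℕ in (hyperfilter ℕ : Filter ℕ), |i| ≤ (n : ℤ) := by
    intro i
    have : ∀ᶠ n : ℕ in atTop, |i| ≤ (n : ℤ) := by
      filter_upwards [eventually_ge_atTop (i.natAbs)] with n hn
      rw [Int.abs_eq_natAbs]; omega
    exact Nat.hyperfilter_le_atTop this
  have hex : ∀ i : ℤ, ∃ v : G, ∀ᶠ n in (hyperfilter ℕ : Filter ℕ), q n i = v := by
    intro i
    have hfin := ball_finite hS i.natAbs
    have h2 : ∀ᶠ n in (hyperfilter ℕ : Filter ℕ),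
        ∃ v ∈ {g : G | wordLength S g ≤ i.natAbs}, q n i = v := by
      filter_upwards [hev i] with n hn
      refine ⟨q n i, ?_, rfl⟩
      have := hq n 0 i (by simp) hn
      rw [h0, wd_one] at this
      have h3 : (wordLength S (q n i) : ℝ) = (i.natAbs : ℝ) := by
        rw [this, Nat.cast_natAbs]; simp
      have h4 : wordLength S (q n i) = i.natAbs := by exact_mod_cast h3
      exact h4.le
    obtain ⟨v, -, hv⟩ := (Ultrafilter.eventually_exists_mem_iff hfin).1 h2
    exact ⟨v, hv⟩
  choose p hp using hex
  refine ⟨p, fun i j => ?_⟩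
  obtain ⟨n, h1, h2, h3, h4⟩ := ((hev i).and ((hev j).and ((hp i).and (hp j)))).exists
  rw [← h3, ← h4]
  exact hq n i j h1 h2

theorem exists_far {S : Finset G} (hS : Generates S)
    (hq : ¬ QuasiIsometric (wordDist S) intDist) (p : ℤ → G)
    (hp : ∀ i j : ℤ, wordDist S (p i) (p j) = |(i : ℝ) - j|) (R : ℝ) :
    ∃ g : G, ∀ i, R < wordDist S g (p i) := by
  by_contra hcon
  push Not at hcon
  apply hq
  choose f hf using hcon
  have hR : 0 ≤ R := (wd_nonneg S _ _).trans (hf 1)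
  refine ⟨f, 1, 2 * R, R, le_rfl, by linarith, hR, ?_, ?_⟩
  · intro x y
    have e : intDist (f x) (f y) = wordDist S (p (f x)) (p (f y)) := by rw [hp]; rfl
    rw [e]
    have h1 := hf x
    have h2 := hf y
    have h3 := wd_tri hS x (p (f x)) y
    have h4 := wd_tri hS (p (f x)) (p (f y)) y
    have h5 := wd_tri hS (p (f x)) x (p (f y))
    have h6 := wd_tri hS x y (p (f y))
    have h7 := wd_symm hS x (p (f x))
    have h8 := wd_symm hS y (p (f y))
    constructor <;> linarith
  · intro y
    refine ⟨p y, ?_⟩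
    have e : intDist (f (p y)) y = wordDist S (p (f (p y))) (p y) := by rw [hp]; rfl
    rw [e, wd_symm hS]
    exact hf _

theorem exists_tripods [Infinite G] {S : Finset G} (hS : Generates S)
    (hq : ¬ QuasiIsometric (wordDist S) intDist) {δ : ℝ} (hδ : 0 ≤ δ)
    (hyp : IsHyperbolicWith (wordDist S) δ) (L : ℕ) :
    ∃ a : Fin 3 → G, (∀ i, wordLength S (a i) = L) ∧
      ∀ i j, i ≠ j → gromov (wordDist S) 1 (a i) (a j) ≤ 2 * δ + 1 := by
  obtain ⟨p, hp⟩ := exists_line (G := G) hS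
  obtain ⟨g, hg⟩ := exists_far hS hq p hp L
  -- nearest point
  obtain ⟨k, hk⟩ : ∃ k : ℤ, ∀ i, wordLength S (g⁻¹ * p k) ≤ wordLength S (g⁻¹ * p i) := by
    have hne : (Set.range fun i : ℤ => wordLength S (g⁻¹ * p i)).Nonempty := ⟨_, 0, rfl⟩
    obtain ⟨k, hk⟩ := Nat.sInf_mem hne
    exact ⟨k, fun i => by simp only at hk; rw [hk]; exact Nat.sInf_le ⟨i, rfl⟩⟩
  have hk' : ∀ i, wordDist S g (p k) ≤ wordDist S g (p i) := by
    intro i; unfold wordDist; exact_mod_cast hk i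
  have hs := wd_symm hS
  -- products of g with the line
  have hprod : ∀ σ : ℤ, |σ| = 1 → gromov (wordDist S) (p k) (p (k + σ * L)) g ≤ 2 * δ + 1 := by
    intro σ hσ
    by_contra hcon
    push Not at hcon
    set t := gromov (wordDist S) (p k) (p (k + σ * L)) g with ht
    have ht0 : 0 ≤ t := by linarith
    set j := ⌊t⌋₊ with hj
    have hj1 : (j : ℝ) ≤ t := Nat.floor_le ht0
    have hj2 : t < j + 1 := Nat.lt_floor_add_one t
    have hσ' : |(σ : ℝ)| = 1 := by exact_mod_cast hσ
    have hdL : ∀ a b : ℤ, wordDist S (p (k + σ * a)) (p (k + σ * b)) = |(a : ℝ) - b| := by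
      intro a b
      rw [hp]; push_cast
      rw [show ((k : ℝ) + σ * a - (k + σ * b)) = σ * (a - b) by ring, abs_mul, hσ', one_mul]
    have hdk : ∀ a : ℤ, wordDist S (p (k + σ * a)) (p k) = |(a : ℝ)| := by
      intro a
      have := hdL a 0
      simpa using this
    have htL : t ≤ L := by
      have h1 := wd_tri hS (p k) (p (k + σ * L)) g
      have h2 := hdk L
      have h3 := hs (p k) (p (k + σ * L))
      have h4 := hs (p k) g
      simp only [Int.cast_natCast, Nat.abs_cast] at h2
      rw [ht]; unfold gromov; linarith
    have hjL : (j : ℝ) ≤ L := hj1.trans htL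
    have h1 := hyp (p k) (p (k + σ * L)) (p (k + σ * j)) g
    have e1 : gromov (wordDist S) (p k) (p (k + σ * L)) (p (k + σ * j)) = j := by
      unfold gromov
      rw [hdk, hdk, hdL]
      simp only [Int.cast_natCast, Nat.abs_cast]
      rw [abs_of_nonneg (by linarith)]; ring
    rw [e1, ← ht, min_eq_left hj1] at h1
    have e2 : gromov (wordDist S) (p k) (p (k + σ * j)) g ≤ j / 2 := by
      unfold gromov
      rw [hdk]
      have := hk' (k + σ * j)
      rw [hs (p (k + σ * j)) g]
      simp only [Int.cast_natCast, Nat.abs_cast]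
      linarith
    linarith
  obtain ⟨n, r, hn, hr0, hrn, hr⟩ := wd_geodesic hS (p k) g
  have hLn : L ≤ n := by
    have := hg k
    rw [hs, ← hn] at this
    exact_mod_cast this.le
  have hdL := hr 0 L (Nat.zero_le _) hLn
  have hdg := hr L n hLn le_rfl
  rw [hr0] at hdL
  rw [hrn] at hdg
  simp only [Nat.cast_zero, sub_zero] at hdL
  have hprod' : ∀ σ : ℤ, |σ| = 1 → gromov (wordDist S) (p k) (p (k + σ * L)) (r L) ≤ 2 * δ + 1 := by
    intro σ hσ
    refine le_trans ?_ (hprod σ hσ)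
    unfold gromov
    have h1 := wd_tri hS (p (k + σ * L)) (r L) g
    have h2 := hs (r L) (p k)
    have h3 := hs g (p k)
    linarith
  have hopp : gromov (wordDist S) (p k) (p (k + 1 * L)) (p (k + -1 * L)) ≤ 2 * δ + 1 := by
    unfold gromov
    rw [hp, hp, hp]
    push_cast
    have h0 : (0 : ℝ) ≤ L := Nat.cast_nonneg _
    rw [show ((k : ℝ) + 1 * L - k) = L by ring, show ((k : ℝ) + -1 * L - k) = -L by ring,
      show ((k : ℝ) + 1 * L - (k + -1 * L)) = 2 * L by ring, abs_neg, abs_of_nonneg h0,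
      abs_of_nonneg (by linarith : (0 : ℝ) ≤ 2 * L)]
    linarith
  have htr : ∀ x y, gromov (wordDist S) 1 ((p k)⁻¹ * x) ((p k)⁻¹ * y) =
      gromov (wordDist S) (p k) x y := by
    intro x y
    rw [← gromov_left (fun g x y => wd_left S g x y) (p k)]
    simp
  have hlen : ∀ x, wordDist S (p k) x = L → wordLength S ((p k)⁻¹ * x) = L := by
    intro x hx
    unfold wordDist at hx; exact_mod_cast hx
  have hc := gromov_comm hs
  refine ⟨![(p k)⁻¹ * p (k + 1 * L), (p k)⁻¹ * p (k + -1 * L), (p k)⁻¹ * r L], ?_, ?_⟩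
  · intro i
    fin_cases i
    · apply hlen; rw [hp]; push_cast; simp
    · apply hlen; rw [hp]; push_cast; simp
    · apply hlen; exact hdL
  · intro i j hij
    fin_cases i <;> fin_cases j
    · exact absurd rfl hij
    · simpa [htr] using hopp
    · simpa [htr] using hprod' 1 (by simp)
    · rw [hc]; simpa [htr] using hopp
    · exact absurd rfl hij
    · simpa [htr] using hprod' (-1) (by simp)
    · rw [hc]; simpa [htr] using hprod' 1 (by simp)
    · rw [hc]; simpa [htr] using hprod' (-1) (by simp)
    · exact absurd rfl hij



def wball {S : Finset G} (hS : Generates S) (n : ℕ) : Finset G := (ball_finite hS n).toFinset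

theorem mem_wball {S : Finset G} (hS : Generates S) (n : ℕ) (g : G) :
    g ∈ wball hS n ↔ wordLength S g ≤ n := by
  unfold wball; rw [Set.Finite.mem_toFinset]; rfl

def branchTree (c : G → Bool → G) : List Bool → G
  | [] => 1
  | b :: l => branchTree c l * c (branchTree c l) b

theorem exists_branch {S : Finset G} (hS : Generates S) {δ K : ℝ}
    (hyp : IsHyperbolicWith (wordDist S) δ) (L : ℕ) (a : Fin 3 → G)
    (ha : ∀ i, wordLength S (a i) = L)
    (hK : ∀ i j, i ≠ j → gromov (wordDist S) 1 (a i) (a j) ≤ K) (y : G) :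
    ∃ c : Bool → G, (∀ b, wordLength S (c b) = L) ∧
      (∀ b, gromov (wordDist S) 1 y⁻¹ (c b) ≤ K + δ) ∧
      gromov (wordDist S) 1 (c true) (c false) ≤ K := by
  have h : ∀ i j, i ≠ j → gromov (wordDist S) 1 y⁻¹ (a i) ≤ K + δ ∨
      gromov (wordDist S) 1 y⁻¹ (a j) ≤ K + δ := by
    intro i j hij
    have := hK i j hij
    rcases hyp_or hyp 1 y⁻¹ (a i) (a j) with h | h
    · left; linarith
    · right; linarith
  have main : ∃ i j, i ≠ j ∧ gromov (wordDist S) 1 y⁻¹ (a i) ≤ K + δ ∧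
      gromov (wordDist S) 1 y⁻¹ (a j) ≤ K + δ := by
    by_cases h0 : gromov (wordDist S) 1 y⁻¹ (a 0) ≤ K + δ
    · rcases h 1 2 (by decide) with h1 | h1
      · exact ⟨0, 1, by decide, h0, h1⟩
      · exact ⟨0, 2, by decide, h0, h1⟩
    · refine ⟨1, 2, by decide, ?_, ?_⟩
      · exact (h 0 1 (by decide)).resolve_left h0
      · exact (h 0 2 (by decide)).resolve_left h0
  obtain ⟨i, j, hij, hi, hj⟩ := main
  refine ⟨fun b => if b then a i else a j, ?_, ?_, ?_⟩
  · intro b; cases b <;> simp [ha]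
  · intro b; cases b <;> simp [hi, hj]
  · simpa using hK i j hij

theorem growth [Infinite G] {S : Finset G} (hS : Generates S)
    (hq : ¬ QuasiIsometric (wordDist S) intDist) {δ : ℝ} (hδ : 0 ≤ δ)
    (hyp : IsHyperbolicWith (wordDist S) δ) :
    ∃ L : ℕ, 1 ≤ L ∧ ∀ k : ℕ, 2 ^ k ≤ (wball hS (k * L)).card := by
  set K : ℝ := 2 * δ + 1 with hKdef
  set D : ℝ := K + 4 * δ + 1 with hDdef
  obtain ⟨L, hL⟩ := exists_nat_ge (3 * K + 10 * δ + D)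
  have hL1 : (1 : ℝ) ≤ L := by linarith
  obtain ⟨a, ha, hK⟩ := exists_tripods hS hq hδ hyp L
  choose c hc1 hc2 hc3 using exists_branch hS hyp L a ha hK
  have hs := wd_symm hS
  set f := branchTree c with hf
  have fcons : ∀ b l, f (b :: l) = f l * c (f l) b := fun b l => rfl
  set d := wordDist S with hd
  have hlen : ∀ l, wordLength S (f l) ≤ l.length * L := by
    intro l
    induction l with
    | nil => simp [hf, branchTree, wl_one]
    | cons b l ih =>
      rw [fcons]
      have := wl_mul hS (f l) (c (f l) b)
      rw [hc1] at this
      simp only [List.length_cons]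
      nlinarith
  have hback : ∀ y b, gromov d y 1 (y * c y b) ≤ K + δ := by
    intro y b
    have := hc2 y b
    rw [← gromov_left (fun g x y => wd_left S g x y) y] at this
    simpa using this
  have hbr : ∀ y, gromov d y (y * c y true) (y * c y false) ≤ K := by
    intro y
    have := hc3 y
    rw [← gromov_left (fun g x y => wd_left S g x y) y] at this
    simpa using this
  have hdc : ∀ y b, d y (y * c y b) = L := by
    intro y b
    rw [hd, wordDist]; simp [hc1]
  have key : ∀ n : ℕ, ∀ l l' : List Bool, l.length = n → l'.length = n → l ≠ l' →
      gromov d 1 (f l) (f l') ≤ d (f l) 1 - D := by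
    intro n
    induction n with
    | zero =>
      intro l l' h1 h2 h3
      rw [List.length_eq_zero_iff] at h1 h2
      exact absurd (h1.trans h2.symm) h3
    | succ n ih =>
      intro l l' h1 h2 h3
      obtain ⟨b, t, rfl⟩ := List.exists_cons_of_length_eq_add_one h1
      obtain ⟨b', t', rfl⟩ := List.exists_cons_of_length_eq_add_one h2
      simp only [List.length_cons, Nat.add_right_cancel_iff] at h1 h2
      rw [fcons, fcons]
      have g1 := hback (f t) b
      have g2 := hback (f t') b'
      have e1 := hdc (f t) b
      have e2 := hdc (f t') b'
      set w := f t with hw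
      set w' := f t' with hw'
      have grow : d w 1 + L - 2 * (K + δ) ≤ d (w * c w b) 1 := by
        unfold gromov at g1
        have := hs w 1
        have := hs (w * c w b) w
        have := hs (w * c w b) 1
        linarith
      by_cases ht : t = t'
      · subst ht
        have hb : b ≠ b' := by rintro rfl; exact h3 rfl
        have hww : gromov d w (w * c w b) (w * c w b') ≤ K := by
          cases b <;> cases b'
          · exact absurd rfl hb
          · rw [gromov_comm hs]; exact hbr w
          · exact hbr w
          · exact absurd rfl hb
        have tri : gromov d 1 (w * c w b) (w * c w b') ≤
            d w 1 + gromov d w (w * c w b) (w * c w b') := by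
          unfold gromov
          have := wd_tri hS (w * c w b) w 1
          have := wd_tri hS (w * c w b') w 1
          linarith
        linarith
      · have hi := ih t t' h1 h2 ht
        have hi' := ih t' t h2 h1 (Ne.symm ht)
        rw [gromov_comm hs, ← hw, ← hw'] at hi'
        rw [← hw, ← hw'] at hi
        have p1 : d w 1 - (K + δ) ≤ gromov d 1 w (w * c w b) := by
          unfold gromov at g1 ⊢
          have := hs w 1
          have := hs (w * c w b) w
          have := hs (w * c w b) 1
          linarith
        have p2 : d w' 1 - (K + δ) ≤ gromov d 1 w' (w' * c w' b') := by
          unfold gromov at g2 ⊢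
          have := hs w' 1
          have := hs (w' * c w' b') w'
          have := hs (w' * c w' b') 1
          linarith
        rcases hyp_or hyp 1 (w * c w b) w w' with h | h
        · rw [gromov_comm hs] at h; linarith
        · rcases hyp_or hyp 1 (w' * c w' b') w' (w * c w b) with h' | h'
          · rw [gromov_comm hs, gromov_comm hs 1 w' (w * c w b)] at h'
            linarith
          · rw [gromov_comm hs, gromov_comm hs 1 w' (w * c w b)] at h'
            linarith
  refine ⟨L, by exact_mod_cast hL1, fun k => ?_⟩
  have hcard : (Finset.univ : Finset (Fin k → Bool)).card = 2 ^ k := by simp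
  rw [← hcard]
  refine Finset.card_le_card_of_injOn (fun v => f (List.ofFn v)) ?_ ?_
  · intro v _
    rw [Finset.mem_coe, mem_wball]
    simpa using hlen (List.ofFn v)
  · intro v _ v' _ hvv
    by_contra hne
    have h1 := key k (List.ofFn v) (List.ofFn v') (by simp) (by simp)
      (fun h => hne (List.ofFn_injective h))
    simp only at hvv
    rw [← hvv] at h1
    have h2 : gromov d 1 (f (List.ofFn v)) (f (List.ofFn v)) = d (f (List.ofFn v)) 1 := by
      unfold gromov; rw [hd, wd_self]; ring
    linarith

theorem wball_mul {S : Finset G} (hS : Generates S) (m c : ℕ) :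
    (wball hS (m + c)).card ≤ (wball hS c).card * (wball hS m).card := by
  classical
  rw [mul_comm]
  refine le_trans (Finset.card_le_card ?_)
    (Finset.card_image₂_le (fun a b => a * b) (wball hS m) (wball hS c))
  intro g hg
  rw [mem_wball] at hg
  rw [Finset.mem_image₂]
  obtain ⟨h, h1, h2⟩ := wl_prefix hS g (min m (wordLength S g)) (min_le_right _ _)
  refine ⟨h, ?_, h⁻¹ * g, ?_, by simp⟩
  · rw [mem_wball, h1]; exact min_le_left _ _
  · rw [mem_wball, h2]; omega

set_option maxHeartbeats 1000000 in
theorem good_radius {S : Finset G} (hS : Generates S) {L : ℕ} (hL : 1 ≤ L)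
    (hg : ∀ k : ℕ, 2 ^ k ≤ (wball hS (k * L)).card) :
    ∀ n0 : ℕ, ∃ n ≥ n0, (∑ j ∈ Finset.range (n + 1), ((wball hS j).card : ℝ)) ≤
      (2 * L + 1) * (wball hS n).card := by
  intro n0
  by_contra hcon
  push Not at hcon
  have hLr : (1 : ℝ) ≤ L := by exact_mod_cast hL
  set T : ℕ → ℝ := fun n => ∑ j ∈ Finset.range (n + 1), ((wball hS j).card : ℝ) with hT
  set θ : ℝ := 1 + 1 / (2 * L) with hθ
  have hθ0 : 0 ≤ θ := by positivity
  have hstep : ∀ n ≥ n0, T (n + 1) ≤ θ * T n := by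
    intro n hn
    have h1 := hcon (n + 1) (by omega)
    have h2 : T (n + 1) = T n + (wball hS (n + 1)).card := by
      simp only [hT]; rw [Finset.sum_range_succ _ (n + 1)]
    have h3 : (2 * L + 1) * (T (n + 1) - T n) < T (n + 1) := by
      rw [h2]; rw [add_sub_cancel_left]; rw [← h2]; exact h1
    have h4 : 2 * L * T (n + 1) ≤ (2 * L + 1) * T n := by linarith
    have h5 : θ * T n = (2 * L + 1) * T n / (2 * L) := by rw [hθ]; field_simp
    rw [h5, le_div_iff₀ (by positivity)]; linarith
  have hpow : ∀ m, T (n0 + m) ≤ θ ^ m * T n0 := by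
    intro m
    induction m with
    | zero => simp
    | succ m ih =>
      have := hstep (n0 + m) (by omega)
      calc T (n0 + (m + 1)) ≤ θ * T (n0 + m) := this
        _ ≤ θ * (θ ^ m * T n0) := by gcongr
        _ = _ := by ring
  have hr : θ ^ L ≤ Real.exp (1 / 2) := by
    have h1 : θ ≤ Real.exp (1 / (2 * L)) := by
      rw [hθ, add_comm]; exact Real.add_one_le_exp _
    calc θ ^ L ≤ (Real.exp (1 / (2 * L))) ^ L := by gcongr
      _ = Real.exp (1 / 2) := by
        rw [← Real.exp_nat_mul]; congr 1; field_simp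
  have hexp : Real.exp (1 / 2) < 2 := by
    have h1 : Real.exp (1 / 2) * Real.exp (1 / 2) = Real.exp 1 := by
      rw [← Real.exp_add]; norm_num
    have h2 := Real.exp_one_lt_d9
    by_contra h
    push Not at h
    nlinarith
  have hone : ∀ n j : ℕ, j ≤ n → ((wball hS j).card : ℝ) ≤ T n := by
    intro n j hj
    exact Finset.single_le_sum (f := fun j => ((wball hS j).card : ℝ))
        (fun i _ => Nat.cast_nonneg _) (Finset.mem_range.2 (by omega))
  have hT0 : 0 ≤ T n0 := Finset.sum_nonneg fun i _ => Nat.cast_nonneg _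
  clear_value T
  have hfin : ∀ k : ℕ, (2 / Real.exp (1 / 2)) ^ k ≤ T n0 := by
    intro k
    have h1 : (2 : ℝ) ^ k ≤ T (n0 + k * L) := by
      have h0 : ((2 : ℝ)) ^ k ≤ ((wball hS (k * L)).card : ℝ) := by
        have h := (Nat.cast_le (α := ℝ)).2 (hg k)
        rw [Nat.cast_pow] at h; exact h
      refine h0.trans ?_
      generalize k * L = kL
      exact hone (n0 + kL) kL (by omega)
    have h2 : (2 : ℝ) ^ k ≤ (Real.exp (1 / 2)) ^ k * T n0 := by
      refine h1.trans ((hpow (k * L)).trans ?_)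
      rw [mul_comm k L, pow_mul]
      exact mul_le_mul_of_nonneg_right (pow_le_pow_left₀ (pow_nonneg hθ0 _) hr k) hT0
    rw [div_pow, div_le_iff₀ (by positivity)]
    linarith
  obtain ⟨k, hk⟩ := pow_unbounded_of_one_lt (T n0)
    (show 1 < 2 / Real.exp (1 / 2) by rw [lt_div_iff₀ (Real.exp_pos _)]; linarith)
  linarith [hfin k]

theorem exists_drift [Infinite G] {S : Finset G} (hS : Generates S)
    (hq : ¬ QuasiIsometric (wordDist S) intDist) {δ : ℝ} (hδ : 0 ≤ δ)
    (hyp : IsHyperbolicWith (wordDist S) δ) :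
    ∃ A : Finset G, (∀ a ∈ A, a⁻¹ ∈ A) ∧
      ∀ x : G, (1 : ℝ) ≤ ∑ a ∈ A, ((wordLength S (x * a) : ℝ) - wordLength S x) := by
  classical
  obtain ⟨L, hL, hg⟩ := growth hS hq hδ hyp
  set c := ⌈2 * δ⌉₊ with hc
  have hcδ : 2 * δ ≤ c := Nat.le_ceil _
  set βc : ℝ := ((wball hS c).card : ℝ) with hβc
  obtain ⟨n0, hn0⟩ := exists_nat_ge ((2 * L + 1) + 2 * βc * (2 * L + 1) + 1 : ℝ)
  obtain ⟨n, hn, hT⟩ := good_radius hS hL hg n0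
  set T : ℝ := ∑ j ∈ Finset.range (n + 1), ((wball hS j).card : ℝ) with hTdef
  set β : ℝ := ((wball hS n).card : ℝ) with hβ
  have hβ1 : 1 ≤ β := by
    have : 0 < (wball hS n).card := Finset.card_pos.2 ⟨1, by rw [mem_wball, wl_one]; omega⟩
    rw [hβ]; exact_mod_cast this
  have hs := wd_symm hS
  refine ⟨wball hS n, ?_, ?_⟩
  · intro a ha; rw [mem_wball] at ha ⊢; rwa [wl_inv hS]
  intro x
  -- sum of lengths
  have hsum1 : (n : ℝ) * β ≤ (∑ a ∈ wball hS n, (wordLength S a : ℝ)) + T := by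
    have h1 : ∀ a ∈ wball hS n, (n : ℝ) ≤ (wordLength S a : ℝ) +
        ∑ j ∈ Finset.range (n + 1), if wordLength S a ≤ j then (1 : ℝ) else 0 := by
      intro a ha
      rw [mem_wball] at ha
      rw [Finset.sum_ite, Finset.sum_const_zero, add_zero, Finset.sum_const, nsmul_eq_mul, mul_one]
      have : n - wordLength S a ≤
          ((Finset.range (n + 1)).filter fun j => wordLength S a ≤ j).card := by
        have h2 : Finset.Ico (wordLength S a) n ⊆
            (Finset.range (n + 1)).filter fun j => wordLength S a ≤ j := by
          intro j hj
          rw [Finset.mem_Ico] at hj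
          rw [Finset.mem_filter, Finset.mem_range]; omega
        simpa using Finset.card_le_card h2
      have h3 : n ≤ wordLength S a +
          ((Finset.range (n + 1)).filter fun j => wordLength S a ≤ j).card := by omega
      exact_mod_cast h3
    have h2 := Finset.sum_le_sum h1
    rw [Finset.sum_const, nsmul_eq_mul, Finset.sum_add_distrib, Finset.sum_comm, mul_comm] at h2
    refine h2.trans (add_le_add le_rfl ?_)
    refine Finset.sum_le_sum fun j _ => ?_
    rw [Finset.sum_ite, Finset.sum_const_zero, add_zero, Finset.sum_const, nsmul_eq_mul, mul_one]
    have : ((wball hS n).filter fun a => wordLength S a ≤ j) ⊆ wball hS j := by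
      intro a ha; rw [mem_wball]; exact (Finset.mem_filter.1 ha).2
    exact_mod_cast Finset.card_le_card this
  -- sum of products
  have hsum2 : (∑ a ∈ wball hS n, gromov (wordDist S) 1 x⁻¹ a) ≤ βc * T := by
    set ξ := x⁻¹
    have h1 : ∀ a ∈ wball hS n, gromov (wordDist S) 1 ξ a ≤
        ∑ k ∈ Finset.range (n + 1), if (k : ℝ) ≤ gromov (wordDist S) 1 ξ a then (1 : ℝ) else 0 := by
      intro a ha
      rw [mem_wball] at ha
      set t := gromov (wordDist S) 1 ξ a with ht
      rw [Finset.sum_ite, Finset.sum_const_zero, add_zero, Finset.sum_const, nsmul_eq_mul, mul_one]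
      rcases lt_or_ge t 0 with h0 | h0
      · exact h0.le.trans (Nat.cast_nonneg _)
      have htn : t ≤ n := by
        have h1 := wd_tri hS ξ a 1
        have h2 := wd_one' hS a
        have h3 : (wordLength S a : ℝ) ≤ n := by exact_mod_cast ha
        rw [ht]; unfold gromov; linarith
      have hfl : ⌊t⌋₊ ≤ n := by
        have := Nat.floor_le h0
        have : ((⌊t⌋₊ : ℕ) : ℝ) ≤ n := this.trans htn
        exact_mod_cast this
      have h2 : Finset.range (⌊t⌋₊ + 1) ⊆
          (Finset.range (n + 1)).filter fun k : ℕ => (k : ℝ) ≤ t := by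
        intro k hk
        rw [Finset.mem_range] at hk
        rw [Finset.mem_filter, Finset.mem_range]
        refine ⟨by omega, ?_⟩
        rw [← Nat.le_floor_iff h0]; omega
      have h3 := Finset.card_le_card h2
      rw [Finset.card_range] at h3
      have h4 := (Nat.lt_floor_add_one t).le
      refine h4.trans ?_
      exact_mod_cast h3
    refine (Finset.sum_le_sum h1).trans ?_
    rw [Finset.sum_comm, hTdef, ← Finset.sum_range_reflect (fun j => ((wball hS j).card : ℝ)), Finset.mul_sum]
    refine Finset.sum_le_sum fun k hk => ?_
    rw [Finset.mem_range] at hk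
    rw [Finset.sum_ite, Finset.sum_const_zero, add_zero, Finset.sum_const, nsmul_eq_mul, mul_one]
    have hle : ((wball hS n).filter fun a => (k : ℝ) ≤ gromov (wordDist S) 1 ξ a).card ≤
        (wball hS (n - k + c)).card := by
      by_cases hkξ : k ≤ wordLength S ξ
      · obtain ⟨h, hh1, hh2⟩ := wl_prefix hS ξ k hkξ
        refine Finset.card_le_card_of_injOn (fun a => h⁻¹ * a) ?_ ?_
        · intro a ha
          rw [Finset.mem_coe, Finset.mem_filter, mem_wball] at ha
          rw [Finset.mem_coe, mem_wball]
          have e1 : gromov (wordDist S) 1 ξ h = k := by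
            unfold gromov
            rw [wd_one' hS, wd_one' hS, hs ξ h, wordDist, hh1, hh2, Nat.cast_sub hkξ]; ring
          have h2 := hyp 1 ξ h a
          rw [e1, min_eq_left ha.2] at h2
          unfold gromov at h2
          rw [wd_one' hS, wd_one' hS, hh1] at h2
          have h3 : (wordLength S a : ℝ) ≤ n := by exact_mod_cast ha.1
          have h4 : wordDist S h a ≤ n - k + c := by linarith
          unfold wordDist at h4
          have hkn : k ≤ n := by omega
          rw [← Nat.cast_sub hkn] at h4
          exact_mod_cast h4
        · intro a _ b _ hab; exact mul_left_cancel hab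
      · have : ((wball hS n).filter fun a => (k : ℝ) ≤ gromov (wordDist S) 1 ξ a) = ∅ := by
          rw [Finset.filter_eq_empty_iff]
          intro a _ hcon
          apply hkξ
          have h1 := wd_tri hS a ξ 1
          have h2 := wd_one' hS ξ
          have h3 := hs a ξ
          unfold gromov at hcon
          have : (k : ℝ) ≤ wordLength S ξ := by linarith
          exact_mod_cast this
        rw [this]; simp
    have h5 := hle.trans (wball_mul hS (n - k) c)
    have h6 : n + 1 - 1 - k = n - k := by omega
    rw [h6, hβc]
    exact_mod_cast h5
  have hsplit : ∀ a, (wordLength S (x * a) : ℝ) - wordLength S x =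
      wordLength S a - 2 * gromov (wordDist S) 1 x⁻¹ a := by
    intro a
    unfold gromov
    rw [wd_one' hS, wd_one' hS, wordDist, inv_inv, wl_inv hS]; ring
  simp_rw [hsplit]
  rw [Finset.sum_sub_distrib, ← Finset.mul_sum]
  have hnr : (n0 : ℝ) ≤ n := by exact_mod_cast hn
  have hβc0 : 0 ≤ βc := Nat.cast_nonneg _
  have h7 : βc * T ≤ βc * ((2 * L + 1) * β) := by gcongr
  have h8 : ((2 * L + 1) + 2 * βc * (2 * L + 1) + 1) * β ≤ n * β := by
    gcongr; linarith
  nlinarith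



/-- Finitely supported real functions. -/
def FS (f : G → ℝ) : Prop := (Function.support f).Finite

theorem FS.summable {f : G → ℝ} (h : FS f) : Summable f := summable_of_finite_support h

theorem FS.of_zero {f g : G → ℝ} (h : FS f) (hz : ∀ x, f x = 0 → g x = 0) : FS g :=
  Set.Finite.subset h fun x hx hf => hx (hz x hf)

theorem FS.mul {f : G → ℝ} (h : FS f) (g : G → ℝ) : FS (fun x => f x * g x) :=
  h.of_zero fun x hx => by simp [hx]

theorem FS.mul_l {f : G → ℝ} (h : FS f) (g : G → ℝ) : FS (fun x => g x * f x) :=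
  h.of_zero fun x hx => by simp [hx]

theorem FS.add {f g : G → ℝ} (h : FS f) (h' : FS g) : FS (fun x => f x + g x) :=
  (Set.Finite.union h h').subset fun x hx => by
    by_contra hc
    rw [Set.mem_union, not_or] at hc
    simp only [Function.mem_support, not_not] at hc
    apply hx; simp [hc.1, hc.2]

theorem FS.sub {f g : G → ℝ} (h : FS f) (h' : FS g) : FS (fun x => f x - g x) :=
  (Set.Finite.union h h').subset fun x hx => by
    by_contra hc
    rw [Set.mem_union, not_or] at hc
    simp only [Function.mem_support, not_not] at hc
    apply hx; simp [hc.1, hc.2]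

theorem FS.shift {f : G → ℝ} (h : FS f) (a : G) : FS (fun x => f (x * a)) := by
  refine (Set.Finite.preimage (f := fun x => x * a) ?_ h).subset fun x hx => hx
  exact (mul_left_injective a).injOn

theorem FS.sum {f : G → G → ℝ} (A : Finset G) (h : ∀ a ∈ A, FS (f a)) :
    FS (fun x => ∑ a ∈ A, f a x) := by
  refine (Set.Finite.biUnion A.finite_toSet h).subset fun x hx => ?_
  by_contra hc
  apply hx
  simp only [Set.mem_iUnion, not_exists] at hc
  refine Finset.sum_eq_zero fun a ha => ?_
  have := hc a ha
  simpa using this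

theorem tsum_shift (f : G → ℝ) (a : G) : ∑' x, f (x * a) = ∑' x, f x :=
  (Equiv.mulRight a).tsum_eq f

/-- squared norm -/
def nsq (f : G → ℝ) : ℝ := ∑' x, f x ^ 2
/-- energy in the direction `a` -/
def enr (a : G) (f : G → ℝ) : ℝ := ∑' x, (f x - f (x * a)) ^ 2

theorem FS.sq {f : G → ℝ} (h : FS f) : FS (fun x => f x ^ 2) :=
  h.of_zero fun x hx => by simp [hx]

theorem nsq_nonneg (f : G → ℝ) : 0 ≤ nsq f := tsum_nonneg fun x => sq_nonneg _
theorem enr_nonneg (a : G) (f : G → ℝ) : 0 ≤ enr a f := tsum_nonneg fun x => sq_nonneg _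

theorem enr_one (f : G → ℝ) : enr 1 f = 0 := by simp [enr]

theorem enr_inv (a : G) (f : G → ℝ) : enr a⁻¹ f = enr a f := by
  unfold enr
  rw [← tsum_shift _ a]
  refine tsum_congr fun x => ?_
  rw [mul_inv_cancel_right]; ring

theorem enr_mul (a b : G) {f : G → ℝ} (hf : FS f) : enr (a * b) f ≤ 2 * enr a f + 2 * enr b f := by
  have h : enr b f = ∑' x, (f (x * a) - f (x * a * b)) ^ 2 :=
    (tsum_shift (fun x => (f x - f (x * b)) ^ 2) a).symm
  have h1 : FS (fun x => (f x - f (x * a)) ^ 2) := (hf.sub (hf.shift a)).sq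
  have h2' : FS (fun x => (f x - f (x * b)) ^ 2) := (hf.sub (hf.shift b)).sq
  have h2 : FS (fun x => (f (x * a) - f (x * a * b)) ^ 2) := h2'.shift a
  have h3 : FS (fun x => (f x - f (x * (a * b))) ^ 2) := (hf.sub (hf.shift (a * b))).sq
  rw [h]; unfold enr
  rw [← tsum_mul_left, ← tsum_mul_left,
    ← (h1.summable.mul_left 2).tsum_add (h2.summable.mul_left 2)]
  refine h3.summable.tsum_le_tsum (fun x => ?_)
    ((h1.summable.mul_left 2).add (h2.summable.mul_left 2))
  rw [← mul_assoc]
  nlinarith [sq_nonneg ((f x - f (x * a)) - (f (x * a) - f (x * a * b)))]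

theorem drift_gap (A : Finset G) (hA : ∀ a ∈ A, a⁻¹ ∈ A) (u : G → ℝ) (M : ℝ)
    (hM : ∀ x, ∀ a ∈ A, |u (x * a) - u x| ≤ M)
    (hd : ∀ x, 1 ≤ ∑ a ∈ A, (u (x * a) - u x)) {f : G → ℝ} (hf : FS f) :
    nsq f ≤ M ^ 2 * A.card * ∑ a ∈ A, enr a f := by
  classical
  have hAc : 0 < (A.card : ℝ) := by
    rcases Finset.eq_empty_or_nonempty A with rfl | h
    · have := hd 1; simp at this; linarith
    · exact_mod_cast h.card_pos
  set k : ℝ := (A.card : ℝ) with hk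
  have hsq : FS (fun x => f x ^ 2) := hf.sq
  have F1 : ∀ a, FS (fun x => f x ^ 2 * (u (x * a) - u x)) := fun a => hsq.mul _
  have F2 : ∀ a, FS (fun x => f (x * a) ^ 2 * (u x - u (x * a))) := fun a =>
    (hsq.shift a).mul _
  have h1 : nsq f ≤ ∑ a ∈ A, ∑' x, f x ^ 2 * (u (x * a) - u x) := by
    rw [← Summable.tsum_finsetSum fun a _ => (F1 a).summable]
    refine hsq.summable.tsum_le_tsum (fun x => ?_) (FS.sum A fun a _ => F1 a).summable
    rw [← Finset.mul_sum]
    exact le_mul_of_one_le_right (sq_nonneg _) (hd x)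
  have h2 : ∑ a ∈ A, ∑' x, f x ^ 2 * (u (x * a) - u x) =
      ∑ a ∈ A, ∑' x, f (x * a) ^ 2 * (u x - u (x * a)) := by
    refine Finset.sum_bij' (fun a _ => a⁻¹) (fun a _ => a⁻¹) hA hA (by simp) (by simp) ?_
    intro a ha
    rw [← tsum_shift _ a⁻¹]
    refine tsum_congr fun x => ?_
    rw [inv_mul_cancel_right]
  have h3 : 2 * nsq f ≤ ∑ a ∈ A, (M ^ 2 * k * enr a f + nsq f / k) := by
    have : 2 * nsq f ≤ ∑ a ∈ A, ∑' x, (f x ^ 2 * (u (x * a) - u x) +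
        f (x * a) ^ 2 * (u x - u (x * a))) := by
      simp_rw [fun a => ((F1 a).summable).tsum_add (F2 a).summable]
      rw [Finset.sum_add_distrib, ← h2]; linarith
    refine this.trans (Finset.sum_le_sum fun a ha => ?_)
    have e1 : FS (fun x => (f x - f (x * a)) ^ 2) := (hf.sub (hf.shift a)).sq
    have e2 : nsq f / k = ∑' x, ((2 * k)⁻¹ * f x ^ 2 + (2 * k)⁻¹ * f (x * a) ^ 2) := by
      rw [(hsq.summable.mul_left _).tsum_add ((hsq.shift a).summable.mul_left _), tsum_mul_left,
        tsum_mul_left, tsum_shift (fun x => f x ^ 2) a]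
      unfold nsq; field_simp; ring
    have e3 : Summable fun x => ((2 * k)⁻¹ * f x ^ 2 + (2 * k)⁻¹ * f (x * a) ^ 2) :=
      (hsq.summable.mul_left _).add ((hsq.shift a).summable.mul_left _)
    rw [e2]; unfold enr
    rw [← tsum_mul_left, ← (e1.summable.mul_left _).tsum_add e3]
    refine ((F1 a).add (F2 a)).summable.tsum_le_tsum (fun x => ?_)
      ((e1.summable.mul_left _).add e3)
    have hv := hM x a ha
    set v := u (x * a) - u x with hvd
    have hv2 : v ^ 2 ≤ M ^ 2 := by rw [← sq_abs v]; gcongr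
    have : u x - u (x * a) = -v := by rw [hvd]; ring
    rw [this]
    set p := f x - f (x * a) with hp
    set q := f x + f (x * a) with hq
    have i1 : p * q * v ≤ k * v ^ 2 * p ^ 2 + q ^ 2 / (4 * k) := by
      have : k * v ^ 2 * p ^ 2 + q ^ 2 / (4 * k) - p * q * v
        = (2 * k * v * p - q) ^ 2 / (4 * k) := by field_simp; ring
      have h0 : 0 ≤ (2 * k * v * p - q) ^ 2 / (4 * k) := by positivity
      linarith
    have i2 : k * v ^ 2 * p ^ 2 ≤ M ^ 2 * k * p ^ 2 := by
      have : k * v ^ 2 * p ^ 2 ≤ k * M ^ 2 * p ^ 2 := by gcongr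
      linarith
    have i3 : q ^ 2 / (4 * k) ≤ (2 * k)⁻¹ * f x ^ 2 + (2 * k)⁻¹ * f (x * a) ^ 2 := by
      have : (2 * k)⁻¹ * f x ^ 2 + (2 * k)⁻¹ * f (x * a) ^ 2 - q ^ 2 / (4 * k)
        = (f x - f (x * a)) ^ 2 / (4 * k) := by rw [hq]; field_simp; ring
      have h0 : 0 ≤ (f x - f (x * a)) ^ 2 / (4 * k) := by positivity
      linarith
    have i4 : f x ^ 2 * v + f (x * a) ^ 2 * -v = p * q * v := by rw [hp, hq]; ring
    rw [i4]; linarith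
  rw [Finset.sum_add_distrib, Finset.sum_const, nsmul_eq_mul, ← hk, ← Finset.mul_sum,
    mul_div_cancel₀ _ hAc.ne'] at h3
  linarith



/-- Standing assumptions on the step distribution. -/
structure Walk (μ : G → ℝ) (T : Finset G) : Prop where
  nn : ∀ g, 0 ≤ μ g
  symm : ∀ g, μ g⁻¹ = μ g
  mem : ∀ g, g ∈ T ↔ μ g ≠ 0
  sum : ∑ s ∈ T, μ s = 1
  gen : Generates T

theorem Walk.inv_mem {μ : G → ℝ} {T : Finset G} (W : Walk μ T) {s : G} (hs : s ∈ T) : s⁻¹ ∈ T := by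
  rw [W.mem] at hs ⊢; rwa [W.symm]

theorem Walk.pos {μ : G → ℝ} {T : Finset G} (W : Walk μ T) {s : G} (hs : s ∈ T) : 0 < μ s :=
  lt_of_le_of_ne (W.nn s) (Ne.symm ((W.mem s).1 hs))

theorem Walk.sum_inv {μ : G → ℝ} {T : Finset G} (W : Walk μ T) (f : G → ℝ) :
    ∑ s ∈ T, μ s * f s⁻¹ = ∑ s ∈ T, μ s * f s := by
  refine Finset.sum_bij' (fun a _ => a⁻¹) (fun a _ => a⁻¹) (fun a h => W.inv_mem h)
    (fun a h => W.inv_mem h) (by simp) (by simp) ?_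
  intro a _; rw [W.symm]

/-- The Markov operator. -/
def Pop (μ : G → ℝ) (T : Finset G) (f : G → ℝ) (x : G) : ℝ := ∑ s ∈ T, μ s * f (x * s)

theorem FS.pop {f : G → ℝ} (hf : FS f) (μ : G → ℝ) (T : Finset G) : FS (Pop μ T f) :=
  FS.sum (f := fun s x => μ s * f (x * s)) T fun s _ => (hf.shift s).mul_l _

theorem tsum_mul_pop {μ : G → ℝ} {T : Finset G} {f : G → ℝ} (hf : FS f) (g : G → ℝ) :
    ∑' x, f x * Pop μ T g x = ∑ s ∈ T, μ s * ∑' x, f x * g (x * s) := by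
  simp_rw [← tsum_mul_left]
  rw [← Summable.tsum_finsetSum fun s _ => ((hf.mul (fun x => g (x * s))).summable.mul_left _)]
  refine tsum_congr fun x => ?_
  unfold Pop; rw [Finset.mul_sum]
  exact Finset.sum_congr rfl fun s _ => by ring

theorem Walk.pop_symm {μ : G → ℝ} {T : Finset G} (W : Walk μ T) {f g : G → ℝ}
    (hf : FS f) (hg : FS g) :
    ∑' x, f x * Pop μ T g x = ∑' x, g x * Pop μ T f x := by
  rw [tsum_mul_pop hf, tsum_mul_pop hg, ← W.sum_inv]
  refine Finset.sum_congr rfl fun s _ => ?_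
  rw [← tsum_shift _ s]
  congr 1
  refine tsum_congr fun x => ?_
  rw [mul_inv_cancel_right, mul_comm]

theorem Walk.energy {μ : G → ℝ} {T : Finset G} (W : Walk μ T) {f : G → ℝ} (hf : FS f) :
    ∑ s ∈ T, μ s * enr s f = 2 * nsq f - 2 * ∑' x, f x * Pop μ T f x := by
  have h : ∀ s, enr s f = 2 * nsq f - 2 * ∑' x, f x * f (x * s) := by
    intro s
    have h1 : nsq f = ∑' x, f (x * s) ^ 2 := (tsum_shift (fun x => f x ^ 2) s).symm
    have s1 := hf.sq.summable
    have s2 : Summable fun x => f (x * s) ^ 2 := (hf.shift s).sq.summable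
    have s3 := (hf.mul (fun x => f (x * s))).summable
    have : enr s f = ∑' x, (f x ^ 2 + f (x * s) ^ 2 - 2 * (f x * f (x * s))) :=
      tsum_congr fun x => by ring
    rw [this, (s1.add s2).tsum_sub (s3.mul_left 2), s1.tsum_add s2, ← h1, tsum_mul_left]
    unfold nsq; ring
  rw [tsum_mul_pop hf, Finset.mul_sum]
  simp_rw [h, mul_sub]
  rw [Finset.sum_sub_distrib, ← Finset.sum_mul, W.sum, one_mul]
  congr 1
  exact Finset.sum_congr rfl fun s _ => by ring

theorem Walk.enr_le {μ : G → ℝ} {T : Finset G} (W : Walk μ T) (g : G) :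
    ∃ C : ℝ, 0 ≤ C ∧ ∀ f, FS f → enr g f ≤ C * ∑ s ∈ T, μ s * enr s f := by
  have hE : ∀ f, 0 ≤ ∑ s ∈ T, μ s * enr s f := fun f =>
    Finset.sum_nonneg fun s _ => mul_nonneg (W.nn s) (enr_nonneg s f)
  have hg : g ∈ Subgroup.closure (T : Set G) := by
    have := W.gen; unfold Generates at this; rw [this]; trivial
  induction hg using Subgroup.closure_induction with
  | mem s hs =>
    refine ⟨(μ s)⁻¹, inv_nonneg.2 (W.nn s), fun f hf => ?_⟩
    have hp := W.pos hs
    have := Finset.single_le_sum (f := fun s => μ s * enr s f)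
      (fun s _ => mul_nonneg (W.nn s) (enr_nonneg s f)) hs
    rw [← div_eq_inv_mul, le_div_iff₀ hp, mul_comm]; exact this
  | one => exact ⟨0, le_rfl, fun f hf => by rw [enr_one]; simp⟩
  | mul x y _ _ hx hy =>
    obtain ⟨C, hC, h⟩ := hx
    obtain ⟨C', hC', h'⟩ := hy
    refine ⟨2 * C + 2 * C', by positivity, fun f hf => (enr_mul x y hf).trans ?_⟩
    have := h f hf; have := h' f hf; linarith
  | inv x _ hx =>
    obtain ⟨C, hC, h⟩ := hx
    exact ⟨C, hC, fun f hf => by rw [enr_inv]; exact h f hf⟩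

theorem Walk.gap1 [Infinite G] {μ : G → ℝ} {T : Finset G} (W : Walk μ T)
    (hq : ¬ QuasiIsometric (wordDist T) intDist) {δ : ℝ} (hδ : 0 ≤ δ)
    (hyp : IsHyperbolicWith (wordDist T) δ) :
    ∃ C : ℝ, 1 ≤ C ∧ ∀ f, FS f → nsq f ≤ C * ∑ s ∈ T, μ s * enr s f := by
  obtain ⟨A, hA, hd⟩ := exists_drift W.gen hq hδ hyp
  choose c hc0 hc using W.enr_le
  set M : ℝ := ∑ a ∈ A, (wordLength T a : ℝ) with hM
  have hMa : ∀ x, ∀ a ∈ A, |(wordLength T (x * a) : ℝ) - wordLength T x| ≤ M := by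
    intro x a ha
    have h0 : (wordLength T a : ℝ) ≤ M :=
      Finset.single_le_sum (f := fun a => (wordLength T a : ℝ)) (fun a _ => Nat.cast_nonneg _) ha
    have h1 : (wordLength T (x * a) : ℝ) ≤ wordLength T x + wordLength T a := by
      exact_mod_cast wl_mul W.gen x a
    have h2 : (wordLength T x : ℝ) ≤ wordLength T (x * a) + wordLength T a := by
      have := wl_mul W.gen (x * a) a⁻¹
      rw [mul_inv_cancel_right, wl_inv W.gen] at this
      exact_mod_cast this
    rw [abs_le]; constructor <;> linarith
  have hC0 : 0 ≤ M ^ 2 * A.card * ∑ a ∈ A, c a :=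
    mul_nonneg (by positivity) (Finset.sum_nonneg fun a _ => hc0 a)
  refine ⟨M ^ 2 * A.card * (∑ a ∈ A, c a) + 1, by linarith, fun f hf => ?_⟩
  have hE : 0 ≤ ∑ s ∈ T, μ s * enr s f :=
    Finset.sum_nonneg fun s _ => mul_nonneg (W.nn s) (enr_nonneg s f)
  have := drift_gap A hA (fun x => (wordLength T x : ℝ)) M hMa hd hf
  refine this.trans ?_
  have h2 : ∑ a ∈ A, enr a f ≤ (∑ a ∈ A, c a) * ∑ s ∈ T, μ s * enr s f := by
    rw [Finset.sum_mul]; exact Finset.sum_le_sum fun a _ => hc a f hf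
  have h3 : M ^ 2 * A.card * ∑ a ∈ A, enr a f ≤
      M ^ 2 * A.card * ((∑ a ∈ A, c a) * ∑ s ∈ T, μ s * enr s f) :=
    mul_le_mul_of_nonneg_left h2 (by positivity)
  rw [add_mul, mul_assoc (M ^ 2 * A.card)]; linarith

theorem Walk.gap2 [Infinite G] {μ : G → ℝ} {T : Finset G} (W : Walk μ T)
    (hq : ¬ QuasiIsometric (wordDist T) intDist) {δ : ℝ} (hδ : 0 ≤ δ)
    (hyp : IsHyperbolicWith (wordDist T) δ) :
    ∃ κ : ℝ, 0 < κ ∧ κ < 1 ∧ ∀ f, FS f → nsq (Pop μ T f) ≤ κ ^ 2 * nsq f := by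
  obtain ⟨C, hC, h⟩ := W.gap1 hq hδ hyp
  set κ := 1 - 1 / (2 * C) with hκ
  have hC2 : 1 / (2 * C) ≤ 1 / 2 := by
    rw [div_le_div_iff₀ (by positivity) (by norm_num)]; linarith
  have hC3 : 0 < 1 / (2 * C) := by positivity
  have hκ0 : 0 < κ := by linarith
  refine ⟨κ, hκ0, by linarith, ?_⟩
  have k1 : ∀ f, FS f → ∑' x, f x * Pop μ T f x ≤ κ * nsq f := by
    intro f hf
    have := h f hf
    rw [W.energy hf] at this
    have h2 : nsq f / (2 * C) ≤ nsq f - ∑' x, f x * Pop μ T f x := by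
      rw [div_le_iff₀ (by positivity)]; linarith
    have h3 : κ * nsq f = nsq f - nsq f / (2 * C) := by rw [hκ]; ring
    linarith
  have k2 : ∀ f, FS f → -(∑' x, f x * Pop μ T f x) ≤ κ * nsq f := by
    intro f hf
    have hf' : FS (fun x => |f x|) := hf.of_zero fun x hx => by simp [hx]
    have h1 := k1 _ hf'
    have h2 : nsq (fun x => |f x|) = nsq f := tsum_congr fun x => sq_abs _
    rw [h2] at h1
    refine le_trans ?_ h1
    rw [← tsum_neg]
    refine (hf.mul _).summable.neg.tsum_le_tsum (fun x => ?_) (hf'.mul _).summable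
    have h3 : |Pop μ T f x| ≤ Pop μ T (fun x => |f x|) x := by
      unfold Pop
      refine (Finset.abs_sum_le_sum_abs _ _).trans (Finset.sum_le_sum fun s _ => ?_)
      rw [abs_mul, abs_of_nonneg (W.nn s)]
    calc -(f x * Pop μ T f x) ≤ |f x * Pop μ T f x| := neg_le_abs _
      _ = |f x| * |Pop μ T f x| := abs_mul _ _
      _ ≤ _ := by gcongr
  have k3 : ∀ f g, FS f → FS g → ∑' x, g x * Pop μ T f x ≤ κ / 2 * (nsq f + nsq g) := by
    intro f g hf hg
    have a1 := k1 _ (hf.add hg)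
    have a2 := k2 _ (hf.sub hg)
    have Padd : ∀ x, Pop μ T (fun x => f x + g x) x = Pop μ T f x + Pop μ T g x := by
      intro x; unfold Pop; rw [← Finset.sum_add_distrib]
      exact Finset.sum_congr rfl fun s _ => by ring
    have Psub : ∀ x, Pop μ T (fun x => f x - g x) x = Pop μ T f x - Pop μ T g x := by
      intro x; unfold Pop; rw [← Finset.sum_sub_distrib]
      exact Finset.sum_congr rfl fun s _ => by ring
    have s1 := (hf.mul (Pop μ T f)).summable
    have s2 := (hf.mul (Pop μ T g)).summable
    have s3 := (hg.mul (Pop μ T f)).summable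
    have s4 := (hg.mul (Pop μ T g)).summable
    have e1 : ∑' x, (f x + g x) * Pop μ T (fun x => f x + g x) x =
        ∑' x, f x * Pop μ T f x + ∑' x, f x * Pop μ T g x +
        (∑' x, g x * Pop μ T f x + ∑' x, g x * Pop μ T g x) := by
      rw [← s1.tsum_add s2, ← s3.tsum_add s4, ← (s1.add s2).tsum_add (s3.add s4)]
      exact tsum_congr fun x => by rw [Padd]; ring
    have e2 : ∑' x, (f x - g x) * Pop μ T (fun x => f x - g x) x =
        ∑' x, f x * Pop μ T f x - ∑' x, f x * Pop μ T g x -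
        (∑' x, g x * Pop μ T f x - ∑' x, g x * Pop μ T g x) := by
      rw [← s1.tsum_sub s2, ← s3.tsum_sub s4, ← (s1.sub s2).tsum_sub (s3.sub s4)]
      exact tsum_congr fun x => by rw [Psub]; ring
    have e3 : nsq (fun x => f x + g x) + nsq (fun x => f x - g x) = 2 * (nsq f + nsq g) := by
      unfold nsq
      rw [← hf.sq.summable.tsum_add hg.sq.summable, ← tsum_mul_left,
        ← (hf.add hg).sq.summable.tsum_add (hf.sub hg).sq.summable]
      exact tsum_congr fun x => by ring
    have e4 := W.pop_symm hf hg
    rw [e1] at a1; rw [e2] at a2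
    have : κ * nsq (fun x => f x + g x) + κ * nsq (fun x => f x - g x) =
      κ * (2 * (nsq f + nsq g)) := by rw [← e3]; ring
    linarith
  intro f hf
  have hP := hf.pop μ T
  have h4 := k3 f (fun x => κ⁻¹ * Pop μ T f x) hf (hP.mul_l _)
  have h5 : ∑' x, κ⁻¹ * Pop μ T f x * Pop μ T f x = κ⁻¹ * nsq (Pop μ T f) := by
    unfold nsq; rw [← tsum_mul_left]; exact tsum_congr fun x => by ring
  have h6 : nsq (fun x => κ⁻¹ * Pop μ T f x) = κ⁻¹ ^ 2 * nsq (Pop μ T f) := by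
    unfold nsq; rw [← tsum_mul_left]; exact tsum_congr fun x => by ring
  rw [h5, h6] at h4
  have h7 : κ / 2 * (nsq f + κ⁻¹ ^ 2 * nsq (Pop μ T f)) =
    κ / 2 * nsq f + κ⁻¹ * nsq (Pop μ T f) / 2 := by field_simp
  rw [h7] at h4
  have h8 : κ⁻¹ * nsq (Pop μ T f) ≤ κ * nsq f := by linarith
  rw [inv_mul_le_iff₀ hκ0] at h8
  linarith

/-- Iterated Markov operator applied to the indicator of `1`, as convolution powers. -/
theorem Walk.conv_succ {μ : G → ℝ} {T : Finset G} (W : Walk μ T) (n : ℕ) (g : G) :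
    convPow μ (n + 1) g = Pop μ T (convPow μ n) g := by
  classical
  show ∑' y : G, convPow μ n y * μ (y⁻¹ * g) = _
  have h1 : ∑' y : G, convPow μ n y * μ (y⁻¹ * g) =
      ∑' s : G, convPow μ n (g * s⁻¹) * μ s := by
    let e : G ≃ G := (Equiv.inv G).trans (Equiv.mulLeft g)
    rw [← e.tsum_eq]
    refine tsum_congr fun s => ?_
    simp [e]
  rw [h1, tsum_eq_sum (s := T)]
  · unfold Pop; rw [← W.sum_inv]
    exact Finset.sum_congr rfl fun s _ => mul_comm _ _
  · intro s hs
    rw [W.mem, not_not] at hs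
    simp [hs]

theorem conv_zero_FS (μ : G → ℝ) : FS (convPow μ 0) := by
  classical
  refine (Set.finite_singleton (1 : G)).subset fun x hx => ?_
  by_contra h
  exact hx (if_neg h)

theorem Walk.conv_nonneg {μ : G → ℝ} {T : Finset G} (W : Walk μ T) (n : ℕ) (g : G) :
    0 ≤ convPow μ n g := by
  classical
  induction n generalizing g with
  | zero => show 0 ≤ (if g = 1 then (1 : ℝ) else 0); split_ifs <;> norm_num
  | succ n ih =>
    rw [W.conv_succ]
    exact Finset.sum_nonneg fun s _ => mul_nonneg (W.nn s) (ih _)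

theorem Walk.conv_bound [Infinite G] {μ : G → ℝ} {T : Finset G} (W : Walk μ T)
    (hq : ¬ QuasiIsometric (wordDist T) intDist) {δ : ℝ} (hδ : 0 ≤ δ)
    (hyp : IsHyperbolicWith (wordDist T) δ) :
    ∃ κ : ℝ, 0 < κ ∧ κ < 1 ∧ ∀ n g, convPow μ n g ≤ κ ^ n := by
  classical
  obtain ⟨κ, h0, h1, h⟩ := W.gap2 hq hδ hyp
  refine ⟨κ, h0, h1, ?_⟩
  have key : ∀ n, FS (convPow μ n) ∧ nsq (convPow μ n) ≤ (κ ^ n) ^ 2 := by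
    intro n
    induction n with
    | zero =>
      refine ⟨conv_zero_FS μ, ?_⟩
      unfold nsq
      rw [tsum_eq_single (1 : G)]
      · simp [convPow]
      · intro b hb; simp [convPow, hb]
    | succ n ih =>
      have e : convPow μ (n + 1) = Pop μ T (convPow μ n) := funext fun g => W.conv_succ n g
      rw [e]
      refine ⟨ih.1.pop μ T, (h _ ih.1).trans ?_⟩
      calc κ ^ 2 * nsq (convPow μ n) ≤ κ ^ 2 * (κ ^ n) ^ 2 := by gcongr; exact ih.2
        _ = _ := by ring
  intro n g
  have h2 : convPow μ n g ^ 2 ≤ nsq (convPow μ n) :=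
    (key n).1.sq.summable.le_tsum g fun x _ => sq_nonneg _
  exact le_of_sq_le_sq (h2.trans (key n).2) (by positivity)



/-- Walk with exponentially decaying return probabilities. -/
structure SWalk (μ : G → ℝ) (T : Finset G) (κ : ℝ) : Prop extends Walk μ T where
  k0 : 0 < κ
  k1 : κ < 1
  bd : ∀ n g, convPow μ n g ≤ κ ^ n

/-- The Green function based at `1`. -/
def G0 (μ : G → ℝ) (x : G) : ℝ := ∑' n : ℕ, convPow μ n x

section
variable {μ : G → ℝ} {T : Finset G} {κ : ℝ}

theorem Walk.pop_mono (W : Walk μ T) {f g : G → ℝ} (h : ∀ x, f x ≤ g x) (x : G) :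
    Pop μ T f x ≤ Pop μ T g x :=
  Finset.sum_le_sum fun s _ => mul_le_mul_of_nonneg_left (h _) (W.nn s)

theorem Walk.pop_nonneg (W : Walk μ T) {f : G → ℝ} (h : ∀ x, 0 ≤ f x) (x : G) :
    0 ≤ Pop μ T f x :=
  Finset.sum_nonneg fun s _ => mul_nonneg (W.nn s) (h _)

theorem Walk.iter_nonneg (W : Walk μ T) {f : G → ℝ} (h : ∀ x, 0 ≤ f x) (N : ℕ) (x : G) :
    0 ≤ (Pop μ T)^[N] f x := by
  induction N generalizing x with
  | zero => exact h x
  | succ N ih => rw [Function.iterate_succ_apply']; exact W.pop_nonneg ih x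

theorem pop_add (f g : G → ℝ) (x : G) :
    Pop μ T (fun x => f x + g x) x = Pop μ T f x + Pop μ T g x := by
  unfold Pop; rw [← Finset.sum_add_distrib]
  exact Finset.sum_congr rfl fun s _ => by ring

theorem pop_sub (f g : G → ℝ) (x : G) :
    Pop μ T (fun x => f x - g x) x = Pop μ T f x - Pop μ T g x := by
  unfold Pop; rw [← Finset.sum_sub_distrib]
  exact Finset.sum_congr rfl fun s _ => by ring

theorem pop_smul (c : ℝ) (f : G → ℝ) (x : G) :
    Pop μ T (fun x => c * f x) x = c * Pop μ T f x := by
  unfold Pop; rw [Finset.mul_sum]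
  exact Finset.sum_congr rfl fun s _ => by ring

theorem iter_smul (c : ℝ) (f : G → ℝ) (N : ℕ) (x : G) :
    (Pop μ T)^[N] (fun x => c * f x) x = c * (Pop μ T)^[N] f x := by
  induction N generalizing x with
  | zero => rfl
  | succ N ih =>
    rw [Function.iterate_succ_apply', Function.iterate_succ_apply', ← pop_smul]
    exact Finset.sum_congr rfl fun s _ => by rw [ih]

theorem pop_left (f : G → ℝ) (y x : G) :
    Pop μ T (fun x => f (y * x)) x = Pop μ T f (y * x) := by
  unfold Pop; simp only [mul_assoc]

theorem iter_left (f : G → ℝ) (y : G) (N : ℕ) (x : G) :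
    (Pop μ T)^[N] (fun x => f (y * x)) x = (Pop μ T)^[N] f (y * x) := by
  induction N generalizing x with
  | zero => rfl
  | succ N ih =>
    rw [Function.iterate_succ_apply', Function.iterate_succ_apply', ← pop_left]
    exact Finset.sum_congr rfl fun s _ => by rw [ih]

theorem Walk.conv_succ_left (W : Walk μ T) (n : ℕ) (x : G) :
    convPow μ (n + 1) x = ∑ s ∈ T, μ s * convPow μ n (s * x) := by
  classical
  induction n generalizing x with
  | zero =>
    rw [W.conv_succ]
    refine Finset.sum_congr rfl fun s _ => ?_
    have : x * s = 1 ↔ s * x = 1 := mul_eq_one_comm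
    simp only [convPow, this]
  | succ n ih =>
    trans ∑ s ∈ T, ∑ t ∈ T, μ s * (μ t * convPow μ n (t * (x * s)))
    · rw [W.conv_succ]; unfold Pop
      simp_rw [ih, Finset.mul_sum]
    rw [Finset.sum_comm]
    refine Finset.sum_congr rfl fun t _ => ?_
    rw [W.conv_succ]; unfold Pop
    rw [Finset.mul_sum]
    exact Finset.sum_congr rfl fun s _ => by rw [mul_assoc]; ring

theorem Walk.conv_inv (W : Walk μ T) (n : ℕ) (x : G) : convPow μ n x⁻¹ = convPow μ n x := by
  classical
  induction n generalizing x with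
  | zero => simp [convPow]
  | succ n ih =>
    rw [W.conv_succ, W.conv_succ_left]; unfold Pop
    rw [← W.sum_inv (fun s => convPow μ n (s * x))]
    refine Finset.sum_congr rfl fun s _ => ?_
    rw [← ih]; congr 2; group

theorem Walk.conv_wl (W : Walk μ T) (n : ℕ) (x : G) (h : convPow μ n x ≠ 0) :
    wordLength T x ≤ n := by
  classical
  induction n generalizing x with
  | zero =>
    have : x = 1 := by by_contra hx; exact h (by simp [convPow, hx])
    rw [this, wl_one]
  | succ n ih =>
    rw [W.conv_succ] at h
    obtain ⟨s, hs, h1⟩ := Finset.exists_ne_zero_of_sum_ne_zero h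
    have h2 := ih (x * s) (right_ne_zero_of_mul h1)
    have h3 := wl_mul W.gen (x * s) s⁻¹
    rw [mul_inv_cancel_right, wl_inv W.gen] at h3
    have := wl_mem_le hs
    omega

theorem Walk.iter_conv (W : Walk μ T) (n N : ℕ) : (Pop μ T)^[N] (convPow μ n) = convPow μ (n + N) := by
  induction N with
  | zero => rfl
  | succ N ih =>
    rw [Function.iterate_succ_apply', ih]
    exact (funext fun g => W.conv_succ (n + N) g).symm

theorem SWalk.summable (W : SWalk μ T κ) (x : G) : Summable fun n => convPow μ n x :=
  Summable.of_nonneg_of_le (fun n => W.conv_nonneg n x) (fun n => W.bd n x)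
    (summable_geometric_of_lt_one W.k0.le W.k1)

theorem SWalk.summable_tail (W : SWalk μ T κ) (N : ℕ) (x : G) :
    Summable fun n => convPow μ (n + N) x :=
  (summable_nat_add_iff (f := fun n => convPow μ n x) N).2 (W.summable x)

theorem SWalk.iter_G0 (W : SWalk μ T κ) (N : ℕ) (x : G) :
    (Pop μ T)^[N] (G0 μ) x = ∑' n : ℕ, convPow μ (n + N) x := by
  induction N generalizing x with
  | zero => rfl
  | succ N ih =>
    rw [Function.iterate_succ_apply']
    show ∑ s ∈ T, μ s * (Pop μ T)^[N] (G0 μ) (x * s) = _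
    simp_rw [ih, ← tsum_mul_left]
    rw [← Summable.tsum_finsetSum fun s _ => (W.summable_tail N (x * s)).mul_left _]
    refine tsum_congr fun n => ?_
    rw [← add_assoc, W.conv_succ]; rfl

theorem SWalk.iter_G0_le (W : SWalk μ T κ) (N : ℕ) (x : G) :
    (Pop μ T)^[N] (G0 μ) x ≤ κ ^ N / (1 - κ) := by
  rw [W.iter_G0, div_eq_mul_inv, ← tsum_geometric_of_lt_one W.k0.le W.k1, ← tsum_mul_left]
  refine (W.summable_tail N x).tsum_le_tsum (fun n => ?_)
    ((summable_geometric_of_lt_one W.k0.le W.k1).mul_left _)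
  rw [← pow_add, add_comm N n]; exact W.bd _ _

theorem SWalk.G0_nonneg (W : SWalk μ T κ) (x : G) : 0 ≤ G0 μ x :=
  tsum_nonneg fun n => W.conv_nonneg n x

theorem SWalk.G0_inv (W : SWalk μ T κ) (x : G) : G0 μ x⁻¹ = G0 μ x :=
  tsum_congr fun n => W.conv_inv n x

theorem SWalk.G0_one (W : SWalk μ T κ) : G0 μ (1 : G) = 1 + Pop μ T (G0 μ) 1 := by
  have h := W.iter_G0 1 (1 : G)
  simp only [Function.iterate_one] at h
  rw [h]
  unfold G0
  rw [(W.summable 1).tsum_eq_zero_add]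
  simp [convPow]

theorem SWalk.G0_pop (W : SWalk μ T κ) {x : G} (hx : x ≠ 1) : G0 μ x = Pop μ T (G0 μ) x := by
  have h := W.iter_G0 1 x
  simp only [Function.iterate_one] at h
  rw [h]
  unfold G0
  rw [(W.summable x).tsum_eq_zero_add]
  simp [convPow, hx]

theorem SWalk.G0_super (W : SWalk μ T κ) (x : G) : Pop μ T (G0 μ) x ≤ G0 μ x := by
  by_cases h : x = 1
  · rw [h, W.G0_one]; linarith
  · exact (W.G0_pop h).ge

theorem SWalk.G0_one_ge (W : SWalk μ T κ) : 1 ≤ G0 μ (1 : G) := by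
  rw [W.G0_one]; linarith [W.pop_nonneg W.G0_nonneg (1 : G)]

theorem SWalk.G0_le (W : SWalk μ T κ) (x : G) : G0 μ x ≤ κ ^ (wordLength T x) / (1 - κ) := by
  have : G0 μ x = (Pop μ T)^[wordLength T x] (G0 μ) x := by
    rw [W.iter_G0]
    unfold G0
    rw [← (W.summable x).sum_add_tsum_nat_add (wordLength T x), Finset.sum_eq_zero, zero_add]
    intro n hn
    by_contra h
    have := W.conv_wl n x h
    rw [Finset.mem_range] at hn; omega
  rw [this]; exact W.iter_G0_le _ _

theorem SWalk.exists_m (W : SWalk μ T κ) : ∃ m : ℝ, 0 < m ∧ m ≤ 1 ∧ ∀ s ∈ T, m ≤ μ s := by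
  have hne : T.Nonempty := by
    by_contra h
    rw [Finset.not_nonempty_iff_eq_empty] at h
    have := W.sum; rw [h] at this; simp at this
  obtain ⟨s, hs, h⟩ := T.exists_min_image μ hne
  refine ⟨μ s, W.pos hs, ?_, h⟩
  rw [← W.sum]
  exact Finset.single_le_sum (fun s _ => W.nn s) hs

theorem SWalk.super_harnack (W : SWalk μ T κ) {m : ℝ} (hm0 : 0 < m) (hm : ∀ s ∈ T, m ≤ μ s)
    {f : G → ℝ} (hf0 : ∀ x, 0 ≤ f x) (hf : ∀ x, Pop μ T f x ≤ f x) (x g : G) :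
    m ^ (wordLength T g) * f (x * g) ≤ f x := by
  have step : ∀ y, ∀ s ∈ T, m * f (y * s) ≤ f y := by
    intro y s hs
    refine le_trans ?_ (hf y)
    refine le_trans (mul_le_mul_of_nonneg_right (hm s hs) (hf0 _)) ?_
    exact Finset.single_le_sum (f := fun s => μ s * f (y * s))
      (fun s _ => mul_nonneg (W.nn s) (hf0 _)) hs
  obtain ⟨l, h1, h2, h3⟩ := wl_exists W.gen g
  rw [← h1, ← h3]
  clear h1 h3
  induction l generalizing x with
  | nil => simp
  | cons a l ih =>
    have ha : a ∈ T := by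
      rcases h2 a (by simp) with h | h
      · exact h
      · simpa using W.inv_mem h
    have h4 := ih (x * a) (fun b hb => h2 b (by simp [hb]))
    have h5 := step x a ha
    simp only [List.length_cons, List.prod_cons]
    calc m ^ (l.length + 1) * f (x * (a * l.prod))
        = m * (m ^ l.length * f (x * a * l.prod)) := by rw [mul_assoc x a]; ring
      _ ≤ m * f (x * a) := mul_le_mul_of_nonneg_left h4 hm0.le
      _ ≤ f x := h5

theorem SWalk.G0_pos (W : SWalk μ T κ) (x : G) : 0 < G0 μ x := by
  obtain ⟨m, hm0, _, hm⟩ := W.exists_m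
  have := W.super_harnack hm0 hm W.G0_nonneg W.G0_super x x⁻¹
  rw [mul_inv_cancel] at this
  have h1 := W.G0_one_ge
  have : 0 < m ^ wordLength T x⁻¹ * G0 μ 1 := by positivity
  linarith

/-- `Av T B E n v`: there is a `T`-path of length `n` from `v` to `E` avoiding `B`. -/
def Av (T : Finset G) (B E : Set G) : ℕ → G → Prop
  | 0, v => v ∉ B ∧ v ∈ E
  | n + 1, v => v ∉ B ∧ ∃ s ∈ T, Av T B E n (v * s)

theorem Walk.compare (W : Walk μ T) {D w : G → ℝ} {B E : Set G} (hDw : ∀ v, D v ≤ w v)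
    (hw : ∀ v, 0 ≤ w v) (hB : ∀ v ∈ B, D v ≤ 0)
    (hD : ∀ v, v ∉ B → v ∉ E → D v ≤ Pop μ T D v) (N : ℕ) (v : G)
    (hv : ∀ n < N, ¬ Av T B E n v) : D v ≤ (Pop μ T)^[N] w v := by
  induction N generalizing v with
  | zero => exact hDw v
  | succ N ih =>
    by_cases hvB : v ∈ B
    · exact (hB v hvB).trans (W.iter_nonneg hw _ _)
    have hE : v ∉ E := fun h => hv 0 (by omega) ⟨hvB, h⟩
    refine (hD v hvB hE).trans ?_
    rw [Function.iterate_succ_apply']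
    refine Finset.sum_le_sum fun s hs => mul_le_mul_of_nonneg_left ?_ (W.nn s)
    exact ih (v * s) fun n hn h => hv (n + 1) (by omega) ⟨hvB, s, hs, h⟩

theorem not_av_empty (B : Set G) (n : ℕ) (v : G) : ¬ Av T B ∅ n v := by
  induction n generalizing v with
  | zero => intro h; exact h.2
  | succ n ih => rintro ⟨_, s, _, h⟩; exact ih _ h

/-- Maximum principle: subharmonic off `B`, nonpositive on `B`, dominated by a potential. -/
theorem SWalk.maxprin (W : SWalk μ T κ) {D : G → ℝ} {B : Set G} (A : Finset G) (c : G → ℝ)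
    (hc : ∀ a, 0 ≤ c a)
    (hDw : ∀ v, D v ≤ ∑ a ∈ A, c a * G0 μ (a⁻¹ * v)) (hB : ∀ v ∈ B, D v ≤ 0)
    (hD : ∀ v, v ∉ B → D v ≤ Pop μ T D v) (v : G) : D v ≤ 0 := by
  set w : G → ℝ := fun v => ∑ a ∈ A, c a * G0 μ (a⁻¹ * v) with hw
  have hw0 : ∀ v, 0 ≤ w v := fun v => Finset.sum_nonneg fun a _ => mul_nonneg (hc a) (W.G0_nonneg _)
  have h1 : ∀ N, D v ≤ (Pop μ T)^[N] w v := fun N =>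
    W.compare (E := ∅) hDw hw0 hB (fun v h _ => hD v h) N v fun n _ => not_av_empty B n v
  have h2 : ∀ N v, (Pop μ T)^[N] w v = ∑ a ∈ A, c a * (Pop μ T)^[N] (G0 μ) (a⁻¹ * v) := by
    intro N
    induction N with
    | zero => intro v; rfl
    | succ N ih =>
      intro v
      simp only [Function.iterate_succ_apply']
      unfold Pop at ih ⊢
      simp_rw [ih, Finset.mul_sum]
      rw [Finset.sum_comm]
      refine Finset.sum_congr rfl fun a _ => Finset.sum_congr rfl fun s _ => ?_
      rw [mul_assoc a⁻¹]; ring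
  have h3 : ∀ N, D v ≤ (∑ a ∈ A, c a) * (κ ^ N / (1 - κ)) := by
    intro N
    refine (h1 N).trans ?_
    rw [h2, Finset.sum_mul]
    exact Finset.sum_le_sum fun a _ => mul_le_mul_of_nonneg_left (W.iter_G0_le _ _) (hc a)
  have h4 : Tendsto (fun N : ℕ => (∑ a ∈ A, c a) * (κ ^ N / (1 - κ))) atTop (𝓝 0) := by
    have := ((tendsto_pow_atTop_nhds_zero_of_lt_one W.k0.le W.k1).div_const (1 - κ)).const_mul
      (∑ a ∈ A, c a)
    simpa using this
  exact ge_of_tendsto' h4 h3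

theorem SWalk.submul (W : SWalk μ T κ) (x y : G) :
    G0 μ x * G0 μ y ≤ G0 μ 1 * G0 μ (x * y) := by
  classical
  -- D v = G0 v * G0 y - G0 1 * G0 (v * y)
  have hv : ∀ v, G0 μ (v * y) = G0 μ (y⁻¹ * v⁻¹) := fun v => by rw [← W.G0_inv]; congr 1; group
  have hinv : ∀ v, Pop μ T (fun v => G0 μ (y * v)) v = Pop μ T (G0 μ) (y * v) :=
    fun v => pop_left _ _ _
  have := W.maxprin (D := fun v => G0 μ v * G0 μ y - G0 μ 1 * G0 μ (y⁻¹ * v)) (B := {1}) {1}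
    (fun _ => G0 μ y) (fun _ => W.G0_nonneg _) ?_ ?_ ?_ x⁻¹
  · rw [W.G0_inv] at this
    have h : G0 μ (y⁻¹ * x⁻¹) = G0 μ (x * y) := by rw [← W.G0_inv]; congr 1; group
    rw [h] at this; linarith
  · intro v
    simp only [Finset.sum_singleton, inv_one, one_mul]
    have := mul_nonneg (W.G0_nonneg 1) (W.G0_nonneg (y⁻¹ * v))
    linarith
  · rintro v rfl
    simp [W.G0_inv]
  · intro v hv1
    have e : Pop μ T (fun v => G0 μ v * G0 μ y - G0 μ 1 * G0 μ (y⁻¹ * v)) v =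
        G0 μ y * Pop μ T (G0 μ) v - G0 μ 1 * Pop μ T (G0 μ) (y⁻¹ * v) := by
      rw [← pop_left, ← pop_smul, ← pop_smul, ← pop_sub]
      congr 1; funext v; ring
    rw [e, ← W.G0_pop hv1]
    have h1 := mul_le_mul_of_nonneg_left (W.G0_super (y⁻¹ * v)) (W.G0_nonneg 1)
    linarith
end



theorem fhp_nil (x y : G) : IsFirstHitPath x y [] ↔ x = y := by
  simp [IsFirstHitPath, walkPositions]

theorem fhp_cons (x y a : G) (l : List G) :
    IsFirstHitPath x y (a :: l) ↔ x ≠ y ∧ IsFirstHitPath (x * a) y l := by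
  unfold IsFirstHitPath walkPositions
  rw [List.scanl_cons]
  have hne : List.scanl (fun p a => p * a) (x * a) l ≠ [] := by
    cases l <;> simp [List.scanl]
  rw [List.dropLast_cons_of_ne_nil hne, List.getLast?_cons]
  constructor
  · rintro ⟨h1, h2⟩
    rw [List.mem_cons, not_or] at h2
    refine ⟨fun h => h2.1 h.symm, ?_, h2.2⟩
    rw [List.getLast?_eq_some_getLast hne] at h1 ⊢
    simpa using h1
  · rintro ⟨h1, h2, h3⟩
    refine ⟨by rw [h2]; rfl, ?_⟩
    rw [List.mem_cons, not_or]
    exact ⟨fun h => h1 h.symm, h3⟩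

def listEq (α : Type*) : Unit ⊕ (α × List α) ≃ List α where
  toFun o := match o with
    | Sum.inl _ => []
    | Sum.inr p => p.1 :: p.2
  invFun l := match l with
    | [] => Sum.inl ()
    | a :: l => Sum.inr (a, l)
  left_inv o := by cases o <;> rfl
  right_inv l := by cases l <;> rfl

theorem tsum_list {α : Type*} (f : List α → ℝ≥0∞) :
    ∑' l, f l = f [] + ∑' a, ∑' l, f (a :: l) := by
  rw [← (listEq α).tsum_eq, ← ENNReal.tsum_prod (f := fun a l => f (a :: l))]
  have h1 : HasSum ((fun c => f (listEq α c)) ∘ Sum.inl) (f []) := by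
    have := hasSum_unique ((fun c => f (listEq α c)) ∘ (Sum.inl : Unit → Unit ⊕ (α × List α)))
    exact this
  have h2 : HasSum ((fun c => f (listEq α c)) ∘ Sum.inr) (∑' p : α × List α, f (p.1 :: p.2)) :=
    ENNReal.summable.hasSum
  exact (h1.sum h2).tsum_eq

section
variable {μ : G → ℝ} {T : Finset G} {κ : ℝ}

open scoped Classical in
/-- truncated hitting probability -/
def hitE (μ : G → ℝ) (y : G) (n : ℕ) (x : G) : ℝ≥0∞ :=
  ∑' l : List G, if IsFirstHitPath x y l ∧ l.length < n then
    (l.map fun a => ENNReal.ofReal (μ a)).prod else 0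

open scoped Classical in
def hitT (μ : G → ℝ) (y : G) (x : G) : ℝ≥0∞ :=
  ∑' l : List G, if IsFirstHitPath x y l then
    (l.map fun a => ENNReal.ofReal (μ a)).prod else 0

theorem Walk.tsum_T (W : Walk μ T) (f : G → ℝ≥0∞) :
    ∑' a, ENNReal.ofReal (μ a) * f a = ∑ s ∈ T, ENNReal.ofReal (μ s) * f s := by
  refine tsum_eq_sum fun s hs => ?_
  rw [W.mem, not_not] at hs
  simp [hs]

theorem Walk.hitE_succ (W : Walk μ T) (y : G) (n : ℕ) (x : G) (hxy : x ≠ y) :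
    hitE μ y (n + 1) x = ∑ s ∈ T, ENNReal.ofReal (μ s) * hitE μ y n (x * s) := by
  classical
  unfold hitE
  rw [tsum_list, ← W.tsum_T (fun s => ∑' l : List G, if IsFirstHitPath (x * s) y l ∧ l.length < n then
    (l.map fun a => ENNReal.ofReal (μ a)).prod else 0)]
  simp only [fhp_nil, hxy, false_and, if_false, zero_add, fhp_cons, ne_eq, not_false_eq_true,
    true_and, List.length_cons, Nat.add_lt_add_iff_right, List.map_cons, List.prod_cons]
  refine tsum_congr fun a => ?_
  rw [← ENNReal.tsum_mul_left]
  refine tsum_congr fun l => ?_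
  split_ifs <;> simp

theorem Walk.hitT_eq (W : Walk μ T) (y : G) (x : G) (hxy : x ≠ y) :
    hitT μ y x = ∑ s ∈ T, ENNReal.ofReal (μ s) * hitT μ y (x * s) := by
  classical
  unfold hitT
  rw [tsum_list, ← W.tsum_T (fun s => ∑' l : List G, if IsFirstHitPath (x * s) y l then
    (l.map fun a => ENNReal.ofReal (μ a)).prod else 0)]
  simp only [fhp_nil, hxy, if_false, zero_add, fhp_cons, ne_eq, not_false_eq_true,
    true_and, List.map_cons, List.prod_cons]
  refine tsum_congr fun a => ?_
  rw [← ENNReal.tsum_mul_left]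
  refine tsum_congr fun l => ?_
  split_ifs <;> simp

theorem hitT_self (y : G) : hitT μ y y = 1 := by
  classical
  unfold hitT
  rw [tsum_list]
  simp [fhp_nil, fhp_cons]

theorem hitE_self_le (y : G) (n : ℕ) : hitE μ y n y ≤ 1 := by
  classical
  rw [← hitT_self (μ := μ) y]
  unfold hitE hitT
  refine ENNReal.tsum_le_tsum fun l => ?_
  split_ifs with h1 h2 <;> first | exact le_rfl | exact absurd h1.1 h2 | exact zero_le

/-- Green kernel ratio -/
def Fk (μ : G → ℝ) (x : G) : ℝ := G0 μ x / G0 μ 1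

theorem SWalk.Fk_pos (W : SWalk μ T κ) (x : G) : 0 < Fk μ x := div_pos (W.G0_pos _) (W.G0_pos _)
theorem SWalk.Fk_one (W : SWalk μ T κ) : Fk μ (1 : G) = 1 := div_self (W.G0_pos _).ne'

theorem SWalk.Fk_pop (W : SWalk μ T κ) {x : G} (hx : x ≠ 1) : Fk μ x = Pop μ T (Fk μ) x := by
  have : Fk μ = fun x : G => (G0 μ 1)⁻¹ * G0 μ x := by
    funext x; unfold Fk; rw [div_eq_inv_mul]
  rw [this, pop_smul, ← W.G0_pop hx]

theorem ofReal_pop (W : Walk μ T) {f : G → ℝ} (hf : ∀ x, 0 ≤ f x) (x : G) :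
    ENNReal.ofReal (Pop μ T f x) = ∑ s ∈ T, ENNReal.ofReal (μ s) * ENNReal.ofReal (f (x * s)) := by
  unfold Pop
  rw [ENNReal.ofReal_sum_of_nonneg fun s _ => mul_nonneg (W.nn s) (hf _)]
  exact Finset.sum_congr rfl fun s _ => ENNReal.ofReal_mul (W.nn s)

theorem SWalk.hitE_le (W : SWalk μ T κ) (y : G) (n : ℕ) (x : G) :
    hitE μ y n x ≤ ENNReal.ofReal (Fk μ (y⁻¹ * x)) := by
  induction n generalizing x with
  | zero => simp [hitE]
  | succ n ih =>
    by_cases hxy : x = y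
    · subst hxy
      rw [inv_mul_cancel, W.Fk_one, ENNReal.ofReal_one]; exact hitE_self_le _ _
    · have h1 : y⁻¹ * x ≠ 1 := by
        intro h; exact hxy (inv_mul_eq_one.1 h).symm
      rw [W.hitE_succ y n x hxy, W.Fk_pop h1, ofReal_pop W.toWalk fun x => (W.Fk_pos x).le]
      refine Finset.sum_le_sum fun s _ => ?_
      rw [mul_assoc]
      gcongr
      exact ih _

theorem SWalk.hitT_le (W : SWalk μ T κ) (y x : G) :
    hitT μ y x ≤ ENNReal.ofReal (Fk μ (y⁻¹ * x)) := by
  classical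
  unfold hitT
  rw [ENNReal.tsum_eq_iSup_sum]
  refine iSup_le fun s => ?_
  refine le_trans ?_ (W.hitE_le y (s.sup List.length + 1) x)
  unfold hitE
  refine le_trans (Finset.sum_le_sum (g := fun l : List G =>
    if IsFirstHitPath x y l ∧ l.length < s.sup List.length + 1 then
    (l.map fun a => ENNReal.ofReal (μ a)).prod else 0) fun l hl => ?_) (ENNReal.sum_le_tsum s)
  have : l.length < s.sup List.length + 1 := Nat.lt_succ_of_le (Finset.le_sup (f := List.length) hl)
  simp [this]

theorem SWalk.hitT_eq_Fk (W : SWalk μ T κ) (y x : G) :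
    (hitT μ y x).toReal = Fk μ (y⁻¹ * x) := by
  have hfin : ∀ x, hitT μ y x ≠ ⊤ := fun x => ((W.hitT_le y x).trans_lt ENNReal.ofReal_lt_top).ne
  apply le_antisymm
  · exact ENNReal.toReal_le_of_le_ofReal (W.Fk_pos _).le (W.hitT_le y x)
  have hpos := W.G0_pos (1 : G)
  have := W.maxprin (D := fun v => Fk μ (y⁻¹ * v) - (hitT μ y v).toReal) (B := {y}) {y}
    (fun _ => (G0 μ 1)⁻¹) (fun _ => by positivity) ?_ ?_ ?_ x
  · linarith
  · intro v
    simp only [Finset.sum_singleton]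
    unfold Fk
    rw [div_eq_inv_mul]
    linarith [ENNReal.toReal_nonneg (a := hitT μ y v)]
  · rintro v rfl
    rw [inv_mul_cancel, W.Fk_one, hitT_self]; simp
  · intro v hv
    have h1 : y⁻¹ * v ≠ 1 := by
      intro h; exact hv (inv_mul_eq_one.1 h).symm
    rw [pop_sub, pop_left, ← W.Fk_pop h1]
    have : (hitT μ y v).toReal = Pop μ T (fun v => (hitT μ y v).toReal) v := by
      rw [W.hitT_eq y v hv, ENNReal.toReal_sum]
      · refine Finset.sum_congr rfl fun s _ => ?_
        rw [ENNReal.toReal_mul, ENNReal.toReal_ofReal (W.nn s)]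
      · intro s _; exact ENNReal.mul_ne_top ENNReal.ofReal_ne_top (hfin _)
    rw [← this]

theorem SWalk.hitProb_eq (W : SWalk μ T κ) (x y : G) : hitProb μ x y = Fk μ (x⁻¹ * y) := by
  classical
  have h1 : Fk μ (x⁻¹ * y) = Fk μ (y⁻¹ * x) := by
    unfold Fk; rw [← W.G0_inv]; congr 2; group
  rw [h1, ← W.hitT_eq_Fk]
  unfold hitT hitProb
  have key : ∀ l : List G, (l.map fun a => ENNReal.ofReal (μ a)).prod =
      ENNReal.ofReal ((l.map μ).prod) ∧ 0 ≤ (l.map μ).prod := by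
    intro l
    induction l with
    | nil => simp
    | cons a l ih =>
      simp only [List.map_cons, List.prod_cons]
      exact ⟨by rw [ENNReal.ofReal_mul (W.nn a), ih.1], mul_nonneg (W.nn a) ih.2⟩
  rw [ENNReal.tsum_toReal_eq]
  · refine (tsum_subtype (s := {l : List G | IsFirstHitPath x y l})
      (fun l => (l.map μ).prod)).trans ?_
    refine tsum_congr fun l => ?_
    by_cases h : IsFirstHitPath x y l
    · rw [if_pos h, (key l).1, ENNReal.toReal_ofReal (key l).2]
      exact Set.indicator_of_mem (show l ∈ {l : List G | IsFirstHitPath x y l} from h) _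
    · rw [if_neg h, Set.indicator_of_notMem (show l ∉ {l : List G | IsFirstHitPath x y l} from h)]
      rfl
  · intro l
    split_ifs
    · rw [(key l).1]; exact ENNReal.ofReal_ne_top
    · exact ENNReal.zero_ne_top
end


section
variable {μ : G → ℝ} {T : Finset G} {κ : ℝ}

theorem SWalk.gd_eq (W : SWalk μ T κ) (x y : G) : greenDist μ x y = - Real.log (Fk μ (x⁻¹ * y)) := by
  unfold greenDist; rw [W.hitProb_eq]

theorem SWalk.gd_left (W : SWalk μ T κ) : LeftInvariant (greenDist μ) := by
  intro g x y
  rw [W.gd_eq, W.gd_eq]; congr 3; group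

theorem SWalk.Fk_inv (W : SWalk μ T κ) (x : G) : Fk μ x⁻¹ = Fk μ x := by
  unfold Fk; rw [W.G0_inv]

theorem SWalk.Fk_mul (W : SWalk μ T κ) (x y : G) : Fk μ x * Fk μ y ≤ Fk μ (x * y) := by
  unfold Fk
  have h := W.G0_pos (1 : G)
  rw [div_mul_div_comm, div_le_div_iff₀ (by positivity) h]
  nlinarith [W.submul x y]

theorem SWalk.Fk_lt (W : SWalk μ T κ) {x : G} (hx : x ≠ 1) : Fk μ x < 1 := by
  by_contra hcon
  push Not at hcon
  have key : ∀ g, 1 ≤ Fk μ g → ∀ y, G0 μ y ≤ G0 μ (g * y) := by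
    intro g hg y
    unfold Fk at hg
    rw [one_le_div (W.G0_pos 1)] at hg
    have h1 := W.submul g y
    have h2 := mul_le_mul_of_nonneg_right hg (W.G0_nonneg y)
    exact le_of_mul_le_mul_left (h2.trans h1) (W.G0_pos 1)
  have heq : ∀ y, G0 μ (x * y) = G0 μ y := by
    intro y
    apply le_antisymm
    · have := key x⁻¹ (by rwa [W.Fk_inv]) (x * y)
      simpa using this
    · exact key x hcon y
  have h1 := W.G0_one
  have h2 := W.G0_pop hx
  have h3 : Pop μ T (G0 μ) x = Pop μ T (G0 μ) 1 := by
    have := pop_left (μ := μ) (T := T) (G0 μ) x 1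
    rw [mul_one] at this
    rw [← this]
    congr 1; funext y; exact heq y
  have h4 := heq 1
  rw [mul_one] at h4
  linarith

theorem SWalk.gd_metric (W : SWalk μ T κ) : IsMetricFun (greenDist μ) where
  refl x := by rw [W.gd_eq, inv_mul_cancel, W.Fk_one]; simp
  pos x y h := by
    rw [W.gd_eq]
    have h1 : x⁻¹ * y ≠ 1 := by intro h2; exact h (inv_mul_eq_one.1 h2)
    have := Real.log_neg (W.Fk_pos _) (W.Fk_lt h1)
    linarith
  symm x y := by
    rw [W.gd_eq, W.gd_eq, ← W.Fk_inv]; congr 3; group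
  triangle x y z := by
    rw [W.gd_eq, W.gd_eq, W.gd_eq]
    have h := W.Fk_mul (x⁻¹ * y) (y⁻¹ * z)
    have e : x⁻¹ * y * (y⁻¹ * z) = x⁻¹ * z := by group
    rw [e] at h
    have h2 := Real.log_le_log (mul_pos (W.Fk_pos _) (W.Fk_pos _)) h
    rw [Real.log_mul (W.Fk_pos _).ne' (W.Fk_pos _).ne'] at h2
    linarith

theorem SWalk.G0_ge (W : SWalk μ T κ) {m : ℝ} (hm0 : 0 < m) (hm : ∀ s ∈ T, m ≤ μ s) (x : G) :
    m ^ (wordLength T x) * G0 μ 1 ≤ G0 μ x := by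
  have := W.super_harnack hm0 hm W.G0_nonneg W.G0_super x x⁻¹
  rwa [mul_inv_cancel, wl_inv W.gen] at this

/-- two-sided linear comparison with the word metric -/
theorem SWalk.gd_word (W : SWalk μ T κ) : ∃ Λ c : ℝ, 1 ≤ Λ ∧ 0 ≤ c ∧
    (∀ x y, greenDist μ x y ≤ Λ * wordDist T x y) ∧
    (∀ x y, wordDist T x y ≤ Λ * greenDist μ x y + c) := by
  obtain ⟨m, hm0, hm1, hm⟩ := W.exists_m
  have hlm : 0 ≤ - Real.log m := by linarith [Real.log_nonpos hm0.le hm1]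
  have hlk : 0 < - Real.log κ := by linarith [Real.log_neg W.k0 W.k1]
  have hl1 : 0 ≤ - Real.log (1 - κ) := by
    have := Real.log_nonpos (x := 1 - κ) (by linarith [W.k1]) (by linarith [W.k0]); linarith
  set Λ : ℝ := 1 + (- Real.log m) + (- Real.log κ)⁻¹ with hΛ
  have hinv : 0 < (- Real.log κ)⁻¹ := inv_pos.2 hlk
  refine ⟨Λ, (- Real.log κ)⁻¹ * (- Real.log (1 - κ)), by linarith, mul_nonneg hinv.le hl1, ?_, ?_⟩
  · intro x y
    rw [W.gd_eq]; unfold wordDist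
    set g := x⁻¹ * y
    have h1 := W.G0_ge hm0 hm g
    have h2 : m ^ (wordLength T g) ≤ Fk μ g := by
      unfold Fk; rwa [le_div_iff₀ (W.G0_pos 1)]
    have h3 := Real.log_le_log (by positivity) h2
    rw [Real.log_pow] at h3
    have h0 : (0 : ℝ) ≤ wordLength T g := Nat.cast_nonneg _
    have : (- Real.log m) * wordLength T g ≤ Λ * wordLength T g := by
      apply mul_le_mul_of_nonneg_right _ h0; linarith
    linarith
  · intro x y
    have hnn : 0 ≤ greenDist μ x y := by
      by_cases h : x = y
      · rw [h, W.gd_metric.refl]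
      · exact (W.gd_metric.pos x y h).le
    have h1 : (- Real.log κ)⁻¹ * greenDist μ x y ≤ Λ * greenDist μ x y := by
      apply mul_le_mul_of_nonneg_right _ hnn; linarith
    refine le_trans ?_ (add_le_add_left h1 _)
    rw [← mul_add, ← div_eq_inv_mul, le_div_iff₀ hlk]
    rw [W.gd_eq]; unfold wordDist
    set g := x⁻¹ * y
    have h2 : Fk μ g ≤ κ ^ wordLength T g / (1 - κ) := by
      refine le_trans ?_ (W.G0_le g)
      unfold Fk
      exact div_le_self (W.G0_nonneg _) W.G0_one_ge
    have hk : 0 < 1 - κ := by linarith [W.k1]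
    have h3 := Real.log_le_log (W.Fk_pos g) h2
    rw [Real.log_div (pow_pos W.k0 _).ne' hk.ne', Real.log_pow] at h3
    linarith

theorem SWalk.gd_qi (W : SWalk μ T κ) : QuasiIsometric (greenDist μ) (wordDist T) := by
  obtain ⟨Λ, c, h1, h2, h3, h4⟩ := W.gd_word
  refine ⟨id, Λ, c, 0, h1, h2, le_rfl, fun x y => ⟨?_, h4 x y⟩, fun y => ⟨y, ?_⟩⟩
  · have := h3 x y
    have h5 : greenDist μ x y / Λ ≤ wordDist T x y := by
      rw [div_le_iff₀ (by linarith)]; linarith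
    simp only [id]; linarith
  · simp [wd_self]
end


section
variable {μ : G → ℝ} {T : Finset G} {κ δ : ℝ}

theorem av_path {B E : Set G} (n : ℕ) (v : G) (h : Av T B E n v) :
    ∃ q : ℕ → G, q 0 = v ∧ q n ∈ E ∧ (∀ i ≤ n, q i ∉ B) ∧
      ∀ i < n, wordDist T (q i) (q (i + 1)) ≤ 1 := by
  induction n generalizing v with
  | zero => exact ⟨fun _ => v, rfl, h.2, fun i _ => h.1, fun i hi => absurd hi (by omega)⟩
  | succ n ih =>
    obtain ⟨hB, s, hs, h1⟩ := h
    obtain ⟨q, q0, qn, qB, qs⟩ := ih _ h1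
    refine ⟨fun i => if i = 0 then v else q (i - 1), by simp, by simpa using qn, ?_, ?_⟩
    · intro i hi
      by_cases h0 : i = 0
      · simp [h0, hB]
      · simp only [h0, if_false]; exact qB _ (by omega)
    · intro i hi
      by_cases h0 : i = 0
      · subst h0
        simp only [if_true, zero_add, one_ne_zero, if_false, Nat.sub_self, q0]
        unfold wordDist
        rw [inv_mul_cancel_left]
        exact_mod_cast wl_mem_le hs
      · simp only [h0, if_false, Nat.add_eq_zero_iff, one_ne_zero, and_false, Nat.add_sub_cancel]
        have := qs (i - 1) (by omega)
        rwa [Nat.sub_add_cancel (by omega)] at this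

theorem path_gromov (hT : Generates T) (hyp : IsHyperbolicWith (wordDist T) δ) (hδ : 0 ≤ δ) (o : G)
    (r : ℝ) (n : ℕ) (q : ℕ → G) (hq : ∀ i ≤ n, r < wordDist T (q i) o)
    (hs : ∀ i < n, wordDist T (q i) (q (i + 1)) ≤ 1) (j : ℕ) :
    ∀ a b, a ≤ b → b ≤ n → b ≤ a + 2 ^ j → r - 1 - j * δ ≤ gromov (wordDist T) o (q a) (q b) := by
  induction j with
  | zero =>
    intro a b h1 h2 h3
    have h4 := hq a (by omega)
    have h5 := hq b h2
    have h6 : wordDist T (q a) (q b) ≤ 1 := by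
      rcases Nat.lt_or_ge a b with h | h
      · have : b = a + 1 := by simp at h3; omega
        rw [this]; exact hs a (by omega)
      · have : a = b := by omega
        rw [this, wd_self]; norm_num
    unfold gromov
    push_cast; linarith
  | succ j ih =>
    intro a b h1 h2 h3
    set c := min (a + 2 ^ j) b with hc
    have i1 := ih a c (by rw [hc]; omega) (by omega) (by omega)
    have i2 := ih c b (by omega) h2 (by rw [pow_succ] at h3; omega)
    have h := hyp o (q c) (q a) (q b)
    rw [gromov_comm (wd_symm hT)] at i1
    have : r - 1 - j * δ ≤ min (gromov (wordDist T) o (q c) (q a)) (gromov (wordDist T) o (q c) (q b)) :=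
      le_min i1 i2
    push_cast; linarith

theorem geom_lemma (hT : Generates T) (hyp : IsHyperbolicWith (wordDist T) δ) (hδ : 0 ≤ δ)
    {o x x' v w : G} {ρ ρ' : ℝ} (h0 : gromov (wordDist T) o x x' ≤ 0)
    (hv : wordDist T v x ≤ ρ) (hρ : ρ ≤ wordDist T x o / 4) (hv' : ρ ≤ 0 ∨ 4 * δ < wordDist T x o)
    (hw : wordDist T w x' ≤ ρ') (hρ' : ρ' ≤ wordDist T x' o / 4) (hw' : 4 * δ < wordDist T x' o) :
    gromov (wordDist T) o v w ≤ 2 * δ := by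
  have hs := wd_symm hT
  have tri := wd_tri hT
  have hxv : gromov (wordDist T) o v x ≥ wordDist T x o - ρ := by
    unfold gromov; have := tri x v o; have := hs x v; linarith
  have hxw : gromov (wordDist T) o w x' ≥ wordDist T x' o - ρ' := by
    unfold gromov; have := tri x' w o; have := hs x' w; linarith
  rcases hyp_or hyp o v x x' with h | h
  · rcases hv' with h1 | h1
    · have hvx : wordDist T v x = 0 := le_antisymm (hv.trans h1) (wd_nonneg T _ _)
      have e : gromov (wordDist T) o v w ≤ wordDist T v o := by
        unfold gromov; have := tri w v o; have := hs w v; linarith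
      have := tri v x o
      linarith
    · linarith [wd_nonneg T x o]
  · rcases hyp_or hyp o w v x' with h2 | h2
    · rw [gromov_comm hs]; linarith
    · linarith

theorem SWalk.half_step (W : SWalk μ T κ) (hyp : IsHyperbolicWith (wordDist T) δ) (hδ : 0 ≤ δ)
    {m : ℝ} (hm0 : 0 < m) (hm1 : m ≤ 1) (hm : ∀ s ∈ T, m ≤ μ s)
    {o v w : G} {r C η : ℝ} {j L : ℕ} (hvw : gromov (wordDist T) o v w ≤ 2 * δ)
    (hr : 1 + j * δ + 2 * δ < r)
    (hC : ∀ v', wordDist T v' o ≤ r → G0 μ (v'⁻¹ * w) ≤ C * (G0 μ v' * G0 μ w))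
    (hC0 : 0 ≤ C)
    (hη0 : 0 ≤ η) (hη : κ ^ (2 ^ j) / (1 - κ) ≤ η * m ^ L) (hL : wordLength T v + wordLength T w ≤ L) :
    G0 μ (v⁻¹ * w) ≤ (C + η) * (G0 μ v * G0 μ w) := by
  have hsw : ∀ v : G, G0 μ (v⁻¹ * w) = G0 μ (w⁻¹ * v) := by
    intro v; rw [← W.G0_inv]; congr 1; group
  have hcmp := W.compare (D := fun v => G0 μ (w⁻¹ * v) - C * (G0 μ v * G0 μ w))
    (w := fun v => G0 μ (w⁻¹ * v)) (B := {v | wordDist T v o ≤ r}) (E := {w}) ?_ ?_ ?_ ?_ (2 ^ j) v ?_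
  · rw [iter_left] at hcmp
    have h1 := W.iter_G0_le (2 ^ j) (w⁻¹ * v)
    have h2 : m ^ L ≤ G0 μ v * G0 μ w := by
      have a1 := W.G0_ge hm0 hm v
      have a2 := W.G0_ge hm0 hm w
      have hg := W.G0_one_ge
      have b1 : m ^ wordLength T v ≤ G0 μ v := le_trans (le_mul_of_one_le_right (by positivity) hg) a1
      have b2 : m ^ wordLength T w ≤ G0 μ w := le_trans (le_mul_of_one_le_right (by positivity) hg) a2
      calc m ^ L ≤ m ^ (wordLength T v + wordLength T w) := pow_le_pow_of_le_one hm0.le hm1 hL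
        _ = m ^ wordLength T v * m ^ wordLength T w := pow_add _ _ _
        _ ≤ _ := mul_le_mul b1 b2 (by positivity) (W.G0_nonneg _)
    have h3 := mul_le_mul_of_nonneg_left h2 hη0
    rw [hsw]
    linarith
  · intro v
    have := mul_nonneg hC0 (mul_nonneg (W.G0_nonneg v) (W.G0_nonneg w))
    linarith
  · intro v; exact W.G0_nonneg _
  · intro v hv
    have := hC v hv
    rw [hsw] at this; linarith
  · intro v hv hvw
    have h1 : w⁻¹ * v ≠ 1 := by intro h; exact hvw (inv_mul_eq_one.1 h).symm
    have e : Pop μ T (fun v => G0 μ (w⁻¹ * v) - C * (G0 μ v * G0 μ w)) v =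
        Pop μ T (G0 μ) (w⁻¹ * v) - C * G0 μ w * Pop μ T (G0 μ) v := by
      rw [← pop_left, ← pop_smul, ← pop_sub]; congr 1; funext v; ring
    rw [e, ← W.G0_pop h1]
    have := mul_le_mul_of_nonneg_left (W.G0_super v) (mul_nonneg hC0 (W.G0_nonneg w))
    linarith
  · intro n hn hav
    obtain ⟨q, q0, qn, qB, qs⟩ := av_path n v hav
    have hw : q n = w := qn
    have := path_gromov W.gen hyp hδ o r n q (fun i hi => not_le.1 (qB i hi)) qs j 0 n (by omega) le_rfl
      (by omega)
    rw [q0, hw] at this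
    linarith
end



theorem exp_lemma {κ m : ℝ} (k0 : 0 < κ) (k1 : κ < 1) (hm0 : 0 < m) (hm1 : m ≤ 1) (e : ℕ) :
    ∃ i0 : ℕ, ∀ i ≥ i0, 3 ≤ 2 ^ i ∧
      κ ^ (2 ^ (2 ^ i - 3)) / (1 - κ) ≤ (1 / 2) ^ i * m ^ (2 ^ (i + e + 6)) := by
  have hlm : 0 ≤ - Real.log m := by linarith [Real.log_nonpos hm0.le hm1]
  have hlk : 0 < - Real.log κ := by linarith [Real.log_neg k0 k1]
  have hl1 : 0 ≤ - Real.log (1 - κ) := by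
    have := Real.log_nonpos (x := 1 - κ) (by linarith) (by linarith); linarith
  have hk : 0 < 1 - κ := by linarith
  have hl2 : 0 < Real.log 2 := Real.log_pos (by norm_num)
  set c1 : ℝ := - Real.log (1 - κ) + Real.log 2 + 2 ^ (e + 6) * (- Real.log m) with hc1
  have ht := tendsto_pow_const_div_const_pow_of_one_lt 1 (r := (2 : ℝ)) (by norm_num)
  have ht2 : Tendsto (fun n : ℕ => c1 * ((n : ℝ) ^ 1 / 2 ^ n)) atTop (𝓝 0) := by
    simpa using ht.const_mul c1
  have hev : ∀ᶠ n : ℕ in atTop, c1 * ((n : ℝ) ^ 1 / 2 ^ n) < - Real.log κ / 8 :=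
    ht2.eventually_lt_const (by linarith)
  obtain ⟨n0, hn0⟩ := eventually_atTop.1 hev
  refine ⟨n0 + 2, fun i hi => ?_⟩
  have hi2 : i < 2 ^ i := Nat.lt_two_pow_self
  have h3 : 3 ≤ 2 ^ i := by omega
  refine ⟨h3, ?_⟩
  have h4 := hn0 (2 ^ i) (by omega)
  set n := 2 ^ i with hn
  have hnr : (1 : ℝ) ≤ n := by exact_mod_cast (by omega : 1 ≤ n)
  have hir : (i : ℝ) ≤ n := by exact_mod_cast hi2.le
  have h2n : (2 : ℝ) ^ (n - 3) = 2 ^ n / 8 := by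
    have : n = (n - 3) + 3 := by omega
    conv_rhs => rw [this, pow_add]
    norm_num
  have h5 : c1 * n ≤ (- Real.log κ) * 2 ^ (n - 3) := by
    rw [h2n]
    rw [pow_one, mul_div_assoc', div_lt_iff₀ (by positivity)] at h4
    linarith
  rw [← Real.log_le_log_iff (by positivity) (by positivity), Real.log_div (by positivity) hk.ne',
    Real.log_mul (by positivity) (by positivity), Real.log_pow, Real.log_pow, Real.log_pow]
  have e1 : Real.log (1 / 2) = - Real.log 2 := by rw [one_div, Real.log_inv]
  have e2 : ((2 ^ (i + e + 6) : ℕ) : ℝ) = n * 2 ^ (e + 6) := by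
    rw [hn]; push_cast; ring
  have e3 : ((2 ^ (n - 3) : ℕ) : ℝ) = 2 ^ (n - 3) := by push_cast; rfl
  rw [e1, e2, e3]
  have e4 : c1 * n = (- Real.log (1 - κ)) * n + Real.log 2 * n + n * 2 ^ (e + 6) * (- Real.log m) := by
    rw [hc1]; ring
  have e5 : - Real.log (1 - κ) ≤ (- Real.log (1 - κ)) * n := le_mul_of_one_le_right hl1 hnr
  have e6 : i * Real.log 2 ≤ Real.log 2 * n := by nlinarith
  linarith

section
variable {μ : G → ℝ} {T : Finset G} {κ δ : ℝ}

def Arm (T : Finset G) (p : ℕ → G) (R : ℕ) : Prop :=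
  p 0 = 1 ∧ ∀ a b, a ≤ b → b ≤ R → wordDist T (p a) (p b) = (b : ℝ) - a

def cen (p : ℕ → G) (R k : ℕ) : G := p (min (2 ^ k) R)
def rad (R k : ℕ) : ℝ := if 2 ^ k < R then 2 ^ k / 8 else 0

theorem rad_le (R k : ℕ) : rad R k ≤ 2 ^ k / 8 := by
  unfold rad; split_ifs
  · exact le_rfl
  · positivity

theorem Arm.wl (hT : Generates T) {p : ℕ → G} {R : ℕ} (h : Arm T p R) {a : ℕ} (ha : a ≤ R) :
    wordDist T (p a) 1 = a := by
  rw [wd_symm hT, ← h.1, h.2 0 a (by omega) ha]; simp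

theorem Arm.wl_le (hT : Generates T) {p : ℕ → G} {R : ℕ} (h : Arm T p R) {k : ℕ} {v : G}
    (hv : wordDist T v (cen p R k) ≤ rad R k) : (wordLength T v : ℝ) ≤ 2 ^ k + 2 ^ k / 8 := by
  have h1 := wd_tri hT v (cen p R k) 1
  rw [wd_one' hT] at h1
  have h2 : wordDist T (cen p R k) 1 ≤ 2 ^ k := by
    unfold cen; rw [h.wl hT (min_le_right _ _)]
    exact_mod_cast min_le_left _ _
  linarith [rad_le R k]

def St (μ : G → ℝ) (T : Finset G) (p : ℕ → G) (R : ℕ) (p' : ℕ → G) (R' k k' : ℕ) (C : ℝ) : Prop :=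
  ∀ v w, wordDist T v (cen p R k) ≤ rad R k → wordDist T w (cen p' R' k') ≤ rad R' k' →
    G0 μ (v⁻¹ * w) ≤ C * (G0 μ v * G0 μ w)

theorem SWalk.st_symm (W : SWalk μ T κ) {p p' : ℕ → G} {R R' k k' : ℕ} {C : ℝ}
    (h : St μ T p R p' R' k k' C) : St μ T p' R' p R k' k C := by
  intro v w hv hw
  have := h w v hw hv
  rw [← W.G0_inv, mul_comm (G0 μ w)] at this
  have e : (w⁻¹ * v)⁻¹ = v⁻¹ * w := by group
  rwa [e] at this

theorem SWalk.st_step (W : SWalk μ T κ) {e : ℕ} (he : 1 ≤ e)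
    (hyp : IsHyperbolicWith (wordDist T) (2 ^ e))
    {m : ℝ} (hm0 : 0 < m) (hm1 : m ≤ 1) (hm : ∀ s ∈ T, m ≤ μ s) {i : ℕ} (h3 : 3 ≤ 2 ^ i)
    (hη : κ ^ (2 ^ (2 ^ i - 3)) / (1 - κ) ≤ (1 / 2) ^ i * m ^ (2 ^ (i + e + 6)))
    {p p' : ℕ → G} {R R' : ℕ} (hp : Arm T p R) (hp' : Arm T p' R')
    (hpp : ∀ a b, a ≤ R → b ≤ R' → wordDist T (p a) (p' b) = (a : ℝ) + b)
    {k' : ℕ} (hk' : k' ≤ i + e + 3 + 1) {C : ℝ} (hC : 0 ≤ C)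
    (h : St μ T p R p' R' (i + e + 3) k' C) :
    St μ T p R p' R' (i + e + 3 + 1) k' (C + (1 / 2) ^ i) := by
  set k := i + e + 3 with hk
  have hs := wd_symm W.gen
  have hη0 : (0 : ℝ) ≤ (1 / 2) ^ i := by positivity
  have h2k : (2 : ℝ) ^ k = 8 * (2 ^ i * 2 ^ e) := by rw [hk]; ring
  have h2k1 : (2 : ℝ) ^ (k + 1) = 2 * 2 ^ k := by ring
  have h2k' : (2 : ℝ) ^ k' ≤ 2 * 2 ^ k := by
    rw [← h2k1]; exact pow_le_pow_right₀ (by norm_num) hk'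
  have hd2 : (2 : ℝ) ≤ 2 ^ e := by
    calc (2 : ℝ) = 2 ^ 1 := by norm_num
      _ ≤ 2 ^ e := pow_le_pow_right₀ (by norm_num) he
  have hi3 : (3 : ℝ) ≤ 2 ^ i := by exact_mod_cast h3
  have h4d : 4 * (2 : ℝ) ^ e < 2 ^ k := by rw [h2k]; nlinarith
  intro v w hv hw
  by_cases hR : 2 ^ k < R
  · have hηpos := hη
    have hx : cen p R k = p (2 ^ k) := by unfold cen; rw [min_eq_left hR.le]
    have hrad : rad R k = 2 ^ k / 8 := by unfold rad; rw [if_pos hR]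
    have hmin : 2 ^ k ≤ min (2 ^ (k + 1)) R := le_min (Nat.pow_le_pow_right (by norm_num) (by omega)) hR.le
    have hxo : wordDist T (cen p R (k + 1)) (p (2 ^ k)) = (min (2 ^ (k + 1)) R : ℕ) - (2 : ℝ) ^ k := by
      rw [hs]; unfold cen
      rw [hp.2 _ _ hmin (min_le_right _ _)]; push_cast; rfl
    have hx'o : wordDist T (cen p' R' k') (p (2 ^ k)) = (2 : ℝ) ^ k + (min (2 ^ k') R' : ℕ) := by
      rw [hs]; unfold cen
      rw [hpp _ _ hR.le (min_le_right _ _)]; push_cast; rfl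
    have hxx' : wordDist T (cen p R (k + 1)) (cen p' R' k') =
        (min (2 ^ (k + 1)) R : ℕ) + ((min (2 ^ k') R' : ℕ) : ℝ) := by
      unfold cen; rw [hpp _ _ (min_le_right _ _) (min_le_right _ _)]
    have hnn : (0 : ℝ) ≤ (min (2 ^ k') R' : ℕ) := Nat.cast_nonneg _
    have hminr : (2 : ℝ) ^ k ≤ (min (2 ^ (k + 1)) R : ℕ) := by exact_mod_cast hmin
    have geo : gromov (wordDist T) (p (2 ^ k)) v w ≤ 2 * 2 ^ e := by
      refine geom_lemma W.gen hyp (by positivity) (x := cen p R (k + 1)) (x' := cen p' R' k')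
        ?_ hv ?_ ?_ hw ?_ ?_
      · unfold gromov; rw [hxo, hx'o, hxx']; linarith
      · unfold rad
        split_ifs with hc
        · rw [hxo, min_eq_left hc.le]; push_cast; rw [h2k1]; linarith
        · rw [hxo]; linarith
      · unfold rad
        split_ifs with hc
        · right; rw [hxo, min_eq_left hc.le]; push_cast; rw [h2k1]; linarith
        · left; exact le_rfl
      · rw [hx'o]; have := rad_le R' k'; linarith
      · rw [hx'o]; linarith
    refine W.half_step hyp (by positivity) hm0 hm1 hm (j := 2 ^ i - 3) (L := 2 ^ (i + e + 6))
      (r := 2 ^ k / 8) geo ?_ ?_ hC hη0 hη ?_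
    · rw [Nat.cast_sub h3, h2k]; push_cast
      nlinarith
    · intro v' hv'
      refine h v' w ?_ hw
      rw [hx, hrad]; exact hv'
    · have a1 := hp.wl_le W.gen hv
      have a2 := hp'.wl_le W.gen hw
      have e6 : (2 : ℝ) ^ (i + e + 6) = 8 * 2 ^ k := by rw [hk]; ring
      have : ((wordLength T v + wordLength T w : ℕ) : ℝ) ≤ ((2 ^ (i + e + 6) : ℕ) : ℝ) := by
        push_cast
        rw [e6]
        have : (0 : ℝ) < 2 ^ k := by positivity
        linarith
      exact_mod_cast this
  · push Not at hR
    have hR2 : R ≤ 2 ^ (k + 1) := hR.trans (Nat.pow_le_pow_right (by norm_num) (by omega))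
    have e1 : cen p R (k + 1) = cen p R k := by
      unfold cen; rw [min_eq_right hR, min_eq_right hR2]
    have e2 : rad R (k + 1) = rad R k := by
      unfold rad; rw [if_neg (not_lt.2 hR), if_neg (not_lt.2 hR2)]
    rw [e1, e2] at hv
    have h0 : 0 ≤ G0 μ v * G0 μ w := mul_nonneg (W.G0_nonneg _) (W.G0_nonneg _)
    have := h v w hv hw
    nlinarith

theorem SWalk.ancona (W : SWalk μ T κ) (hyp : IsHyperbolic (wordDist T)) :
    ∃ C : ℝ, 0 < C ∧ ∀ X Z : G, wordDist T X Z = wordLength T X + wordLength T Z →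
      G0 μ (X⁻¹ * Z) ≤ C * (G0 μ X * G0 μ Z) := by
  obtain ⟨δ, hδ, hyp⟩ := hyp
  obtain ⟨m, hm0, hm1, hm⟩ := W.exists_m
  obtain ⟨e, he1, he⟩ : ∃ e : ℕ, 1 ≤ e ∧ δ ≤ 2 ^ e := by
    obtain ⟨e, he⟩ := pow_unbounded_of_one_lt δ (by norm_num : (1 : ℝ) < 2)
    refine ⟨e + 1, by omega, ?_⟩
    have : (2 : ℝ) ^ e ≤ 2 ^ (e + 1) := pow_le_pow_right₀ (by norm_num) (by omega)
    linarith
  have hyp' : IsHyperbolicWith (wordDist T) (2 ^ e) := fun w x y z => by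
    have := hyp w x y z; linarith
  obtain ⟨i0, hi0⟩ := exp_lemma W.k0 W.k1 hm0 hm1 e
  have hk : 0 < 1 - κ := by linarith [W.k1]
  set C0 : ℝ := (m ^ (2 ^ (i0 + e + 3 + 2)))⁻¹ / (1 - κ) with hC0
  have hC0p : 0 < C0 := by positivity
  refine ⟨C0 + 4, by linarith, fun X Z hXZ => ?_⟩
  obtain ⟨p, p0, pR, pg⟩ := wl_geodesic W.gen X
  obtain ⟨p', p0', pR', pg'⟩ := wl_geodesic W.gen Z
  set R := wordLength T X with hR
  set R' := wordLength T Z with hR'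
  have hp : Arm T p R := ⟨p0, fun a b h1 h2 => by
    unfold wordDist; rw [pg a b h1 h2, Nat.cast_sub h1]⟩
  have hp' : Arm T p' R' := ⟨p0', fun a b h1 h2 => by
    unfold wordDist; rw [pg' a b h1 h2, Nat.cast_sub h1]⟩
  have hs := wd_symm W.gen
  have hpp : ∀ a b, a ≤ R → b ≤ R' → wordDist T (p a) (p' b) = (a : ℝ) + b := by
    intro a b ha hb
    have h1 := wd_tri W.gen (p a) 1 (p' b)
    rw [hp.wl W.gen ha, hs 1, hp'.wl W.gen hb] at h1
    have h2 := wd_tri W.gen X (p a) Z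
    have h3 := wd_tri W.gen (p a) (p' b) Z
    have h4 := hp.2 a R ha le_rfl
    have h5 := hp'.2 b R' hb le_rfl
    rw [pR, hs] at h4
    rw [pR'] at h5
    linarith
  have main : ∀ n, St μ T p R p' R' (i0 + n + e + 3) (i0 + n + e + 3) (C0 + 4 - 4 * (1 / 2) ^ (i0 + n)) := by
    intro n
    induction n with
    | zero =>
      intro v w hv hw
      have a1 := hp.wl_le W.gen hv
      have a2 := hp'.wl_le W.gen hw
      simp only [add_zero] at a1 a2 ⊢
      have hb : ∀ u : G, (wordLength T u : ℝ) ≤ 2 ^ (i0 + e + 3) + 2 ^ (i0 + e + 3) / 8 →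
          m ^ (2 ^ (i0 + e + 3 + 1)) ≤ G0 μ u := by
        intro u hu
        have h1 := W.G0_ge hm0 hm u
        have h2 : wordLength T u ≤ 2 ^ (i0 + e + 3 + 1) := by
          have : (wordLength T u : ℝ) ≤ ((2 ^ (i0 + e + 3 + 1) : ℕ) : ℝ) := by
            push_cast; rw [pow_succ]
            have : (0 : ℝ) < 2 ^ (i0 + e + 3) := by positivity
            linarith
          exact_mod_cast this
        have h3 := pow_le_pow_of_le_one hm0.le hm1 h2
        have h4 : m ^ wordLength T u ≤ m ^ wordLength T u * G0 μ 1 :=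
          le_mul_of_one_le_right (by positivity) W.G0_one_ge
        linarith
      have b1 := hb v a1
      have b2 := hb w a2
      have b3 : m ^ (2 ^ (i0 + e + 3 + 2)) ≤ G0 μ v * G0 μ w := by
        calc m ^ (2 ^ (i0 + e + 3 + 2)) = m ^ (2 ^ (i0 + e + 3 + 1)) * m ^ (2 ^ (i0 + e + 3 + 1)) := by
              rw [← pow_add]; congr 1; ring
          _ ≤ _ := mul_le_mul b1 b2 (by positivity) (W.G0_nonneg _)
      have b4 : G0 μ (v⁻¹ * w) ≤ 1 / (1 - κ) := by
        refine (W.G0_le _).trans ?_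
        gcongr
        exact pow_le_one₀ W.k0.le W.k1.le
      have b5 : 1 / (1 - κ) = C0 * m ^ (2 ^ (i0 + e + 3 + 2)) := by
        rw [hC0]; field_simp
      have b6 : (1 / 2 : ℝ) ^ i0 ≤ 1 := pow_le_one₀ (by norm_num) (by norm_num)
      calc G0 μ (v⁻¹ * w) ≤ C0 * m ^ (2 ^ (i0 + e + 3 + 2)) := by rw [← b5]; exact b4
        _ ≤ C0 * (G0 μ v * G0 μ w) := mul_le_mul_of_nonneg_left b3 hC0p.le
        _ ≤ _ := mul_le_mul_of_nonneg_right (by linarith) (mul_nonneg (W.G0_nonneg _) (W.G0_nonneg _))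
    | succ n ih =>
      obtain ⟨h3, hη⟩ := hi0 (i0 + n) (by omega)
      have b6 : (1 / 2 : ℝ) ^ (i0 + n) ≤ 1 := pow_le_one₀ (by norm_num) (by norm_num)
      have b7 : (0 : ℝ) < (1 / 2) ^ (i0 + n) := by positivity
      have s1 := W.st_step he1 hyp' hm0 hm1 hm h3 hη hp hp' hpp (by omega) (by linarith) ih
      have s2 := W.st_step he1 hyp' hm0 hm1 hm h3 hη hp' hp
        (fun a b ha hb => by rw [hs, hpp b a hb ha, add_comm]) le_rfl (by linarith) (W.st_symm s1)
      have s3 := W.st_symm s2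
      have e1 : i0 + (n + 1) + e + 3 = i0 + n + e + 3 + 1 := by omega
      have e2 : C0 + 4 - 4 * (1 / 2 : ℝ) ^ (i0 + (n + 1)) =
          C0 + 4 - 4 * (1 / 2) ^ (i0 + n) + (1 / 2) ^ (i0 + n) + (1 / 2) ^ (i0 + n) := by
        rw [← add_assoc, pow_succ]; ring
      rw [e1, e2]; exact s3
  have hfin := main (R + R') X Z
  set k := i0 + (R + R') + e + 3 with hkk
  have hk2 : k < 2 ^ k := Nat.lt_two_pow_self
  have hRk : R ≤ 2 ^ k := by omega
  have hRk' : R' ≤ 2 ^ k := by omega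
  have f1 : cen p R k = X := by unfold cen; rw [min_eq_right hRk, pR]
  have f2 : cen p' R' k = Z := by unfold cen; rw [min_eq_right hRk', pR']
  have f3 : rad R k = 0 := by unfold rad; rw [if_neg (not_lt.2 hRk)]
  have f4 : rad R' k = 0 := by unfold rad; rw [if_neg (not_lt.2 hRk')]
  have := hfin (by rw [f1, f3, wd_self]) (by rw [f2, f4, wd_self])
  refine this.trans (mul_le_mul_of_nonneg_right ?_ (mul_nonneg (W.G0_nonneg _) (W.G0_nonneg _)))
  have b7 : (0 : ℝ) < (1 / 2) ^ (i0 + (R + R')) := by positivity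
  linarith
end



section
variable {μ : G → ℝ} {T : Finset G} {κ δ : ℝ}

theorem SWalk.ancona_gd (W : SWalk μ T κ) (hyp : IsHyperbolic (wordDist T)) :
    ∃ c : ℝ, 0 ≤ c ∧ ∀ x y z, wordDist T x z = wordDist T x y + wordDist T y z →
      greenDist μ x y + greenDist μ y z ≤ greenDist μ x z + c := by
  obtain ⟨C, hC, h⟩ := W.ancona hyp
  refine ⟨max 0 (Real.log (C * G0 μ 1)), le_max_left _ _, fun x y z hx => ?_⟩
  have h1 := h (y⁻¹ * x) (y⁻¹ * z) (by
    rw [wd_left, hx, wd_symm W.gen x y]; rfl)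
  have e : (y⁻¹ * x)⁻¹ * (y⁻¹ * z) = x⁻¹ * z := by group
  rw [e] at h1
  have g1 := W.G0_pos 1
  have h2 : Fk μ (x⁻¹ * z) ≤ (C * G0 μ 1) * (Fk μ (y⁻¹ * x) * Fk μ (y⁻¹ * z)) := by
    unfold Fk
    rw [div_le_iff₀ g1]
    refine h1.trans (le_of_eq ?_)
    field_simp
  have h3 := Real.log_le_log (W.Fk_pos _) h2
  rw [Real.log_mul (by positivity) (mul_pos (W.Fk_pos _) (W.Fk_pos _)).ne',
    Real.log_mul (W.Fk_pos _).ne' (W.Fk_pos _).ne'] at h3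
  have h4 := W.gd_metric.symm x y
  rw [h4, W.gd_eq, W.gd_eq, W.gd_eq]
  have := le_max_right 0 (Real.log (C * G0 μ 1))
  linarith

theorem SWalk.gd_near (W : SWalk μ T κ) (hyp : IsHyperbolic (wordDist T)) (K : ℝ) :
    ∃ C : ℝ, 0 ≤ C ∧ ∀ x y m, gromov (wordDist T) m x y ≤ K →
      greenDist μ x m + greenDist μ m y ≤ greenDist μ x y + C := by
  obtain ⟨c, hc, hA⟩ := W.ancona_gd hyp
  obtain ⟨Λ, c', hΛ, -, hw, -⟩ := W.gd_word
  obtain ⟨δ, hδ, hyp⟩ := hyp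
  have hs := wd_symm W.gen
  have h4 := four_of_hyp hs hyp
  refine ⟨max 0 (c + 2 * (Λ * (K + 1 + 2 * δ))), le_max_left _ _, fun x y m hm => ?_⟩
  obtain ⟨n, p, hn, p0, pn, hp⟩ := wd_geodesic W.gen x y
  unfold gromov at hm
  have t1 := wd_tri W.gen m x y
  have t2 := wd_tri W.gen x m y
  have t3 := wd_tri W.gen x y m
  have s1 := hs m x
  have s2 := hs m y
  set a := (wordDist T x m + n - wordDist T m y) / 2 with ha
  have ha0 : 0 ≤ a := by rw [ha]; linarith
  have han : a ≤ n := by rw [ha]; linarith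
  have hi1 := Nat.floor_le ha0
  have hi2 := Nat.lt_floor_add_one a
  set i := ⌊a⌋₊ with hi
  have hin : i ≤ n := by exact_mod_cast hi1.trans han
  have d1 := hp 0 i (Nat.zero_le _) hin
  have d2 := hp i n hin le_rfl
  rw [p0] at d1; rw [pn] at d2
  have d3 := hs x (p i)
  have f := h4 m (p i) x y
  have f2 : wordDist T m (p i) ≤ K + 1 + 2 * δ := by
    push_cast at d1
    rcases le_max_iff.1 (show wordDist T m (p i) + wordDist T x y - 2 * δ ≤ _ by linarith [f]) with h | h
    · linarith
    · linarith
  have g1 := hA x (p i) y (by rw [d1, d2, ← hn]; push_cast; ring)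
  have g2 := W.gd_metric.triangle x (p i) m
  have g3 := W.gd_metric.triangle m (p i) y
  have g4 := W.gd_metric.symm (p i) m
  have g5 := hw m (p i)
  have g6 := mul_le_mul_of_nonneg_left f2 (by linarith : 0 ≤ Λ)
  have := le_max_right 0 (c + 2 * (Λ * (K + 1 + 2 * δ)))
  linarith

theorem center (hT : Generates T) (h4 : Four (wordDist T) δ) (hδ : 0 ≤ δ) (x y z w : G)
    (h1 : wordDist T x z + wordDist T y w ≤ wordDist T x y + wordDist T z w)
    (h2 : wordDist T x z + wordDist T y w ≤ wordDist T x w + wordDist T y z) :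
    ∃ m, gromov (wordDist T) m x y ≤ 1 + 3 * δ ∧ gromov (wordDist T) m z w ≤ 1 + 3 * δ ∧
      gromov (wordDist T) m x w ≤ 1 + 3 * δ ∧ gromov (wordDist T) m y z ≤ 1 + 3 * δ := by
  have hs := wd_symm hT
  obtain ⟨n, p, hn, p0, pn, hp⟩ := wd_geodesic hT x y
  have t1 := wd_tri hT z x y
  have t2 := wd_tri hT x z y
  have t3 := wd_tri hT x y z
  have s1 := hs z x
  have s2 := hs z y
  set a := (wordDist T x z + n - wordDist T z y) / 2 with ha
  have ha0 : 0 ≤ a := by rw [ha]; linarith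
  have han : a ≤ n := by rw [ha]; linarith
  have hi1 := Nat.floor_le ha0
  have hi2 := Nat.lt_floor_add_one a
  set i := ⌊a⌋₊ with hi
  have hin : i ≤ n := by exact_mod_cast hi1.trans han
  have d1 := hp 0 i (Nat.zero_le _) hin
  have d2 := hp i n hin le_rfl
  rw [p0] at d1; rw [pn] at d2
  push_cast at d1
  have d3 := hs x (p i)
  have d4 := hs y (p i)
  have d5 := hs w (p i)
  have d6 := hs w x
  have d7 := hs w y
  have f1 : wordDist T z (p i) ≤ wordDist T x z - i + 2 * δ := by
    have f := h4 z (p i) x y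
    rcases le_max_iff.1 (show wordDist T z (p i) + wordDist T x y - 2 * δ ≤ _ by linarith [f]) with h | h
    · linarith
    · linarith
  have f2 : wordDist T (p i) w ≤ wordDist T x w - i + 2 * δ := by
    have f := h4 (p i) w x y
    rcases le_max_iff.1 (show wordDist T (p i) w + wordDist T x y - 2 * δ ≤ _ by linarith [f]) with h | h
    · linarith
    · linarith
  have f3 : wordDist T x w + wordDist T y z ≤ wordDist T x y + wordDist T z w + 2 * δ := by
    have f := h4 x w z y
    have := hs w z
    rcases le_max_iff.1 (show wordDist T x w + wordDist T z y - 2 * δ ≤ _ by linarith [f]) with h | h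
    · linarith
    · linarith
  refine ⟨p i, ?_, ?_, ?_, ?_⟩ <;> unfold gromov <;> linarith

theorem SWalk.gd_hyp (W : SWalk μ T κ) (hyp : IsHyperbolic (wordDist T)) :
    IsHyperbolic (greenDist μ) := by
  have hyp0 := hyp
  obtain ⟨δ, hδ, hyp⟩ := hyp
  obtain ⟨C, hC, h⟩ := W.gd_near hyp0 (1 + 3 * δ)
  have hs := wd_symm W.gen
  have h4 := four_of_hyp hs hyp
  have gs := W.gd_metric.symm
  have gt := W.gd_metric.triangle
  have key : ∀ x y z w : G, 
      wordDist T x z + wordDist T y w ≤ wordDist T x y + wordDist T z w →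
      wordDist T x z + wordDist T y w ≤ wordDist T x w + wordDist T y z →
      ∃ Sg : ℝ, Sg ≤ greenDist μ x y + greenDist μ z w + 2 * C ∧
        Sg ≤ greenDist μ x w + greenDist μ y z + 2 * C ∧
        greenDist μ x z + greenDist μ y w ≤ Sg ∧ greenDist μ x y + greenDist μ z w ≤ Sg ∧
        greenDist μ x w + greenDist μ y z ≤ Sg := by
    intro x y z w h1 h2
    obtain ⟨m, m1, m2, m3, m4⟩ := center W.gen h4 hδ x y z w h1 h2
    have a1 := h _ _ _ m1
    have a2 := h _ _ _ m2
    have a3 := h _ _ _ m3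
    have a4 := h _ _ _ m4
    have b1 := gt x m z
    have b2 := gt y m w
    have b3 := gt x m y
    have b4 := gt z m w
    have b5 := gt x m w
    have b6 := gt y m z
    have c1 := gs m z
    have c2 := gs m y
    refine ⟨greenDist μ x m + greenDist μ y m + greenDist μ z m + greenDist μ m w,
      ?_, ?_, ?_, ?_, ?_⟩ <;> linarith
  refine ⟨C, hC, hyp_of_four gs ?_⟩
  intro x y z w
  have e1 := hs w z
  have e2 := hs w y
  have e3 := hs z y
  have e1' := gs w z
  have e2' := gs w y
  have e3' := gs z y
  by_cases c1 : wordDist T x z + wordDist T y w ≤ wordDist T x y + wordDist T z w ∧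
      wordDist T x z + wordDist T y w ≤ wordDist T x w + wordDist T y z
  · obtain ⟨S, k1, k2, k3, k4, k5⟩ := key x y z w c1.1 c1.2
    have := le_max_right (greenDist μ x z + greenDist μ y w) (greenDist μ x w + greenDist μ y z)
    linarith
  by_cases c2 : wordDist T x w + wordDist T y z ≤ wordDist T x y + wordDist T z w ∧
      wordDist T x w + wordDist T y z ≤ wordDist T x z + wordDist T y w
  · obtain ⟨S, k1, k2, k3, k4, k5⟩ := key x y w z (by linarith [c2.1]) (by linarith [c2.2])
    have := le_max_left (greenDist μ x z + greenDist μ y w) (greenDist μ x w + greenDist μ y z)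
    linarith
  · have c3 : wordDist T x y + wordDist T z w ≤ wordDist T x z + wordDist T y w ∧
      wordDist T x y + wordDist T z w ≤ wordDist T x w + wordDist T y z := by
      rw [not_and_or, not_le, not_le] at c1 c2
      constructor
      · rcases c1 with c | c <;> rcases c2 with c' | c' <;> linarith
      · rcases c1 with c | c <;> rcases c2 with c' | c' <;> linarith
    obtain ⟨S, k1, k2, k3, k4, k5⟩ := key x z y w (by linarith [c3.1]) (by linarith [c3.2])
    have := le_max_left (greenDist μ x z + greenDist μ y w) (greenDist μ x w + greenDist μ y z)
    linarith

theorem SWalk.memD (W : SWalk μ T κ) (hyp : IsHyperbolic (wordDist T)) : MemD (greenDist μ) :=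
  ⟨W.gd_metric, W.gd_left, W.gd_hyp hyp, T, W.gen, W.gd_qi⟩
end



section
variable {μ : G → ℝ} {T : Finset G} {κ δ : ℝ}

theorem SWalk.ruler (W : SWalk μ T κ) (hyp : IsHyperbolic (wordDist T)) :
    ∃ K M : ℝ, 0 ≤ K ∧ 0 ≤ M ∧ ∀ u t, 0 ≤ t → t ≤ greenDist μ 1 u →
      ∃ x, t ≤ greenDist μ 1 x ∧ greenDist μ 1 x ≤ t + M ∧
        greenDist μ 1 x + greenDist μ x u ≤ greenDist μ 1 u + K := by
  obtain ⟨c, hc, hA⟩ := W.ancona_gd hyp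
  obtain ⟨Λ, c', hΛ, -, hw, -⟩ := W.gd_word
  refine ⟨c, Λ, hc, by linarith, fun u t ht0 ht => ?_⟩
  obtain ⟨n, p, hn, p0, pn, hp⟩ := wd_geodesic W.gen 1 u
  classical
  have hex : ∃ i, i ≤ n ∧ t ≤ greenDist μ 1 (p i) := ⟨n, le_rfl, by rw [pn]; exact ht⟩
  obtain ⟨hin, hi⟩ := Nat.find_spec hex
  have hmin := fun j => Nat.find_min (m := j) hex
  set i := Nat.find hex
  have d1 := hp 0 i (Nat.zero_le _) hin
  have d2 := hp i n hin le_rfl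
  rw [p0] at d1; rw [pn] at d2
  refine ⟨p i, hi, ?_, hA 1 (p i) u (by rw [d1, d2, ← hn]; push_cast; ring)⟩
  rcases Nat.eq_zero_or_pos i with h0 | h0
  · rw [h0, p0, W.gd_metric.refl]; linarith
  · have h1 := hmin (i - 1) (by omega)
    have h2 : greenDist μ 1 (p (i - 1)) < t := by
      by_contra hcon
      exact h1 ⟨by omega, not_lt.1 hcon⟩
    have h3 := hw (p (i - 1)) (p i)
    rw [hp (i - 1) i (by omega) hin, Nat.cast_sub h0] at h3
    have h4 := W.gd_metric.triangle 1 (p (i - 1)) (p i)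
    push_cast at h3
    linarith

def wcons (s : G) (ω : ℕ → G) : ℕ → G := fun n => Nat.casesOn n s ω

theorem walkPos_cons (s : G) (ω : ℕ → G) (n : ℕ) :
    walkPos (n + 1) (wcons s ω) = s * walkPos n ω := by
  unfold walkPos
  rw [List.range_succ_eq_map, List.map_cons, List.prod_cons, List.map_map]
  rfl

theorem walkPos_zero (ω : ℕ → G) : walkPos 0 ω = 1 := rfl

theorem walkPos_succ (ω : ℕ → G) (n : ℕ) : walkPos (n + 1) ω = walkPos n ω * ω n := by
  unfold walkPos
  rw [List.range_succ, List.map_append, List.prod_append]; simp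

variable [Countable G] [MeasurableSpace G] [MeasurableSingletonClass G]

theorem walkPos_meas (n : ℕ) : Measurable (walkPos n : (ℕ → G) → G) := by
  induction n with
  | zero => exact measurable_const
  | succ n ih =>
    have : (walkPos (n + 1) : (ℕ → G) → G) = fun ω => walkPos n ω * ω n := by
      funext ω; exact walkPos_succ ω n
    rw [this]
    exact (Measurable.of_discrete (f := fun p : G × G => p.1 * p.2)).comp
      (ih.prodMk (measurable_pi_apply n))

theorem wcons_meas (s : G) : Measurable (wcons s) := by
  rw [measurable_pi_iff]
  intro n
  cases n with
  | zero => exact measurable_const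
  | succ n => exact measurable_pi_apply n

def cyl (n : ℕ) (g : Fin n → G) : Set (ℕ → G) := {ω | ∀ i : Fin n, ω (i : ℕ) = g i}

theorem cyl_meas (n : ℕ) (g : Fin n → G) : MeasurableSet (cyl n g) := by
  have : cyl n g = ⋂ i : Fin n, (fun ω : ℕ → G => ω i) ⁻¹' {g i} := by
    ext ω; simp [cyl]
  rw [this]
  exact MeasurableSet.iInter fun i => measurable_pi_apply _ (measurableSet_singleton _)

def cyls (G : Type*) : Set (Set (ℕ → G)) :=
  {E | ∃ (n : ℕ) (g : Fin n → G), E = {ω | ∀ i : Fin n, ω (i : ℕ) = g i}}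

theorem cyl_inter {n m : ℕ} (hnm : n ≤ m) (g : Fin n → G) (h : Fin m → G)
    (hne : (cyl n g ∩ cyl m h).Nonempty) : cyl n g ∩ cyl m h = cyl m h := by
  obtain ⟨ω₀, h1, h2⟩ := hne
  refine inter_eq_right.2 fun ω hω i => ?_
  have a := hω ⟨i, by omega⟩
  have b := h2 ⟨i, by omega⟩
  have c := h1 i
  simp only at a b
  rw [a, ← b, c]

theorem cyls_pi : IsPiSystem (cyls G) := by
  rintro _ ⟨n, g, rfl⟩ _ ⟨m, h, rfl⟩ hne
  rcases le_total n m with hnm | hnm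
  · exact ⟨m, h, cyl_inter hnm g h hne⟩
  · refine ⟨n, g, ?_⟩
    have := cyl_inter hnm h g (by rw [inter_comm]; exact hne)
    rw [inter_comm]; exact this

theorem cyls_gen : (MeasurableSpace.pi : MeasurableSpace (ℕ → G)) =
    MeasurableSpace.generateFrom (cyls G) := by
  apply le_antisymm
  · refine iSup_le fun i => ?_
    rintro _ ⟨s, -, rfl⟩
    have : (fun ω : ℕ → G => ω i) ⁻¹' s =
        ⋃ g : {g : Fin (i + 1) → G // g (Fin.last i) ∈ s}, cyl (i + 1) g.1 := by
      ext ω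
      simp only [mem_preimage, mem_iUnion]
      constructor
      · intro h
        exact ⟨⟨fun j => ω j, by simpa using h⟩, fun j => rfl⟩
      · rintro ⟨⟨g, hg⟩, h⟩
        have := h (Fin.last i)
        simp only [Fin.val_last] at this
        rw [this]; exact hg
    rw [this]
    exact MeasurableSet.iUnion fun g => MeasurableSpace.measurableSet_generateFrom ⟨_, _, rfl⟩
  · refine MeasurableSpace.generateFrom_le ?_
    rintro _ ⟨n, g, rfl⟩
    exact cyl_meas n g

theorem Walk.markov (W : Walk μ T) {P : Measure (ℕ → G)} (hP : IsWalkMeasure μ P)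
    {E : Set (ℕ → G)} (hE : MeasurableSet E) :
    P E = ∑ s ∈ T, ENNReal.ofReal (μ s) * P (wcons s ⁻¹' E) := by
  classical
  have := hP.1
  set P' : Measure (ℕ → G) := ∑ s ∈ T, ENNReal.ofReal (μ s) • P.map (wcons s) with hP'
  have hap : ∀ E : Set (ℕ → G), MeasurableSet E →
      P' E = ∑ s ∈ T, ENNReal.ofReal (μ s) * P (wcons s ⁻¹' E) := by
    intro E hE
    rw [hP', Measure.finsetSum_apply]
    refine Finset.sum_congr rfl fun s hs => ?_
    rw [Measure.smul_apply, Measure.map_apply (wcons_meas s) hE, smul_eq_mul]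
  have hone : ∑ s ∈ T, ENNReal.ofReal (μ s) = 1 := by
    rw [← ENNReal.ofReal_sum_of_nonneg fun s hs => W.nn s, W.sum, ENNReal.ofReal_one]
  have key : P = P' := by
    refine ext_of_generate_finite (cyls G) cyls_gen cyls_pi ?_ ?_
    · rintro _ ⟨n, g, rfl⟩
      rw [hap {ω : ℕ → G | ∀ i : Fin n, ω (i : ℕ) = g i} (cyl_meas n g), hP.2]
      cases n with
      | zero => simp [hone]
      | succ n =>
        have h1 : ∀ s, P (wcons s ⁻¹' {ω | ∀ i : Fin (n + 1), ω (i : ℕ) = g i}) =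
            if s = g 0 then ∏ i : Fin n, ENNReal.ofReal (μ (g i.succ)) else 0 := by
          intro s
          split_ifs with h
          · rw [← hP.2]
            congr 1
            ext ω
            simp only [mem_preimage, mem_setOf_eq, Fin.forall_fin_succ]
            simp [wcons, h]
          · convert measure_empty (μ := P)
            ext ω
            simp only [mem_preimage, mem_setOf_eq, Fin.forall_fin_succ]
            simp [wcons, h]
        simp only [h1, mul_ite, mul_zero, Finset.sum_ite_eq']
        rw [Fin.prod_univ_succ]
        split_ifs with h
        · rfl
        · have : μ (g 0) = 0 := by
            by_contra hc; exact h ((W.mem _).2 hc)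
          simp [this]
    · rw [hap _ MeasurableSet.univ]; simp [hone]
  conv_lhs => rw [key]
  exact hap E hE
end



section
variable {μ : G → ℝ} {T : Finset G} {κ δ : ℝ}
variable [Countable G] [MeasurableSpace G] [MeasurableSingletonClass G]

theorem Walk.markov_real (W : Walk μ T) {P : Measure (ℕ → G)} (hP : IsWalkMeasure μ P)
    {E : Set (ℕ → G)} (hE : MeasurableSet E) :
    P.real E = ∑ s ∈ T, μ s * P.real (wcons s ⁻¹' E) := by
  have := hP.1
  unfold Measure.real
  rw [W.markov hP hE, ENNReal.toReal_sum fun s _ => ENNReal.mul_ne_top ENNReal.ofReal_ne_top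
    (measure_ne_top _ _)]
  exact Finset.sum_congr rfl fun s _ => by rw [ENNReal.toReal_mul, ENNReal.toReal_ofReal (W.nn s)]

def hitEv (U : Set G) (y : G) : Set (ℕ → G) := {ω | ∃ n, y * walkPos n ω ∈ U}
def inEv (V : Set G) (y : G) : Set (ℕ → G) := {ω | ∀ᶠ n in atTop, y * walkPos n ω ∈ V}

theorem pos_meas (U : Set G) (y : G) (n : ℕ) : MeasurableSet {ω : ℕ → G | y * walkPos n ω ∈ U} := by
  have : Measurable fun ω : ℕ → G => y * walkPos n ω :=
    (Measurable.of_discrete (f := fun g : G => y * g)).comp (walkPos_meas n)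
  exact this (Set.to_countable U).measurableSet

theorem hitEv_meas (U : Set G) (y : G) : MeasurableSet (hitEv U y) := by
  have : hitEv U y = ⋃ n, {ω : ℕ → G | y * walkPos n ω ∈ U} := by ext; simp [hitEv]
  rw [this]; exact MeasurableSet.iUnion fun n => pos_meas U y n

theorem inEv_meas (U : Set G) (y : G) : MeasurableSet (inEv U y) := by
  have : inEv U y = ⋃ N, ⋂ n, ⋂ (_ : N ≤ n), {ω : ℕ → G | y * walkPos n ω ∈ U} := by
    ext; simp [inEv, eventually_atTop]
  rw [this]
  exact MeasurableSet.iUnion fun N => MeasurableSet.iInter fun n => MeasurableSet.iInter fun _ =>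
    pos_meas U y n

theorem hitEv_cons {U : Set G} {y : G} (hy : y ∉ U) (s : G) :
    wcons s ⁻¹' (hitEv U y) = hitEv U (y * s) := by
  ext ω
  simp only [hitEv, mem_preimage, mem_setOf_eq]
  constructor
  · rintro ⟨n, hn⟩
    cases n with
    | zero => rw [walkPos_zero, mul_one] at hn; exact absurd hn hy
    | succ n => rw [walkPos_cons, ← mul_assoc] at hn; exact ⟨n, hn⟩
  · rintro ⟨n, hn⟩
    exact ⟨n + 1, by rw [walkPos_cons, ← mul_assoc]; exact hn⟩

theorem inEv_cons (V : Set G) (y : G) (s : G) :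
    wcons s ⁻¹' (inEv V y) = inEv V (y * s) := by
  ext ω
  simp only [inEv, mem_preimage, mem_setOf_eq]
  conv_lhs => rw [← map_add_atTop_eq_nat 1, eventually_map]
  simp only [walkPos_cons, mul_assoc]

theorem Walk.law (W : Walk μ T) {P : Measure (ℕ → G)} (hP : IsWalkMeasure μ P) (n : ℕ) (g : G) :
    P.real {ω | walkPos n ω = g} = convPow μ n g := by
  have := hP.1
  classical
  induction n generalizing g with
  | zero =>
    simp only [walkPos_zero, convPow]
    by_cases h : g = 1
    · simp [h]
    · simp [h, Ne.symm h]
  | succ n ih =>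
    have hm : MeasurableSet {ω : ℕ → G | walkPos (n + 1) ω = g} := by
      have := pos_meas {g} 1 (n + 1)
      simpa using this
    rw [W.markov_real hP hm, W.conv_succ_left, ← W.sum_inv]
    refine Finset.sum_congr rfl fun s _ => ?_
    rw [← ih]
    congr 2
    ext ω
    simp only [mem_preimage, mem_setOf_eq, walkPos_cons]
    constructor
    · intro h; rw [← h]; group
    · intro h; rw [h]; group

theorem SWalk.hit_le_G0 (W : SWalk μ T κ) {P : Measure (ℕ → G)} (hP : IsWalkMeasure μ P)
    (A : Finset G) (y : G) :
    P.real (hitEv (A : Set G) y) ≤ ∑ a ∈ A, G0 μ (a⁻¹ * y) := by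
  have := hP.1
  have h1 : ∀ a, P {ω | ∃ n, y * walkPos n ω = a} ≤ ENNReal.ofReal (G0 μ (a⁻¹ * y)) := by
    intro a
    have e : {ω : ℕ → G | ∃ n, y * walkPos n ω = a} = ⋃ n, {ω | walkPos n ω = y⁻¹ * a} := by
      ext ω; simp [eq_inv_mul_iff_mul_eq]
    rw [e]
    refine (measure_iUnion_le _).trans ?_
    have e2 : G0 μ (a⁻¹ * y) = ∑' n, convPow μ n (y⁻¹ * a) := by
      rw [← W.G0_inv]; unfold G0; simp
    rw [e2, ENNReal.ofReal_tsum_of_nonneg (fun n => W.conv_nonneg n _) (W.summable _)]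
    refine ENNReal.tsum_le_tsum fun n => ?_
    rw [← W.law hP, ofReal_measureReal]
  have e : hitEv (A : Set G) y = ⋃ a ∈ A, {ω | ∃ n, y * walkPos n ω = a} := by
    ext ω
    simp only [hitEv, mem_setOf_eq, mem_iUnion, Finset.mem_coe]
    constructor
    · rintro ⟨n, hn⟩; exact ⟨_, hn, n, rfl⟩
    · rintro ⟨a, ha, n, rfl⟩; exact ⟨n, ha⟩
  have h2 : P (hitEv (A : Set G) y) ≤ ENNReal.ofReal (∑ a ∈ A, G0 μ (a⁻¹ * y)) := by
    rw [e, ENNReal.ofReal_sum_of_nonneg fun a _ => W.G0_nonneg _]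
    exact (measure_biUnion_finset_le _ _).trans (Finset.sum_le_sum fun a _ => h1 a)
  exact ENNReal.toReal_le_of_le_ofReal (Finset.sum_nonneg fun a _ => W.G0_nonneg _) h2

theorem SWalk.gd_exp (W : SWalk μ T κ) (x y : G) : Fk μ (x⁻¹ * y) = Real.exp (- greenDist μ x y) := by
  rw [W.gd_eq, neg_neg, Real.exp_log (W.Fk_pos _)]

theorem SWalk.hit_fin (W : SWalk μ T κ) {P : Measure (ℕ → G)} (hP : IsWalkMeasure μ P)
    {K : ℝ} (x : G) (A : Finset G)
    (hA : ∀ y ∈ A, greenDist μ 1 x + greenDist μ x y ≤ greenDist μ 1 y + K) :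
    P.real (hitEv (A : Set G) 1) ≤ Real.exp K * Real.exp (- greenDist μ 1 x) := by
  classical
  have := hP.1
  set u : G → ℝ := fun y => P.real (hitEv (A : Set G) y) with hu
  have u0 : ∀ y, 0 ≤ u y := fun y => measureReal_nonneg
  have u1 : ∀ y, u y ≤ 1 := fun y => measureReal_le_one
  have uA : ∀ y ∈ A, u y = 1 := by
    intro y hy
    have : hitEv (A : Set G) y = univ := by
      ext ω; simp only [hitEv, mem_setOf_eq, mem_univ, iff_true]
      exact ⟨0, by rw [walkPos_zero, mul_one]; exact hy⟩
    simp [hu, this]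
  have uP : ∀ y, y ∉ A → u y = Pop μ T u y := by
    intro y hy
    have := W.markov_real hP (hitEv_meas (A : Set G) y)
    simp only [hitEv_cons (show y ∉ (A : Set G) from hy)] at this
    exact this
  have uG : ∀ y, u y ≤ ∑ a ∈ A, G0 μ (a⁻¹ * y) := fun y => W.hit_le_G0 hP A y
  set q : G → ℝ := fun y => u y - Pop μ T u y with hq
  have Pu1 : ∀ y, Pop μ T u y ≤ 1 := by
    intro y
    rw [← W.sum]
    exact Finset.sum_le_sum fun s _ => mul_le_of_le_one_right (W.nn s) (u1 _)
  have q0 : ∀ y, 0 ≤ q y := by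
    intro y
    by_cases hy : y ∈ A
    · have := Pu1 y; simp only [hq, uA y hy]; linarith
    · simp only [hq]; rw [← uP y hy]; simp
  set w : G → ℝ := fun v => ∑ a ∈ A, q a * G0 μ (a⁻¹ * v) with hw
  have wP : ∀ y, w y = Pop μ T w y + q y := by
    intro y
    have e1 : Pop μ T w y = ∑ a ∈ A, q a * Pop μ T (G0 μ) (a⁻¹ * y) := by
      simp only [hw, Pop, Finset.mul_sum]
      rw [Finset.sum_comm]
      refine Finset.sum_congr rfl fun a _ => Finset.sum_congr rfl fun s _ => ?_
      rw [mul_assoc a⁻¹]; ring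
    have e2 : ∀ a, G0 μ (a⁻¹ * y) = Pop μ T (G0 μ) (a⁻¹ * y) + if a = y then 1 else 0 := by
      intro a
      split_ifs with h
      · subst h; rw [inv_mul_cancel, W.G0_one]; ring
      · rw [add_zero]; refine W.G0_pop fun h' => h ?_
        rw [inv_mul_eq_one] at h'; exact h'
    have e3 : w y = ∑ a ∈ A, q a * (Pop μ T (G0 μ) (a⁻¹ * y) + if a = y then 1 else 0) :=
      Finset.sum_congr rfl fun a _ => by rw [e2]
    rw [e3, e1]
    simp only [mul_add, Finset.sum_add_distrib, mul_ite, mul_one, mul_zero, Finset.sum_ite_eq']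
    split_ifs with h
    · rfl
    · simp only [hq]; rw [← uP y h]; simp
  have hD : ∀ v, u v - w v = Pop μ T (fun v => u v - w v) v := by
    intro v
    rw [pop_sub]
    have := wP v
    simp only [hq] at this
    linarith
  have w0 : ∀ v, 0 ≤ w v := fun v => Finset.sum_nonneg fun a _ => mul_nonneg (q0 a) (W.G0_nonneg _)
  have d1 : u 1 - w 1 ≤ 0 := by
    refine W.maxprin (D := fun v => u v - w v) (B := ∅) A (fun _ => 1) (fun _ => zero_le_one) ?_ ?_ ?_ 1
    · intro v; simp only [one_mul]; linarith [uG v, w0 v]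
    · intro v hv; exact absurd hv (notMem_empty v)
    · intro v _; exact (hD v).le
  have d2 : w x - u x ≤ 0 := by
    refine W.maxprin (D := fun v => w v - u v) (B := ∅) A q q0 ?_ ?_ ?_ x
    · intro v; linarith [u0 v]
    · intro v hv; exact absurd hv (notMem_empty v)
    · intro v _
      have := hD v
      rw [pop_sub] at this ⊢
      linarith
  have d3 : w 1 ≤ Real.exp K * Real.exp (- greenDist μ 1 x) * w x := by
    simp only [hw, Finset.mul_sum]
    refine Finset.sum_le_sum fun a ha => ?_
    have f1 : G0 μ (a⁻¹ * 1) ≤ Real.exp K * Real.exp (- greenDist μ 1 x) * G0 μ (a⁻¹ * x) := by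
      have g := W.G0_pos 1
      have e1 : G0 μ (a⁻¹ * 1) = Real.exp (- greenDist μ a 1) * G0 μ 1 := by
        rw [← W.gd_exp, Fk]; field_simp
      have e2 : G0 μ (a⁻¹ * x) = Real.exp (- greenDist μ a x) * G0 μ 1 := by
        rw [← W.gd_exp, Fk]; field_simp
      rw [e1, e2, ← mul_assoc, ← Real.exp_add, ← Real.exp_add]
      refine mul_le_mul_of_nonneg_right (Real.exp_le_exp.2 ?_) g.le
      have := hA a ha
      have s1 := W.gd_metric.symm a 1
      have s2 := W.gd_metric.symm a x
      linarith
    calc q a * G0 μ (a⁻¹ * 1) ≤ q a * (Real.exp K * Real.exp (- greenDist μ 1 x) * G0 μ (a⁻¹ * x)) :=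
          mul_le_mul_of_nonneg_left f1 (q0 a)
      _ = _ := by ring
  have d4 : w x ≤ 1 := by linarith [u1 x]
  have d5 : 0 < Real.exp K * Real.exp (- greenDist μ 1 x) := by positivity
  change u 1 ≤ _
  nlinarith

theorem SWalk.hit_le (W : SWalk μ T κ) {P : Measure (ℕ → G)} (hP : IsWalkMeasure μ P)
    {K : ℝ} (x : G) (U : Set G)
    (hU : ∀ y ∈ U, greenDist μ 1 x + greenDist μ x y ≤ greenDist μ 1 y + K) :
    P.real (hitEv U 1) ≤ Real.exp K * Real.exp (- greenDist μ 1 x) := by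
  classical
  have := hP.1
  set A : ℕ → Finset G := fun R => (wball W.gen R).filter (· ∈ U) with hA
  have hmono : Monotone fun R => hitEv (A R : Set G) 1 := by
    intro R R' h ω ⟨n, hn⟩
    refine ⟨n, ?_⟩
    simp only [hA, Finset.mem_coe, Finset.mem_filter, mem_wball] at hn ⊢
    exact ⟨hn.1.trans h, hn.2⟩
  have e : hitEv U 1 = ⋃ R, hitEv (A R : Set G) 1 := by
    ext ω
    simp only [mem_iUnion]
    constructor
    · rintro ⟨n, hn⟩
      refine ⟨wordLength T (1 * walkPos n ω), n, ?_⟩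
      simp only [hA, Finset.mem_coe, Finset.mem_filter, mem_wball]
      exact ⟨le_rfl, hn⟩
    · rintro ⟨R, n, hn⟩
      simp only [hA, Finset.mem_coe, Finset.mem_filter] at hn
      exact ⟨n, hn.2⟩
  refine ENNReal.toReal_le_of_le_ofReal (by positivity) ?_
  rw [e, hmono.measure_iUnion]
  refine iSup_le fun R => ?_
  rw [← ofReal_measureReal]
  refine ENNReal.ofReal_le_ofReal (W.hit_fin hP x (A R) fun y hy => hU y ?_)
  exact (Finset.mem_filter.1 hy).2

theorem SWalk.in_ge (W : SWalk μ T κ) {P : Measure (ℕ → G)} (hP : IsWalkMeasure μ P)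
    (V : Set G) (x : G) :
    Real.exp (- greenDist μ 1 x) * P.real (inEv V x) ≤ P.real (inEv V 1) := by
  have := hP.1
  set h : G → ℝ := fun y => P.real (inEv V y) with hh
  have h0 : ∀ y, 0 ≤ h y := fun y => measureReal_nonneg
  have hPop : ∀ y, h y = Pop μ T h y := by
    intro y
    have := W.markov_real hP (inEv_meas V y)
    simp only [inEv_cons] at this
    exact this
  have g := W.G0_pos (1 : G)
  have key := W.maxprin (D := fun v => h x / G0 μ 1 * G0 μ (x⁻¹ * v) - h v) (B := {x}) {x}
    (fun _ => h x / G0 μ 1) (fun _ => div_nonneg (h0 x) g.le) ?_ ?_ ?_ 1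
  · have e : h x / G0 μ 1 * G0 μ (x⁻¹ * 1) = Real.exp (- greenDist μ 1 x) * h x := by
      rw [W.gd_metric.symm, ← W.gd_exp, Fk]; ring
    simp only [e] at key
    change _ ≤ h 1
    linarith
  · intro v; simp only [Finset.sum_singleton]; linarith [h0 v]
  · intro v hv
    rw [mem_singleton_iff.1 hv, inv_mul_cancel]
    simp only [tsub_le_iff_right, zero_add]
    rw [div_mul_cancel₀ _ g.ne']
  · intro v hv
    have e0 : x⁻¹ * v ≠ 1 := fun h' => hv (by rw [inv_mul_eq_one] at h'; exact h'.symm)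
    rw [pop_sub, ← hPop, pop_smul, W.G0_pop e0, pop_left]
end



section
variable {μ : G → ℝ} {T : Finset G} {κ δ : ℝ}

theorem gromov_nonneg {X : Type*} {d : X → X → ℝ} (hd : IsMetricFun d) (w x y : X) :
    0 ≤ gromov d w x y := by
  unfold gromov
  have := hd.triangle x w y
  have := hd.symm w y
  linarith

theorem gromov_le {X : Type*} {d : X → X → ℝ} (hd : IsMetricFun d) (w x y : X) :
    gromov d w x y ≤ d w x := by
  unfold gromov
  have := hd.triangle y x w
  have := hd.symm w x
  have := hd.symm x y
  linarith

variable [Countable G] [MeasurableSpace G] [MeasurableSingletonClass G]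

theorem SWalk.shadow (W : SWalk μ T κ) (hyp : IsHyperbolic (wordDist T))
    {P : Measure (ℕ → G)} (hP : IsWalkMeasure μ P) :
    ∃ C : ℝ, 1 ≤ C ∧ ∀ u t, P.real {ω | ∃ n, t ≤ gromov (greenDist μ) 1 u (walkPos n ω)} ≤
      C * Real.exp (-t) := by
  have := hP.1
  obtain ⟨δ, hδ, hg⟩ := W.gd_hyp hyp
  obtain ⟨K, M, hK, hM, hr⟩ := W.ruler hyp
  have gm := W.gd_metric
  refine ⟨Real.exp (2 * (K / 2 + M + δ)), Real.one_le_exp (by linarith), fun u t => ?_⟩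
  rcases lt_or_ge t 0 with ht | ht
  · have h1 : 1 ≤ Real.exp (2 * (K / 2 + M + δ)) := Real.one_le_exp (by linarith)
    have h2 : 1 ≤ Real.exp (-t) := Real.one_le_exp (by linarith)
    exact measureReal_le_one.trans (one_le_mul_of_one_le_of_one_le h1 h2)
  rcases lt_or_ge (greenDist μ 1 u) t with hu | hu
  · have : {ω : ℕ → G | ∃ n, t ≤ gromov (greenDist μ) 1 u (walkPos n ω)} = ∅ := by
      ext ω
      simp only [mem_setOf_eq, mem_empty_iff_false, iff_false, not_exists, not_le]
      intro n
      exact (gromov_le gm _ _ _).trans_lt hu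
    rw [this]; simp; positivity
  obtain ⟨x, x1, x2, x3⟩ := hr u t ht hu
  have h := W.hit_le hP (K := 2 * (K / 2 + M + δ)) x {y | t ≤ gromov (greenDist μ) 1 u y} ?_
  · have e : {ω : ℕ → G | ∃ n, t ≤ gromov (greenDist μ) 1 u (walkPos n ω)} =
        hitEv {y | t ≤ gromov (greenDist μ) 1 u y} 1 := by
      ext ω; simp [hitEv]
    rw [e]
    refine h.trans (mul_le_mul_of_nonneg_left (Real.exp_le_exp.2 (by linarith)) (by positivity))
  · intro y hy
    have h1 := hg 1 u x y
    have h2 : gromov (greenDist μ) 1 u x ≥ greenDist μ 1 x - K / 2 := by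
      unfold gromov
      have s1 := gm.symm u 1
      have s2 := gm.symm x 1
      have s3 := gm.symm u x
      linarith
    have hy' : t ≤ gromov (greenDist μ) 1 u y := hy
    have h3 : greenDist μ 1 x - K / 2 - M ≤ min (gromov (greenDist μ) 1 u x) (gromov (greenDist μ) 1 u y) :=
      le_min (by linarith) (by linarith)
    have h4 : greenDist μ 1 x - K / 2 - M - δ ≤ gromov (greenDist μ) 1 x y := by linarith
    unfold gromov at h4
    have s1 := gm.symm y 1
    have s2 := gm.symm x 1
    linarith

theorem SWalk.upper (W : SWalk μ T κ) (hyp : IsHyperbolic (wordDist T))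
    {ε C : ℝ} {B : Type*} [MetricSpace B] [MeasurableSpace B] [BorelSpace B]
    (bd : BoundaryData G (greenDist μ) B) (hv : IsVisualMetric (greenDist μ) bd ε C)
    {P : Measure (ℕ → G)} {ν : Measure B} (hν : IsHarmonicMeasure (greenDist μ) bd μ P ν) :
    ∃ C' : ℝ, 0 < C' ∧ ∀ b r, 0 < r → ν (ball b r) ≤ ENNReal.ofReal (C' * r ^ (1 / ε)) := by
  obtain ⟨hP, Z, Zm, hZ, rfl⟩ := hν
  have := hP.1
  obtain ⟨δ, hδ, hg⟩ := W.gd_hyp hyp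
  have gm := W.gd_metric
  obtain ⟨C1, hC1, hsh⟩ := W.shadow hyp hP
  obtain ⟨hε, hC, hv⟩ := hv
  refine ⟨C1 * Real.exp δ * C ^ (1 / ε), by positivity, fun b r hr => ?_⟩
  rw [Measure.map_apply Zm measurableSet_ball]
  obtain ⟨u, hu⟩ := bd.conv_surj b
  set t : ℝ := - Real.log (C * r) / ε with ht
  have hCr : 0 < C * r := by positivity
  have hti := bd.conv_tendstoInfinity u b hu
  obtain ⟨⟨N1, N2⟩, hN⟩ := eventually_atTop.1 (hti.eventually_ge_atTop t)
  set N := max N1 N2 with hNd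
  have hNu : ∀ n, N ≤ n → t ≤ gromov (greenDist μ) 1 (u n) (u N) := fun n hn =>
    hN (n, N) ⟨(le_max_left _ _).trans hn, le_max_right _ _⟩
  have hsub : P (Z ⁻¹' ball b r) ≤
      P {ω | ∃ n, t - δ ≤ gromov (greenDist μ) 1 (u N) (walkPos n ω)} := by
    refine measure_mono_ae ?_
    filter_upwards [hZ] with ω hω hb
    have hb' : dist (Z ω) b < r := hb
    have hev : ∀ᶠ n in atTop, t ≤ gromov (greenDist μ) 1 (u n) (walkPos n ω) := by
      by_cases hbe : b = Z ω
      · have := (bd.conv_iff u _ b hu).1 (hbe ▸ hω)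
        exact this.eventually_ge_atTop t
      · have h2 := (hv u _ b (Z ω) hu hω hbe).2
        have h3 : Real.exp (-ε * seqGromov (greenDist μ) u fun n => walkPos n ω) < C * r := by
          rw [dist_comm] at hb'
          exact h2.trans_lt (mul_lt_mul_of_pos_left hb' hC)
        have h4 := (Real.lt_log_iff_exp_lt hCr).2 h3
        have h5 : t < seqGromov (greenDist μ) u fun n => walkPos n ω := by
          rw [ht, div_lt_iff₀ hε]; linarith
        have := eventually_lt_of_lt_liminf h5
          ⟨0, eventually_map.2 (Eventually.of_forall fun n => gromov_nonneg gm _ _ _)⟩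
        exact this.mono fun n hn => hn.le
    obtain ⟨n, hn1, hn2⟩ := (hev.and (eventually_ge_atTop N)).exists
    refine ⟨n, ?_⟩
    have h1 := hg 1 (u n) (u N) (walkPos n ω)
    have h2 := le_min (hNu n hn2) hn1
    linarith
  refine hsub.trans ?_
  rw [← ofReal_measureReal]
  refine ENNReal.ofReal_le_ofReal ((hsh _ _).trans (le_of_eq ?_))
  have e1 : C ^ (1 / ε) * r ^ (1 / ε) = Real.exp (-t) := by
    rw [← Real.mul_rpow hC.le hr.le, Real.rpow_def_of_pos hCr, ht]
    congr 1; ring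
  rw [mul_assoc, mul_assoc, e1, neg_sub, sub_eq_add_neg, Real.exp_add]

theorem SWalk.lower (W : SWalk μ T κ) (hyp : IsHyperbolic (wordDist T))
    {ε C : ℝ} {B : Type*} [MetricSpace B] [MeasurableSpace B] [BorelSpace B]
    (bd : BoundaryData G (greenDist μ) B) (hv : IsVisualMetric (greenDist μ) bd ε C)
    {P : Measure (ℕ → G)} {ν : Measure B} (hν : IsHarmonicMeasure (greenDist μ) bd μ P ν)
    (D : ℝ) (hD : 0 < D) :
    ∃ c : ℝ, 0 < c ∧ ∀ b r, 0 < r → r ≤ D → ENNReal.ofReal (c * r ^ (1 / ε)) ≤ ν (ball b r) := by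
  obtain ⟨hP, Z, Zm, hZ, rfl⟩ := hν
  have := hP.1
  obtain ⟨δ, hδ, hg⟩ := W.gd_hyp hyp
  have gm := W.gd_metric
  have gl := W.gd_left
  obtain ⟨C1, hC1, hsh⟩ := W.shadow hyp hP
  obtain ⟨K, M, hK, hM, hr⟩ := W.ruler hyp
  obtain ⟨hε, hC, hv⟩ := hv
  set T0 : ℝ := Real.log (2 * C1) with hT0
  have hT0p : 0 ≤ T0 := Real.log_nonneg (by linarith)
  set K3 : ℝ := 2 * δ + K / 2 + T0 with hK3
  have hK3p : 0 ≤ K3 := by rw [hK3]; linarith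
  set c1 : ℝ := min (Real.exp (-K3) * (1 / (2 * C)) ^ (1 / ε)) ((1 / D) ^ (1 / ε)) with hc1
  have hc1p : 0 < c1 := lt_min (by positivity) (by positivity)
  refine ⟨Real.exp (-M) / 2 * c1, by positivity, fun b r hr0 hrD => ?_⟩
  rw [Measure.map_apply Zm measurableSet_ball]
  obtain ⟨u, hu⟩ := bd.conv_surj b
  set t : ℝ := - Real.log (1 / (2 * C) * r) / ε with ht
  have hCr : 0 < 1 / (2 * C) * r := by positivity
  set t1 : ℝ := max 0 (t + K3) with ht1
  have hti := bd.conv_tendstoInfinity u b hu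
  obtain ⟨⟨N1, N2⟩, hN⟩ := eventually_atTop.1 (hti.eventually_ge_atTop (max (t + δ) t1))
  set N := max N1 N2 with hNd
  have hNu : ∀ n, N ≤ n → max (t + δ) t1 ≤ gromov (greenDist μ) 1 (u n) (u N) := fun n hn =>
    hN (n, N) ⟨(le_max_left _ _).trans hn, le_max_right _ _⟩
  have hNd1 : t1 ≤ greenDist μ 1 (u N) :=
    (le_max_right _ _).trans ((hNu N le_rfl).trans (gromov_le gm _ _ _))
  obtain ⟨x, x1, x2, x3⟩ := hr (u N) t1 (le_max_left _ _) hNd1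
  set V : Set G := {z | t + δ ≤ gromov (greenDist μ) 1 (u N) z} with hV
  have hsub : P (inEv V 1) ≤ P (Z ⁻¹' ball b r) := by
    refine measure_mono_ae ?_
    filter_upwards [hZ] with ω hω hb
    have hb' : ∀ᶠ n in atTop, 1 * walkPos n ω ∈ V := hb
    have hev : ∀ᶠ n in atTop, t ≤ gromov (greenDist μ) 1 (u n) (walkPos n ω) := by
      filter_upwards [hb', eventually_ge_atTop N] with n h1 h2
      rw [one_mul] at h1
      have h1' : t + δ ≤ gromov (greenDist μ) 1 (u N) (walkPos n ω) := h1
      have h3 := hg 1 (u N) (u n) (walkPos n ω)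
      have h4 := (le_max_left _ _).trans (hNu n h2)
      rw [gromov_comm gm.symm] at h4
      have := le_min h4 h1'
      linarith
    show dist (Z ω) b < r
    by_cases hbe : b = Z ω
    · rw [← hbe, dist_self]; exact hr0
    · have h2 := (hv u _ b (Z ω) hu hω hbe).1
      have h5 : t ≤ seqGromov (greenDist μ) u fun n => walkPos n ω := by
        refine le_liminf_of_le ?_ hev
        by_contra hcob
        refine hbe (bd.conv_unique (fun n => walkPos n ω) b (Z ω) ?_ hω)
        refine (bd.conv_iff u _ b hu).2 (tendsto_atTop.2 fun a => ?_)
        by_contra hna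
        refine hcob ⟨a, fun a' ha' => ?_⟩
        rw [eventually_map] at ha'
        by_contra hlt
        exact hna (ha'.mono fun n hn => by linarith [not_le.1 hlt])
      have h6 : Real.exp (-ε * seqGromov (greenDist μ) u fun n => walkPos n ω) ≤ Real.exp (-ε * t) :=
        Real.exp_le_exp.2 (by nlinarith)
      have h7 : Real.exp (-ε * t) = 1 / (2 * C) * r := by
        rw [ht]
        have : -ε * (-Real.log (1 / (2 * C) * r) / ε) = Real.log (1 / (2 * C) * r) := by
          field_simp
        rw [this, Real.exp_log hCr]
      rw [h7] at h6
      have h8 : C * (1 / (2 * C) * r) = r / 2 := by field_simp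
      have h9 := mul_le_mul_of_nonneg_left h6 hC.le
      rw [dist_comm]
      linarith
  have hx : 1 / 2 ≤ P.real (inEv V x) := by
    have s := hsh x⁻¹ T0
    have e : C1 * Real.exp (-T0) = 1 / 2 := by
      rw [Real.exp_neg, hT0, Real.exp_log (by linarith)]; field_simp
    rw [e] at s
    set E : Set (ℕ → G) := {ω | ∃ n, T0 ≤ gromov (greenDist μ) 1 x⁻¹ (walkPos n ω)} with hE
    have hEm : MeasurableSet E := by
      have : E = hitEv {y | T0 ≤ gromov (greenDist μ) 1 x⁻¹ y} 1 := by
        ext ω; simp [hitEv, hE]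
      rw [this]; exact hitEv_meas _ _
    have h1 : Eᶜ ⊆ inEv V x := by
      intro ω hω
      have hω' : ∀ n, gromov (greenDist μ) 1 x⁻¹ (walkPos n ω) < T0 := by
        intro n
        by_contra hc
        exact hω ⟨n, not_lt.1 hc⟩
      refine Eventually.of_forall fun n => ?_
      show t + δ ≤ gromov (greenDist μ) 1 (u N) (x * walkPos n ω)
      have a1 := hg 1 x (u N) (x * walkPos n ω)
      have a2 := hω' n
      set z := walkPos n ω
      have b1 : greenDist μ x⁻¹ z = greenDist μ 1 (x * z) := by
        have := gl x x⁻¹ z; rw [mul_inv_cancel] at this; exact this.symm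
      have b2 : greenDist μ x⁻¹ 1 = greenDist μ 1 x := by
        have := gl x x⁻¹ 1; rw [mul_inv_cancel, mul_one] at this; exact this.symm
      have b3 : greenDist μ z 1 = greenDist μ (x * z) x := by
        have := gl x z 1; rw [mul_one] at this; exact this.symm
      have s1 := gm.symm x 1
      have s2 := gm.symm (x * z) 1
      have s3 := gm.symm (x * z) x
      have s4 := gm.symm (u N) 1
      have a3 : greenDist μ 1 x - T0 ≤ gromov (greenDist μ) 1 x (x * z) := by
        unfold gromov at a2 ⊢
        linarith
      have a4 : greenDist μ 1 x - K / 2 ≤ gromov (greenDist μ) 1 x (u N) := by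
        unfold gromov
        linarith
      have a5 : greenDist μ 1 x - K / 2 - T0 ≤
          min (gromov (greenDist μ) 1 x (u N)) (gromov (greenDist μ) 1 x (x * z)) :=
        le_min (by linarith) (by linarith)
      have a6 : t + K3 ≤ t1 := le_max_right _ _
      linarith
    have h2 := measureReal_mono (μ := P) h1
    rw [probReal_compl_eq_one_sub hEm] at h2
    linarith
  have h3 := W.in_ge hP V x
  have h4 : c1 * r ^ (1 / ε) ≤ Real.exp (-t1) := by
    rcases le_total 0 (t + K3) with h | h
    · have e0 : t1 = t + K3 := max_eq_right h
      have e1 : (1 / (2 * C)) ^ (1 / ε) * r ^ (1 / ε) = Real.exp (-t) := by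
        rw [← Real.mul_rpow (by positivity) hr0.le, Real.rpow_def_of_pos hCr, ht]
        congr 1; ring
      calc c1 * r ^ (1 / ε) ≤ (Real.exp (-K3) * (1 / (2 * C)) ^ (1 / ε)) * r ^ (1 / ε) :=
            mul_le_mul_of_nonneg_right (min_le_left _ _) (by positivity)
        _ = Real.exp (-K3) * Real.exp (-t) := by rw [mul_assoc, e1]
        _ = Real.exp (-t1) := by rw [← Real.exp_add, e0]; congr 1; ring
    · have e0 : t1 = 0 := max_eq_left h
      rw [e0, neg_zero, Real.exp_zero]
      calc c1 * r ^ (1 / ε) ≤ (1 / D) ^ (1 / ε) * r ^ (1 / ε) :=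
            mul_le_mul_of_nonneg_right (min_le_right _ _) (by positivity)
        _ = (1 / D * r) ^ (1 / ε) := by rw [Real.mul_rpow (by positivity) hr0.le]
        _ ≤ 1 := by
          refine Real.rpow_le_one (by positivity) ?_ (by positivity)
          rw [one_div, inv_mul_le_iff₀ hD, mul_one]; exact hrD
  refine le_trans ?_ hsub
  rw [← ofReal_measureReal]
  refine ENNReal.ofReal_le_ofReal ?_
  have h5 : Real.exp (-M) * Real.exp (-t1) ≤ Real.exp (- greenDist μ 1 x) := by
    rw [← Real.exp_add]; exact Real.exp_le_exp.2 (by linarith)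
  calc Real.exp (-M) / 2 * c1 * r ^ (1 / ε) = Real.exp (-M) / 2 * (c1 * r ^ (1 / ε)) := by ring
    _ ≤ Real.exp (-M) / 2 * Real.exp (-t1) := mul_le_mul_of_nonneg_left h4 (by positivity)
    _ = (Real.exp (-M) * Real.exp (-t1)) * (1 / 2) := by ring
    _ ≤ Real.exp (- greenDist μ 1 x) * P.real (inEv V x) :=
        mul_le_mul h5 hx (by norm_num) (by positivity)
    _ ≤ _ := h3

theorem SWalk.ahlfors (W : SWalk μ T κ) (hyp : IsHyperbolic (wordDist T))
    {ε C : ℝ} {B : Type*} [MetricSpace B] [MeasurableSpace B] [BorelSpace B]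
    (bd : BoundaryData G (greenDist μ) B) (hv : IsVisualMetric (greenDist μ) bd ε C)
    {P : Measure (ℕ → G)} {ν : Measure B} (hν : IsHarmonicMeasure (greenDist μ) bd μ P ν) :
    AhlforsRegularOfDim ν (1 / ε) := by
  obtain ⟨C', hC', hup⟩ := W.upper hyp bd hv hν
  obtain ⟨c, hc, hlo⟩ := W.lower hyp bd hv hν (max (Metric.diam (Set.univ : Set B)) 1)
    (lt_max_of_lt_right one_pos)
  refine ⟨max C' c⁻¹, lt_max_of_lt_left hC', fun b r hr hrd => ⟨?_, ?_⟩⟩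
  · refine le_trans (ENNReal.ofReal_le_ofReal ?_) (hlo b r hr (hrd.trans (le_max_left _ _)))
    refine mul_le_mul_of_nonneg_right ?_ (by positivity)
    exact inv_le_of_inv_le₀ hc (le_max_right _ _)
  · refine (hup b r hr).trans (ENNReal.ofReal_le_ofReal ?_)
    exact mul_le_mul_of_nonneg_right (le_max_left _ _) (by positivity)
end

/-- **Corollary 1.2.**  For a finitely supported symmetric probability measure whose support
generates a non-elementary hyperbolic group, the Green metric is a left-invariant hyperbolic
metric quasi-isometric to the word metrics, and the harmonic measure is Ahlfors regular of
dimension `1/ε` for any visual metric of parameter `ε` (small enough) induced by `d_G`. -/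
theorem green_metric_memD_and_harmonic_ahlfors
    {G : Type*} [Group G] [Countable G] [MeasurableSpace G] [MeasurableSingletonClass G]
    (hG : NonElemHyperbolic G)
    (μ : G → ℝ) (hprob : IsProbDensity μ) (hsymm : IsSymmetric μ)
    (hfin : {g : G | μ g ≠ 0}.Finite) (hgen : GeneratesSupp μ) :
    MemD (greenDist μ) ∧
    ∃ ε₀ : ℝ, 0 < ε₀ ∧
      ∀ ε : ℝ, 0 < ε → ε ≤ ε₀ →
        ∀ (B : Type) [MetricSpace B] [MeasurableSpace B] [BorelSpace B],
          ∀ (bd : BoundaryData G (greenDist μ) B) (C : ℝ),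
            IsVisualMetric (greenDist μ) bd ε C →
            ∀ (P : Measure (ℕ → G)) (ν : Measure B),
              IsHarmonicMeasure (greenDist μ) bd μ P ν →
              AhlforsRegularOfDim ν (1 / ε) := by
  obtain ⟨hinf, -, hall⟩ := hG
  have hgenT : Generates hfin.toFinset := by
    unfold Generates; rw [hfin.coe_toFinset]; exact hgen
  have W : Walk μ hfin.toFinset :=
    { nn := hprob.1
      symm := hsymm
      mem := fun g => by simp
      sum := by
        rw [← hprob.2.tsum_eq]
        refine (tsum_eq_sum fun g hg => ?_).symm
        by_contra h
        exact hg (by simpa using h)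
      gen := hgenT }
  obtain ⟨hyp, hq⟩ := hall _ hgenT
  have hyp0 := hyp
  obtain ⟨δ, hδ, hyp⟩ := hyp
  obtain ⟨κ, k0, k1, hb⟩ := W.conv_bound hq hδ hyp
  have SW : SWalk μ hfin.toFinset κ := { toWalk := W, k0 := k0, k1 := k1, bd := hb }
  refine ⟨SW.memD hyp0, 1, one_pos, ?_⟩
  intro ε _ _ B _ _ _ bd C hv P ν hν
  exact SW.ahlfors hyp0 bd hv hν

end GHM
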